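/- Fix an integer k ≥ 3. Let (m_j) and (n_j) be sequences of positive integers tending to infinity with liminf m_j/n_j > 2/k, and let w_j → +∞. If m_j ≤ n_j − w_j for all j, then the probability that a uniformly random constrained k-XORSAT instance with m_j equations and n_j variables is satisfiable is 1 − O(m_j^{−(k−2)} + exp(−0.69 · w_j)); in particular it tends to 1. If m_j ≥ n_j + w_j for all j, then the satisfiability probability is O(2^{−w_j}); in particular it tends to 0. -/

import Mathlib

open scoped Classical

/-- The set of `m × n` matrices over `F₂` in which every row has exactly `k`
entries equal to `1` and every column has at least `2` entries equal to `1`. -/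
noncomputable def constrainedSet (k m n : ℕ) : Finset (Matrix (Fin m) (Fin n) (ZMod 2)) :=
  Finset.univ.filter (fun A =>
    (∀ i : Fin m, (Finset.univ.filter (fun j : Fin n => A i j = 1)).card = k) ∧
    (∀ j : Fin n, 2 ≤ (Finset.univ.filter (fun i : Fin m => A i j = 1)).card))

/-- The probability that a uniformly random constrained `k`-XORSAT instance with
`m` equations and `n` variables is satisfiable. -/
noncomputable def satProb (k m n : ℕ) : ℝ :=
  (((constrainedSet k m n ×ˢ (Finset.univ : Finset (Fin m → ZMod 2))).filter
      (fun p => ∃ x : Fin n → ZMod 2, p.1.mulVec x = p.2)).card : ℝ) /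
    (((constrainedSet k m n).card : ℝ) * 2 ^ m)

noncomputable def gg (z : ℝ) : ℝ := Real.exp z - 1 - z

theorem gg_pos {z : ℝ} (hz : z ≠ 0) : 0 < gg z := by
  have := Real.add_one_lt_exp hz
  unfold gg; linarith

theorem gg_ge {z : ℝ} (hz : 0 ≤ z) : z ^ 2 / 2 ≤ gg z := by
  have := Real.quadratic_le_exp_of_nonneg hz
  unfold gg; linarith

theorem gg_neg_le {v : ℝ} (hv : 0 ≤ v) : gg (-v) ≤ gg v := by
  have h : v ≤ Real.sinh v := Real.self_le_sinh_iff.2 hv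
  rw [Real.sinh_eq] at h
  unfold gg; linarith

theorem nonneg_of_deriv {f f' : ℝ → ℝ} (hf : ∀ x, HasDerivAt f (f' x) x) (h0 : f 0 = 0)
    (hp : ∀ x, 0 ≤ x → 0 ≤ f' x) : ∀ x, 0 ≤ x → 0 ≤ f x := by
  have hm : MonotoneOn f (Set.Ici 0) := by
    apply monotoneOn_of_deriv_nonneg (convex_Ici 0)
    · exact fun x _ => (hf x).continuousAt.continuousWithinAt
    · exact fun x _ => (hf x).differentiableAt.differentiableWithinAt
    · intro x hx
      rw [(hf x).deriv]
      rw [interior_Ici] at hx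
      exact hp x (le_of_lt hx)
  intro x hx
  have := hm (Set.mem_Ici.2 le_rfl) (Set.mem_Ici.2 hx) hx
  linarith

theorem Q_nonneg (z : ℝ) (hz : 0 ≤ z) :
    0 ≤ (z^2-4*z+2) * Real.exp z + (z^3+z^2+4*z-4) + 2 * Real.exp (-z) := by
  have hE : ∀ x : ℝ, HasDerivAt Real.exp (Real.exp x) x := Real.hasDerivAt_exp
  have hN : ∀ x : ℝ, HasDerivAt (fun x => Real.exp (-x)) (- Real.exp (-x)) x := by
    intro x
    have := (hasDerivAt_neg x).exp
    simpa using this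
  have hx1 : ∀ x : ℝ, HasDerivAt (fun x : ℝ => x) 1 x := fun x => hasDerivAt_id x
  have hx2 : ∀ x : ℝ, HasDerivAt (fun x : ℝ => x^2) (2*x) x := fun x => by
    simpa using hasDerivAt_pow 2 x
  have hx3 : ∀ x : ℝ, HasDerivAt (fun x : ℝ => x^3) (3*x^2) x := fun x => by
    simpa using hasDerivAt_pow 3 x
  have d5 : ∀ x : ℝ, 0 ≤ x → 0 ≤ (x^2+6*x+2)*Real.exp x - 2 * Real.exp (-x) := by
    intro x hx
    have h1 : 1 ≤ Real.exp x := Real.one_le_exp hx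
    have h2 : Real.exp (-x) ≤ 1 := Real.exp_le_one_iff.2 (by linarith)
    nlinarith [mul_nonneg (by positivity : 0 ≤ x^2+6*x) (Real.exp_pos x).le]
  have d4 : ∀ x : ℝ, 0 ≤ x → 0 ≤ (x^2+4*x-2)*Real.exp x + 2 * Real.exp (-x) := by
    apply nonneg_of_deriv _ (by simp) d5
    intro x
    have := ((((hx2 x).add ((hx1 x).const_mul 4)).sub_const 2).mul (hE x)).add ((hN x).const_mul 2)
    refine (this.congr_deriv ?_)
    simp; ring
  have d3 : ∀ x : ℝ, 0 ≤ x → 0 ≤ (x^2+2*x-4)*Real.exp x + 6 - 2 * Real.exp (-x) := by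
    apply nonneg_of_deriv _ (by norm_num) d4
    intro x
    have := (((((hx2 x).add ((hx1 x).const_mul 2)).sub_const 4).mul (hE x)).add_const 6).sub ((hN x).const_mul 2)
    refine (this.congr_deriv ?_)
    simp; ring
  have d2 : ∀ x : ℝ, 0 ≤ x → 0 ≤ (x^2-4)*Real.exp x + (6*x+2) + 2 * Real.exp (-x) := by
    apply nonneg_of_deriv _ (by norm_num) d3
    intro x
    have := ((((hx2 x).sub_const 4).mul (hE x)).add (((hx1 x).const_mul 6).add_const 2)).add ((hN x).const_mul 2)
    refine (this.congr_deriv ?_)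
    simp; ring
  have d1 : ∀ x : ℝ, 0 ≤ x → 0 ≤ (x^2-2*x-2)*Real.exp x + (3*x^2+2*x+4) - 2 * Real.exp (-x) := by
    apply nonneg_of_deriv _ (by norm_num) d2
    intro x
    have := (((((hx2 x).sub ((hx1 x).const_mul 2)).sub_const 2).mul (hE x)).add ((((hx2 x).const_mul 3).add ((hx1 x).const_mul 2)).add_const 4)).sub ((hN x).const_mul 2)
    refine (this.congr_deriv ?_)
    simp; ring
  have d0 : ∀ x : ℝ, 0 ≤ x → 0 ≤ (x^2-4*x+2)*Real.exp x + (x^3+x^2+4*x-4) + 2 * Real.exp (-x) := by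
    apply nonneg_of_deriv _ (by norm_num) d1
    intro x
    have := (((((hx2 x).sub ((hx1 x).const_mul 4)).add_const 2).mul (hE x)).add ((((hx3 x).add (hx2 x)).add ((hx1 x).const_mul 4)).sub_const 4)).add ((hN x).const_mul 2)
    refine (this.congr_deriv ?_)
    simp; ring
  exact d0 z hz

noncomputable def kap (z : ℝ) : ℝ := z * (Real.exp z - 1) / gg z

theorem gg_hasDeriv (z : ℝ) : HasDerivAt gg (Real.exp z - 1) z := by
  unfold gg
  exact ((Real.hasDerivAt_exp z).sub_const 1).sub (hasDerivAt_id z)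

theorem kap_ge {z : ℝ} (hz : 0 < z) : z ≤ kap z := by
  unfold kap
  rw [le_div_iff₀ (gg_pos hz.ne')]
  unfold gg; nlinarith

theorem kap_le {z : ℝ} (hz : 0 < z) : kap z ≤ 2 + z := by
  unfold kap
  rw [div_le_iff₀ (gg_pos hz.ne')]
  have := gg_ge hz.le
  unfold gg at *; nlinarith

theorem kap_two_lt {z : ℝ} (hz : 0 < z) : 2 ≤ kap z := by
  unfold kap
  rw [le_div_iff₀ (gg_pos hz.ne')]
  have key : ∀ x : ℝ, 0 ≤ x → 0 ≤ x * (Real.exp x - 1) - 2 * gg x := by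
    have d1 : ∀ x : ℝ, 0 ≤ x → 0 ≤ 1 * (Real.exp x - 1) + x * Real.exp x - 2 * (Real.exp x - 1) := by
      intro x hx
      have h1 := Real.add_one_le_exp (-x)
      have h2 : Real.exp x * Real.exp (-x) = 1 := by rw [← Real.exp_add]; simp
      nlinarith [Real.exp_pos x]
    refine nonneg_of_deriv (fun x => ?_) (by simp [gg]) d1
    exact ((hasDerivAt_id x).mul ((Real.hasDerivAt_exp x).sub_const 1)).sub ((gg_hasDeriv x).const_mul 2)
  have := key z hz.le
  linarith

theorem pp_mono : MonotoneOn (fun z : ℝ => (2*z*gg z - z^2*(Real.exp z - 1)) / gg z ^ 2) (Set.Ioi 0) := by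
  have hd : ∀ x : ℝ, 0 < x → HasDerivAt (fun z : ℝ => (2*z*gg z - z^2*(Real.exp z - 1)) / gg z ^ 2)
      (((2 * gg x + 2*x*(Real.exp x - 1) - (2*x*(Real.exp x - 1) + x^2 * Real.exp x)) * gg x ^ 2
        - (2*x*gg x - x^2*(Real.exp x - 1)) * (2 * gg x * (Real.exp x - 1))) / (gg x ^ 2)^2) x := by
    intro x hx
    have hx2 : HasDerivAt (fun x : ℝ => x^2) (2*x) x := by simpa using hasDerivAt_pow 2 x
    have hx1 : HasDerivAt (fun x : ℝ => 2*x) 2 x := by simpa using (hasDerivAt_id x).const_mul 2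
    have h1 := (hx1.mul (gg_hasDeriv x)).sub (hx2.mul ((Real.hasDerivAt_exp x).sub_const 1))
    have h2 : HasDerivAt (fun x : ℝ => gg x^2) (2*gg x * (Real.exp x - 1)) x := by
      have := (gg_hasDeriv x).pow 2
      refine this.congr_deriv ?_
      simp
    exact h1.div h2 (pow_ne_zero 2 (gg_pos hx.ne').ne')
  apply monotoneOn_of_deriv_nonneg (convex_Ioi 0)
  · exact fun x hx => (hd x hx).continuousAt.continuousWithinAt
  · intro x hx
    rw [interior_Ioi] at hx
    exact (hd x hx).differentiableAt.differentiableWithinAt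
  · intro x hx
    rw [interior_Ioi] at hx
    rw [(hd x hx).deriv]
    apply div_nonneg _ (by positivity)
    have hg := gg_pos (ne_of_gt hx)
    have hQ := Q_nonneg x (le_of_lt hx)
    have h2 : Real.exp x * Real.exp (-x) = 1 := by rw [← Real.exp_add]; simp
    have hQ2 : 0 ≤ (x^2-4*x+2) * Real.exp x^2 + (x^3+x^2+4*x-4) * Real.exp x + 2 := by
      have := mul_nonneg (Real.exp_pos x).le hQ
      nlinarith
    have : (2 * gg x + 2*x*(Real.exp x - 1) - (2*x*(Real.exp x - 1) + x^2 * Real.exp x)) * gg x ^ 2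
        - (2*x*gg x - x^2*(Real.exp x - 1)) * (2 * gg x * (Real.exp x - 1))
        = gg x * ((x^2-4*x+2) * Real.exp x^2 + (x^3+x^2+4*x-4) * Real.exp x + 2) := by
      unfold gg; ring
    rw [this]
    positivity

theorem L1 {z u : ℝ} (hz : 0 < z) (hu0 : 0 ≤ u) (hu1 : u ≤ 1) :
    gg (u*z) / gg z ≤ u^2 / (1 + (kap z - 2) * (1-u)) := by
  have hk := kap_two_lt hz
  have hg := gg_pos hz.ne'
  have hden : 0 < 1 + (kap z - 2) * (1-u) := by nlinarith
  rcases hu0.eq_or_lt with rfl | hu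
  · simp [gg]
  have hv : 0 < u * z := by positivity
  have hgv := gg_pos hv.ne'
  have hvz : u * z ≤ z := by nlinarith
  -- mean value
  have hd : ∀ x : ℝ, 0 < x → HasDerivAt (fun z : ℝ => z^2 / gg z) ((2*x*gg x - x^2*(Real.exp x - 1)) / gg x ^ 2) x := by
    intro x hx
    have hx2 : HasDerivAt (fun x : ℝ => x^2) (2*x) x := by simpa using hasDerivAt_pow 2 x
    exact hx2.div (gg_hasDeriv x) (gg_pos hx.ne').ne'
  have hmv := Convex.image_sub_le_mul_sub_of_deriv_le (convex_Icc (u*z) z) (f := fun z : ℝ => z^2 / gg z)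
    (fun x hx => (hd x (lt_of_lt_of_le hv hx.1)).continuousAt.continuousWithinAt)
    (fun x hx => by
      rw [interior_Icc] at hx
      exact (hd x (lt_trans hv hx.1)).differentiableAt.differentiableWithinAt)
    (C := (2*z*gg z - z^2*(Real.exp z - 1)) / gg z ^ 2)
    (fun x hx => by
      rw [interior_Icc] at hx
      rw [(hd x (lt_trans hv hx.1)).deriv]
      exact pp_mono (Set.mem_Ioi.2 (lt_trans hv hx.1)) (Set.mem_Ioi.2 hz) hx.2.le)
    (u*z) ⟨le_rfl, hvz⟩ z ⟨hvz, le_rfl⟩ hvz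
  have e1 : (2*z*gg z - z^2*(Real.exp z - 1)) / gg z ^ 2 = z * (2 - kap z) / gg z := by
    unfold kap; field_simp
  rw [e1] at hmv
  rw [div_le_div_iff₀ hg hden]
  have h3 : z^2 / gg z * (1 + (kap z - 2)*(1-u)) ≤ (u*z)^2 / gg (u*z) := by
    have : z * (2 - kap z) / gg z * (z - u*z) = - (z^2/gg z * ((kap z - 2)*(1-u))) := by
      field_simp; ring
    rw [this] at hmv
    linarith
  rw [le_div_iff₀ hgv] at h3
  have h4 : gg (u*z) * (1 + (kap z - 2)*(1-u)) * z^2 ≤ u^2 * gg z * z^2 := by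
    have := mul_le_mul_of_nonneg_right h3 hg.le
    have e : z^2 / gg z * (1 + (kap z - 2)*(1-u)) * gg (u*z) * gg z = gg (u*z) * (1 + (kap z - 2)*(1-u)) * z^2 := by
      field_simp
    rw [e] at this
    linarith
  exact le_of_mul_le_mul_right h4 (by positivity)

/-- F -/
noncomputable def FF (κ u : ℝ) : ℝ := (1 + u^2 / (1 + (κ-2)*(1-u))) / 2

theorem FF_pos {κ u : ℝ} (hκ : 2 ≤ κ) (hu1 : u ≤ 1) : 0 < FF κ u := by
  unfold FF
  have : 0 < 1 + (κ-2)*(1-u) := by nlinarith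
  positivity

theorem FF_L2 {κ K u : ℝ} (hκ : 2 ≤ κ) (hK : κ ≤ K) (hu0 : 0 ≤ u) (hu1 : u ≤ 1) :
    Real.log (FF κ u) ≤ κ / K * Real.log (FF K u) := by
  have hF : ∀ s, 2 ≤ s → 0 < FF s u := fun s hs => FF_pos hs hu1
  have hden : ∀ s : ℝ, 2 ≤ s → 0 < 1 + (s-2)*(1-u) := fun s hs => by nlinarith
  have hd : ∀ s, 2 ≤ s → HasDerivAt (fun s => FF s u) (-(u^2*(1-u)) / (1+(s-2)*(1-u))^2/2) s := by
    intro s hs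
    unfold FF
    have h1 : HasDerivAt (fun s : ℝ => 1+(s-2)*(1-u)) (1-u) s := by
      simpa using (((hasDerivAt_id s).sub_const 2).mul_const (1-u)).const_add 1
    have h2 := (((hasDerivAt_const s (u^2)).div h1 (hden s hs).ne').const_add 1).div_const 2
    refine h2.congr_deriv ?_
    simp
  have hd2 : ∀ s, 2 ≤ s → HasDerivAt (fun s => Real.log (FF s u) / s)
      (((-(u^2*(1-u)) / (1+(s-2)*(1-u))^2/2) / FF s u * s - Real.log (FF s u) * 1)/ s^2) s := by
    intro s hs
    exact ((hd s hs).log (hF s hs).ne').div (hasDerivAt_id s) (by simp; linarith)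
  have hm : MonotoneOn (fun s => Real.log (FF s u) / s) (Set.Icc 2 K) := by
    apply monotoneOn_of_deriv_nonneg (convex_Icc 2 K)
    · exact fun x hx => (hd2 x hx.1).continuousAt.continuousWithinAt
    · intro x hx
      rw [interior_Icc] at hx
      exact (hd2 x hx.1.le).differentiableAt.differentiableWithinAt
    · intro s hs
      rw [interior_Icc] at hs
      have hs2 := hs.1.le
      rw [(hd2 s hs2).deriv]
      apply div_nonneg _ (by positivity)
      have hl : Real.log (FF s u) ≤ FF s u - 1 := Real.log_le_sub_one_of_pos (hF s hs2)
      have hD := hden s hs2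
      have hFs := hF s hs2
      suffices h : 0 ≤ (-(u^2*(1-u)) / (1+(s-2)*(1-u))^2/2) / FF s u * s - (FF s u - 1) by linarith
      have e : FF s u = (1+(s-2)*(1-u) + u^2) / (2 * (1+(s-2)*(1-u))) := by
        unfold FF; field_simp
      have hN : 0 < 1+(s-2)*(1-u) + u^2 := by positivity
      rw [e]
      set D := 1+(s-2)*(1-u) with hDdef
      have : (-(u^2*(1-u)) / D^2/2) / ((D+u^2)/(2*D)) * s - ((D+u^2)/(2*D) - 1)
        = ((D - u^2) * (D+u^2) - 2 * s * u^2*(1-u)) / (2 * D * (D+u^2)) := by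
        field_simp; ring
      rw [this]
      apply div_nonneg _ (by positivity)
      rw [hDdef]
      have : (1 + (s - 2) * (1 - u) - u ^ 2) * (1 + (s - 2) * (1 - u) + u ^ 2) - 2 * s * u ^ 2 * (1 - u)
        = (1-u) * ((s-1+u) * (1 + (s - 2) * (1 - u) + u ^ 2) - 2 * s * u^2) := by ring
      rw [this]
      apply mul_nonneg (by linarith)
      obtain ⟨t, ht⟩ : ∃ t, s = 2 + t := ⟨s-2, by ring⟩
      have he : 0 ≤ t := by linarith
      have hv : 0 ≤ 1 - u := by linarith
      have e5 : (s - 1 + u) * (1 + (s - 2) * (1 - u) + u ^ 2) - 2 * s * u ^ 2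
        = (1-u) * ((1 + u + u * (1-u)) + 2 * t * (1+u) + t^2) := by rw [ht]; ring
      rw [e5]
      positivity
  have := hm ⟨hκ, hK⟩ ⟨hκ.trans hK, le_rfl⟩ hK
  simp only at this
  have hκ0 : 0 < κ := by linarith
  rw [div_le_iff₀ hκ0] at this
  calc _ ≤ _ := this
    _ = _ := by ring

theorem FF_L4 {κ K u : ℝ} (hκ : 2 ≤ κ) (hK : κ ≤ K) (hu0 : 0 ≤ u) (hu1 : u ≤ 1)
    (hu : (K+1) * u^2 ≤ 0.003) :
    Real.log (FF κ u) ≤ κ / K * Real.log (FF K u) - (1 - κ/K) * 0.69 := by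
  have hK0 : 0 < K := by linarith
  have hD1 : 1 ≤ 1 + (κ-2)*(1-u) := by nlinarith
  have hD2 : 1 ≤ 1 + (K-2)*(1-u) := by nlinarith
  set p := u^2 / (1 + (κ-2)*(1-u)) with hp
  set P := u^2 / (1 + (K-2)*(1-u)) with hP
  have hp0 : 0 ≤ p := by positivity
  have hP0 : 0 ≤ P := by positivity
  have hPu : P ≤ u^2 := div_le_self (by positivity) hD2
  have hpP : p - P ≤ u^2 * (K - κ) := by
    rw [hp, hP, div_sub_div _ _ (by linarith) (by linarith), div_le_iff₀ (by positivity)]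
    have h1 : u^2 * (1 + (K-2)*(1-u)) - (1 + (κ-2)*(1-u)) * u^2 = u^2 * (K-κ) * (1-u) := by ring
    rw [h1]
    have h2 : 1 ≤ (1 + (κ-2)*(1-u)) * (1 + (K-2)*(1-u)) := by nlinarith
    have h3 : 0 ≤ u^2 * (K-κ) := mul_nonneg (sq_nonneg u) (by linarith)
    nlinarith
  have hl2 := Real.log_two_gt_d9
  have e1 : Real.log (FF κ u) = Real.log (1+p) - Real.log 2 := by
    unfold FF; rw [Real.log_div (by positivity) (by norm_num)]
  have e2 : Real.log (FF K u) = Real.log (1+P) - Real.log 2 := by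
    unfold FF; rw [Real.log_div (by positivity) (by norm_num)]
  have h1 : Real.log (1+p) ≤ Real.log (1+P) + (p - P)⊔0 := by
    rcases le_total p P with h | h
    · have : Real.log (1+p) ≤ Real.log (1+P) := Real.log_le_log (by positivity) (by linarith)
      have := le_max_right (p-P) 0
      linarith
    · have h5 : Real.log ((1+p)/(1+P)) ≤ (1+p)/(1+P) - 1 := Real.log_le_sub_one_of_pos (by positivity)
      rw [Real.log_div (by positivity) (by positivity)] at h5
      have h6 : (1+p)/(1+P) - 1 ≤ p - P := by
        rw [div_sub_one (by positivity), div_le_iff₀ (by positivity)]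
        nlinarith
      have := le_max_left (p-P) 0
      linarith
  have h2 : (p-P)⊔0 ≤ u^2*(K-κ) := max_le hpP (mul_nonneg (sq_nonneg u) (by linarith))
  have h3 : Real.log (1+P) ≤ u^2 := by
    have := Real.log_le_sub_one_of_pos (show 0 < 1+P by positivity)
    linarith
  have hc : 0 ≤ 1 - κ/K := by rw [sub_nonneg, div_le_one hK0]; exact hK
  have e3 : K - κ = K * (1 - κ/K) := by field_simp
  rw [e1, e2]
  rw [e3] at h2
  set c := κ/K
  have : (1-c) * Real.log (1+P) ≤ (1-c) * u^2 := mul_le_mul_of_nonneg_left h3 hc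
  have h7 : (1-c) * ((K+1)*u^2) ≤ (1-c) * 0.003 := mul_le_mul_of_nonneg_left hu hc
  have h8 : (1-c) * 0.693 ≤ (1-c) * Real.log 2 := mul_le_mul_of_nonneg_left (by linarith) hc
  nlinarith

theorem amgm_pow (n : ℕ) {r : ℝ} (h0 : 0 ≤ r) (h1 : r ≤ 1) :
    (2*n+1) * (1-r) * r^n ≤ 1 - r^(2*n+1) := by
  induction n with
  | zero => simp
  | succ n ih =>
    have h3 : r^(n+1) ≤ 1 := pow_le_one₀ h0 h1
    have hn : 0 ≤ r^n := by positivity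
    have e : 1 - r^(2*(n+1)+1) - (2*(n+1:ℕ)+1) * (1-r) * r^(n+1)
      = r * (1 - r^(2*n+1) - (2*n+1) * (1-r) * r^n) + (1 - r) * (1 - r^(n+1))^2 := by
      push_cast; ring
    have h4 := mul_nonneg h0 (sub_nonneg.2 ih)
    have h5 := mul_nonneg (sub_nonneg.2 h1) (sq_nonneg (1 - r^(n+1)))
    linarith

theorem bern2 (n : ℕ) (hn : 2 ≤ n) {y : ℝ} (h0 : 0 ≤ y) (h1 : y ≤ 1) :
    1 - n*y + y^2 ≤ (1-y)^n := by
  induction n, hn using Nat.le_induction with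
  | base => push_cast; nlinarith
  | succ n hn ih =>
    have hn' : (2:ℝ) ≤ n := by exact_mod_cast hn
    rw [pow_succ (1-y)]
    have := mul_le_mul_of_nonneg_right ih (sub_nonneg.2 h1)
    push_cast
    nlinarith [sq_nonneg y, mul_nonneg h0 (sq_nonneg y), mul_nonneg (sub_nonneg.2 h1) (sq_nonneg y), mul_nonneg (sub_nonneg.2 hn') (sq_nonneg y)]

/-- key inequality -/
theorem L3 (k : ℕ) (hk : 3 ≤ k) {r : ℝ} (h0 : 0 < r) (h1 : r ≤ 1) :
    FF k ((1 - r^(k-1))/(1+r^(k-1))) ≤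
      (1+r^k)^(k-1)/(1+r^(k-1))^k - (r^(k-1)*(1-r)/(1+r^(k-1)))^2/2 := by
  obtain ⟨j, rfl⟩ : ∃ j, k = j + 3 := ⟨k-3, by omega⟩
  have e0 : j + 3 - 1 = j + 2 := by omega
  rw [e0]
  set A := r^(j+2) with hA
  have hA0 : 0 < A := by positivity
  have hA1 : A ≤ 1 := pow_le_one₀ h0.le h1
  have hrk : r^(j+3) = r * A := by rw [hA]; ring
  rw [hrk]
  set y := A*(1-r)/(1+A) with hy
  have hy0 : 0 ≤ y := div_nonneg (mul_nonneg hA0.le (by linarith)) (by linarith)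
  have hy1 : y ≤ 1 := by
    rw [hy, div_le_one (by positivity)]; nlinarith
  have eV : (1+r*A)^(j+2)/(1+A)^(j+3) = (1-y)^(j+2) / (1+A) := by
    have : 1 - y = (1+r*A)/(1+A) := by rw [hy]; field_simp; ring
    rw [this, div_pow, pow_succ (1+A) (j+2)]; field_simp
  rw [eV]
  have hb := bern2 (j+2) (by omega) hy0 hy1
  have eF : FF ((j+3:ℕ):ℝ) ((1-A)/(1+A)) = (1 + (j+1)*A + (j+2)*A^2)/((1+A)*(1+(2*j+3)*A)) := by
    unfold FF; push_cast
    have h5 : 1 + ((j:ℝ)+3-2)*(1 - (1-A)/(1+A)) = (1+(2*j+3)*A)/(1+A) := by field_simp; ring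
    rw [h5]
    field_simp; ring
  rw [eF]
  have hy2 : y^2/2 ≤ y^2/(1+A) := by
    apply div_le_div_of_nonneg_left (by positivity) (by positivity) (by linarith)
  have h6 : (1 + (j+1)*A + (j+2)*A^2)/((1+A)*(1+(2*j+3)*A)) ≤ (1 - (j+2:ℕ)*y)/(1+A) := by
    have hAr : A = r * r^(j+1) := by rw [hA]; ring
    have ham := amgm_pow (j+1) h0.le h1
    have ha2 : r^(2*(j+1)+1) = A * r^(j+1) := by rw [hA]; ring
    rw [ha2] at ham
    push_cast at ham ⊢
    rw [hy, div_le_div_iff₀ (by positivity) (by positivity)]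
    have : (1 - ((j:ℝ)+2)*(A*(1-r)/(1+A))) * ((1+A)*(1+(2*j+3)*A)) - (1 + (j+1)*A + (j+2)*A^2) * (1+A)
       = (j+2) * A * ((1 - A)*(1+A) - (1-r)*(1+(2*j+3)*A)) := by
      field_simp; ring
    have h7 : (1 - A)*(1+A) - (1-r)*(1+(2*j+3)*A) = r * (1 - A*r^(j+1) - (2*(j+1)+1)*(1-r)*r^(j+1)) := by
      have : A * (r * r^(j+1)) = A * A := by rw [← hAr]
      have h' : (2*(j:ℝ)+3) * (1-r) * (r * r^(j+1)) = (2*(j:ℝ)+3) * (1-r) * A := by rw [← hAr]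
      nlinarith
    have h8 : 0 ≤ ((j:ℝ)+2) * A * ((1 - A)*(1+A) - (1-r)*(1+(2*j+3)*A)) := by
      rw [h7]
      apply mul_nonneg (by positivity)
      apply mul_nonneg h0.le
      linarith
    linarith
  have h9 : (1 - (j+2:ℕ)*y)/(1+A) + y^2/(1+A) ≤ (1-y)^(j+2)/(1+A) := by
    rw [← add_div]
    exact div_le_div_of_nonneg_right hb (by positivity)
  linarith

open Finset in
instance prodAntidiag : Finset.HasAntidiagonal (ℕ × ℕ) where
  antidiagonal p := ((antidiagonal p.1) ×ˢ (antidiagonal p.2)).map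
    ⟨fun x => ((x.1.1, x.2.1), (x.1.2, x.2.2)), by
      rintro ⟨⟨a,b⟩,⟨c,d⟩⟩ ⟨⟨a',b'⟩,⟨c',d'⟩⟩ h
      simp only [Prod.mk.injEq] at h ⊢
      tauto⟩
  mem_antidiagonal := by
    rintro ⟨a, b⟩ ⟨⟨c,d⟩,⟨e,f⟩⟩
    simp only [mem_map, mem_product, HasAntidiagonal.mem_antidiagonal, Function.Embedding.coeFn_mk, Prod.exists,
      Prod.mk.injEq, Prod.mk_add_mk]
    constructor
    · rintro ⟨a1, b1, a2, b2, ⟨h1, h2⟩, ⟨rfl, rfl⟩, rfl, rfl⟩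
      exact ⟨h1, h2⟩
    · rintro ⟨h1, h2⟩
      exact ⟨c, e, d, f, ⟨h1, h2⟩, rfl⟩

theorem sum_prodAntidiag {α : Type*} [AddCommMonoid α] (p : ℕ × ℕ) (f : (ℕ × ℕ) × (ℕ × ℕ) → α) :
    ∑ x ∈ Finset.HasAntidiagonal.antidiagonal p, f x = ∑ x ∈ Finset.HasAntidiagonal.antidiagonal p.1, ∑ y ∈ Finset.HasAntidiagonal.antidiagonal p.2,
      f ((x.1, y.1), (x.2, y.2)) := by
  rw [← Finset.sum_product']
  exact Finset.sum_map _ _ _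

/-- weights -/
noncomputable def gam (p : ℕ × ℕ) : ℝ :=
  if Even p.1 ∧ 2 ≤ p.1 + p.2 then 1 / ((p.1.factorial : ℝ) * p.2.factorial) else 0

theorem gam_nonneg (p : ℕ × ℕ) : 0 ≤ gam p := by
  unfold gam; split_ifs <;> positivity

/-- coefficient array -/
noncomputable def qq : ℕ → ℕ × ℕ → ℝ
  | 0, p => if p = 0 then 1 else 0
  | (n+1), p => ∑ x ∈ Finset.HasAntidiagonal.antidiagonal p, gam x.1 * qq n x.2

theorem qq_nonneg (n : ℕ) (p : ℕ × ℕ) : 0 ≤ qq n p := by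
  induction n generalizing p with
  | zero => unfold qq; split_ifs <;> norm_num
  | succ n ih => unfold qq; exact Finset.sum_nonneg fun x _ => mul_nonneg (gam_nonneg _) (ih _)

/-- monomial -/
noncomputable def mon (X Y : ℂ) (p : ℕ × ℕ) : ℂ := X^p.1 * Y^p.2

theorem mon_add (X Y : ℂ) (p q : ℕ × ℕ) : mon X Y (p+q) = mon X Y p * mon X Y q := by
  simp [mon, pow_add]; ring

theorem norm_mon (X Y : ℂ) (p : ℕ × ℕ) : (‖mon X Y p‖ : ℂ) = mon ‖X‖ ‖Y‖ p := by
  simp [mon]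

noncomputable def GC (X Y : ℂ) : ℂ := Complex.cosh X * Complex.exp Y - 1 - Y
noncomputable def GR (x y : ℝ) : ℝ := Real.cosh x * Real.exp y - 1 - y

theorem GC_ofReal (x y : ℝ) : GC x y = (GR x y : ℂ) := by
  simp [GC, GR]

theorem gam_term (X Y : ℂ) (p : ℕ × ℕ) : (gam p : ℂ) * mon X Y p =
      (X^p.1 / (p.1.factorial : ℂ) + (-X)^p.1 / (p.1.factorial : ℂ))/2 * (Y^p.2 / (p.2.factorial : ℂ))
      - (if p = (0,0) then (1:ℂ) else 0) - (if p = (0,1) then Y else 0) := by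
  obtain ⟨i, j⟩ := p
  simp only [gam, mon, Prod.mk.injEq]
  rcases Nat.even_or_odd i with hi | hi
  · rw [hi.neg_pow]
    by_cases hij : 2 ≤ i + j
    · have n1 : ¬ (i = 0 ∧ j = 0) := by omega
      have n2 : ¬ (i = 0 ∧ j = 1) := by omega
      simp only [hi, hij, n1, n2, true_and, if_true, if_false]
      push_cast
      field_simp
      ring
    · have i0 : i = 0 := by
        rcases hi with ⟨t, rfl⟩; omega
      subst i0
      have : j = 0 ∨ j = 1 := by omega
      rcases this with rfl | rfl <;> simp
  · have h' : ¬ Even i := Nat.not_even_iff_odd.2 hi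
    have i0 : i ≠ 0 := by rintro rfl; simp at h'
    rw [hi.neg_pow]
    simp [h', i0, neg_div]

theorem exp_hs (Z : ℂ) : HasSum (fun n : ℕ => Z^n / (n.factorial : ℂ)) (Complex.exp Z) := by
  rw [Complex.exp_eq_exp_ℂ]; exact NormedSpace.expSeries_div_hasSum_exp Z

theorem exp_hsn (Z : ℂ) : Summable (fun n : ℕ => ‖Z^n / (n.factorial : ℂ)‖) :=
  NormedSpace.norm_expSeries_div_summable Z

theorem cosh_hs (X : ℂ) : HasSum (fun n : ℕ => (X^n / (n.factorial : ℂ) + (-X)^n / (n.factorial : ℂ))/2) (Complex.cosh X) := by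
  unfold Complex.cosh
  exact ((exp_hs X).add (exp_hs (-X))).div_const 2

theorem cosh_hsn (X : ℂ) : Summable (fun n : ℕ => ‖(X^n / (n.factorial : ℂ) + (-X)^n / (n.factorial : ℂ))/2‖) := by
  refine Summable.of_nonneg_of_le (fun _ => norm_nonneg _) (fun n => ?_) ((exp_hsn X).add (exp_hsn (-X)))
  rw [norm_div]
  have := norm_add_le (X^n / (n.factorial : ℂ)) ((-X)^n / (n.factorial : ℂ))
  have h2 : ‖(2:ℂ)‖ = 2 := by simp
  rw [h2]
  have := norm_nonneg (X^n / (n.factorial : ℂ) + (-X)^n / (n.factorial : ℂ))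
  linarith

theorem mul_hs {f g : ℕ → ℂ} {F G : ℂ} (hf : Summable fun n => ‖f n‖) (hg : Summable fun n => ‖g n‖)
    (hF : HasSum f F) (hG : HasSum g G) : HasSum (fun p : ℕ × ℕ => f p.1 * g p.2) (F * G) :=
  hF.mul hG (summable_mul_of_summable_norm hf hg)

theorem gam_hasSum (X Y : ℂ) : HasSum (fun p : ℕ × ℕ => (gam p : ℂ) * mon X Y p) (GC X Y) := by
  rw [funext (gam_term X Y)]
  unfold GC
  have hp := mul_hs (cosh_hsn X) (exp_hsn Y) (cosh_hs X) (exp_hs Y)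
  have h1 : HasSum (fun p : ℕ × ℕ => if p = (0,0) then (1:ℂ) else 0) 1 := hasSum_ite_eq _ _
  have h2 : HasSum (fun p : ℕ × ℕ => if p = (0,1) then Y else 0) Y := hasSum_ite_eq _ _
  exact (hp.sub h1).sub h2

theorem gam_norm (X Y : ℂ) (p : ℕ × ℕ) : ‖(gam p : ℂ) * mon X Y p‖ = gam p * (‖X‖^p.1 * ‖Y‖^p.2) := by
  rw [norm_mul, Complex.norm_real, Real.norm_of_nonneg (gam_nonneg p)]; simp [mon]

theorem gam_hasSum_real (x y : ℝ) : HasSum (fun p : ℕ × ℕ => gam p * (x^p.1*y^p.2)) (GR x y) := by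
  have := gam_hasSum x y
  rw [GC_ofReal] at this
  rw [← Complex.hasSum_ofReal]
  convert this using 1
  funext p; simp [mon]

theorem gam_summable_norm (X Y : ℂ) : Summable (fun p : ℕ × ℕ => ‖(gam p : ℂ) * mon X Y p‖) := by
  simp_rw [gam_norm]
  exact (gam_hasSum_real _ _).summable

theorem cauchy_aux {f g : ℕ × ℕ → ℂ} {F G : ℂ} (hf : Summable fun p => ‖f p‖) (hg : Summable fun p => ‖g p‖)
    (hF : HasSum f F) (hG : HasSum g G) :
    (Summable fun p => ‖∑ x ∈ Finset.HasAntidiagonal.antidiagonal p, f x.1 * g x.2‖) ∧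
    HasSum (fun p => ∑ x ∈ Finset.HasAntidiagonal.antidiagonal p, f x.1 * g x.2) (F * G) := by
  have hsn : Summable (fun x : (ℕ×ℕ) × (ℕ × ℕ) => ‖f x.1‖ * ‖g x.2‖) :=
    hf.mul_of_nonneg hg (fun _ => norm_nonneg _) (fun _ => norm_nonneg _)
  have hs := summable_mul_of_summable_norm hf hg
  have h1 : Summable fun p => ‖∑ x ∈ Finset.HasAntidiagonal.antidiagonal p, f x.1 * g x.2‖ := by
    refine Summable.of_nonneg_of_le (fun _ => norm_nonneg _) (fun p => ?_)
      (summable_sum_mul_antidiagonal_of_summable_mul (f := fun p => ‖f p‖) (g := fun p => ‖g p‖) hsn)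
    refine (norm_sum_le _ _).trans (Finset.sum_le_sum fun x _ => ?_)
    rw [norm_mul]
  refine ⟨h1, ?_⟩
  have h2 := hf.of_norm.tsum_mul_tsum_eq_tsum_sum_antidiagonal hg.of_norm hs
  rw [hF.tsum_eq, hG.tsum_eq] at h2
  rw [h2]
  exact h1.of_norm.hasSum

theorem qq_hasSum_aux (X Y : ℂ) (n : ℕ) : Summable (fun p : ℕ × ℕ => ‖(qq n p : ℂ) * mon X Y p‖) ∧
    HasSum (fun p : ℕ × ℕ => (qq n p : ℂ) * mon X Y p) (GC X Y ^ n) := by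
  induction n with
  | zero =>
    have : (fun p : ℕ × ℕ => (qq 0 p : ℂ) * mon X Y p) = fun p => if p = 0 then 1 else 0 := by
      funext p; unfold qq
      split_ifs with h
      · subst h; simp [mon]
      · simp
    constructor
    · rw [funext_iff] at this
      simp_rw [this]
      apply summable_of_ne_finset_zero (s := {0})
      intro p hp; simp at hp; simp [hp]
    · rw [this, pow_zero]; exact hasSum_ite_eq _ _
  | succ n ih =>
    have key : ∀ p, (qq (n+1) p : ℂ) * mon X Y p = ∑ x ∈ Finset.HasAntidiagonal.antidiagonal p,
        ((gam x.1 : ℂ) * mon X Y x.1) * ((qq n x.2 : ℂ) * mon X Y x.2) := by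
      intro p
      rw [qq]; push_cast
      rw [Finset.sum_mul]
      refine Finset.sum_congr rfl fun x hx => ?_
      rw [Finset.HasAntidiagonal.mem_antidiagonal] at hx
      rw [← hx, mon_add]; ring
    have h := cauchy_aux (gam_summable_norm X Y) ih.1 (gam_hasSum X Y) ih.2
    rw [pow_succ']
    rw [← funext key] at h
    have k2 : (fun p : ℕ × ℕ => ‖(qq (n+1) p : ℂ) * mon X Y p‖) = fun p => ‖∑ x ∈ Finset.HasAntidiagonal.antidiagonal p,
        ((gam x.1 : ℂ) * mon X Y x.1) * ((qq n x.2 : ℂ) * mon X Y x.2)‖ := by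
      funext p; rw [key]
    rw [k2]
    exact h

theorem qq_hasSum (X Y : ℂ) (n : ℕ) : HasSum (fun p : ℕ × ℕ => (qq n p : ℂ) * mon X Y p) (GC X Y ^ n) :=
  (qq_hasSum_aux X Y n).2

theorem qq_hasSum_real (x y : ℝ) (n : ℕ) : HasSum (fun p : ℕ × ℕ => qq n p * (x^p.1*y^p.2)) (GR x y ^ n) := by
  have := qq_hasSum x y n
  rw [GC_ofReal] at this
  rw [← Complex.hasSum_ofReal]
  push_cast
  exact this

theorem U0 {x y : ℝ} (hx : 0 ≤ x) (hy : 0 ≤ y) (n a b : ℕ) : qq n (a,b) * (x^a*y^b) ≤ GR x y ^ n :=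
  le_hasSum (qq_hasSum_real x y n) (a,b) fun p _ => mul_nonneg (qq_nonneg _ _) (by positivity)

theorem integral_exp_int (d : ℤ) : ∫ φ in (-Real.pi)..Real.pi, Complex.exp (Complex.I * d * φ) = if d = 0 then (2*Real.pi : ℂ) else 0 := by
  split_ifs with h
  · subst h; simp; ring
  · have hc : Complex.I * (d:ℂ) ≠ 0 := by simp [h]
    rw [integral_exp_mul_complex hc]
    have : Complex.exp (Complex.I * d * (Real.pi:ℝ)) = Complex.exp (Complex.I * d * ((-Real.pi:ℝ):ℂ)) := by
      rw [Complex.exp_eq_exp_iff_exists_int]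
      exact ⟨d, by push_cast; ring⟩
    rw [this]; simp

theorem HasSum.congr_fun' {ι : Type*} {f g : ι → ℂ} {a : ℂ} (h : HasSum f a) (hfg : ∀ i, g i = f i) : HasSum g a := by
  rw [funext hfg]; exact h

theorem fourier_extract {ι : Type*} [Countable ι] (c : ι → ℂ) (d : ι → ℕ) (hs : Summable fun i => ‖c i‖) (b : ℕ)
    (F : ℝ → ℂ) (hF : ∀ φ : ℝ, HasSum (fun i => c i * Complex.exp (Complex.I * φ)^(d i)) (F φ)) :
    HasSum (fun i => if d i = b then c i else 0)
      ((∫ φ in (-Real.pi)..Real.pi, F φ * Complex.exp (-(Complex.I * b * φ))) / (2*Real.pi)) := by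
  have h := intervalIntegral.hasSum_integral_of_dominated_convergence (μ := MeasureTheory.volume)
    (a := -Real.pi) (b := Real.pi)
    (F := fun i φ => c i * Complex.exp (Complex.I * φ)^(d i) * Complex.exp (-(Complex.I * b * φ)))
    (f := fun φ => F φ * Complex.exp (-(Complex.I * b * φ)))
    (fun i _ => ‖c i‖)
    (fun i => (by fun_prop : Continuous _).aestronglyMeasurable)
    (fun i => Filter.Eventually.of_forall fun t _ => by
      rw [norm_mul, norm_mul, norm_pow]
      have e1 : ‖Complex.exp (Complex.I * t)‖ = 1 := by rw [mul_comm]; exact Complex.norm_exp_ofReal_mul_I t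
      have e2 : ‖Complex.exp (-(Complex.I * b * t))‖ = 1 := by
        rw [Complex.norm_exp]; simp
      rw [e1, e2]; simp)
    (Filter.Eventually.of_forall fun t _ => hs)
    (by simp)
    (Filter.Eventually.of_forall fun t _ => (hF t).mul_right _)
  have h2 := h.div_const (2*Real.pi : ℂ)
  refine h2.congr_fun' fun i => ?_
  have e : ∀ φ : ℝ, c i * Complex.exp (Complex.I * φ)^(d i) * Complex.exp (-(Complex.I * b * φ))
      = c i * Complex.exp (Complex.I * ((d i - b : ℤ) : ℂ) * φ) := by
    intro φ
    rw [mul_assoc, ← Complex.exp_nat_mul, ← Complex.exp_add]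
    congr 2; push_cast; ring
  simp_rw [e]
  rw [intervalIntegral.integral_const_mul, integral_exp_int]
  have hpi : (2*Real.pi:ℂ) ≠ 0 := by simp [Real.pi_ne_zero]
  by_cases hd : d i = b
  · simp [hd, hpi]
  · have : (d i : ℤ) - b ≠ 0 := by omega
    simp [hd, this]

open Complex in
theorem norm_pair {A B : ℝ} (hA : 0 ≤ A) (hB : 0 ≤ B) (φ : ℝ) :
    ‖(A:ℂ) + B * exp (I * φ)‖ ≤ A + B - A * B / (A+B) * (1 - Real.cos φ) := by
  rcases (add_nonneg hA hB).eq_or_lt with h | h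
  · have a0 : A = 0 := by linarith
    have b0 : B = 0 := by linarith
    subst a0 b0; simp
  have hc := Real.cos_le_one φ
  have hc2 := Real.neg_one_le_cos φ
  have hpos : 0 ≤ A + B - A * B / (A+B) * (1 - Real.cos φ) := by
    have : A * B / (A+B) * (1 - Real.cos φ) ≤ A*B/(A+B) * 2 := by
      apply mul_le_mul_of_nonneg_left (by linarith) (by positivity)
    have h2 : A*B/(A+B)*2 ≤ A + B := by
      rw [div_mul_eq_mul_div, div_le_iff₀ h]; nlinarith [sq_nonneg A, sq_nonneg B]
    linarith
  apply le_of_sq_le_sq _ hpos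
  rw [← Complex.normSq_eq_norm_sq]
  have e : (A:ℂ) + B * exp (I * φ) = ((A + B * Real.cos φ : ℝ) : ℂ) + ((B * Real.sin φ : ℝ):ℂ) * I := by
    rw [mul_comm I, exp_mul_I]; push_cast; ring
  rw [e, normSq_add_mul_I]
  have e2 : (A + B * Real.cos φ)^2 + (B*Real.sin φ)^2 = (A+B)^2 - 2*(A*B)*(1-Real.cos φ) := by
    have := Real.sin_sq_add_cos_sq φ
    linear_combination B^2 * this
  rw [e2]
  have e3 : (A + B - A * B / (A+B) * (1 - Real.cos φ))^2 = (A+B)^2 - 2*(A*B)*(1-Real.cos φ) + (A * B / (A+B) * (1 - Real.cos φ))^2 := by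
    field_simp; ring
  rw [e3]
  nlinarith [sq_nonneg (A * B / (A+B) * (1 - Real.cos φ))]

theorem hasSum_norm_le' {ι : Type*} {f : ι → ℂ} {F : ℂ} {N : ℝ} (hf : HasSum f F)
    (hN : HasSum (fun i => ‖f i‖) N) (S : Finset ι) : ‖F‖ ≤ N - ∑ i ∈ S, ‖f i‖ + ‖∑ i ∈ S, f i‖ := by
  have h1 : HasSum (fun x : {x // x ∉ S} => f x) (F - ∑ i ∈ S, f i) := by
    rw [S.hasSum_compl_iff]; simpa using hf
  have h2 : HasSum (fun x : {x // x ∉ S} => ‖f x‖) (N - ∑ i ∈ S, ‖f i‖) := by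
    rw [S.hasSum_compl_iff (f := fun i => ‖f i‖)]; simpa using hN
  have h3 : ‖F - ∑ i ∈ S, f i‖ ≤ N - ∑ i ∈ S, ‖f i‖ := h1.norm_le_of_bounded h2 (fun _ => le_rfl)
  have := norm_add_le (F - ∑ i ∈ S, f i) (∑ i ∈ S, f i)
  rw [sub_add_cancel] at this
  linarith

open Complex in
theorem GC_decay {x y : ℝ} (hx : 0 ≤ x) (hy : 0 < y) (θ φ : ℝ) :
    ‖GC (x * exp (I * θ)) (y * exp (I*φ))‖ ≤ GR x y - y^3/(2*(3+y)) * (1 - Real.cos φ)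
      - x^4/(2*(12+x^2)) * (1 - Real.cos (2*θ)) := by
  set X := (x:ℂ) * exp (I * θ) with hX
  set Y := (y:ℂ) * exp (I * φ) with hY
  have nX : ‖X‖ = x := by
    rw [hX, norm_mul, mul_comm I, norm_exp_ofReal_mul_I, norm_real, Real.norm_of_nonneg hx, mul_one]
  have nY : ‖Y‖ = y := by
    rw [hY, norm_mul, mul_comm I, norm_exp_ofReal_mul_I, norm_real, Real.norm_of_nonneg hy.le, mul_one]
  have hn : HasSum (fun p => ‖(gam p : ℂ) * mon X Y p‖) (GR x y) := by
    rw [funext (gam_norm X Y), nX, nY]; exact gam_hasSum_real x y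
  have h := hasSum_norm_le' (gam_hasSum X Y) hn {(0,2),(0,3),(2,0),(4,0)}
  have g1 : gam (0,2) = 1/2 := by simp [gam]
  have g2 : gam (0,3) = 1/6 := by simp [gam]; norm_num [Nat.factorial]
  have g3 : gam (2,0) = 1/2 := by simp [gam]
  have g4 : gam (4,0) = 1/24 := by
    have : Even 4 := by decide
    simp [gam, this]; norm_num [Nat.factorial]
  have s1 : ∑ p ∈ ({(0,2),(0,3),(2,0),(4,0)} : Finset (ℕ × ℕ)), ‖(gam p : ℂ) * mon X Y p‖ = y^2/2 + y^3/6 + (x^2/2 + x^4/24) := by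
    rw [Finset.sum_congr rfl (fun p _ => gam_norm X Y p), nX, nY]
    rw [Finset.sum_insert (by decide), Finset.sum_insert (by decide), Finset.sum_insert (by decide), Finset.sum_singleton, g1, g2, g3, g4]
    norm_num; ring
  have s2 : ∑ p ∈ ({(0,2),(0,3),(2,0),(4,0)} : Finset (ℕ × ℕ)), (gam p : ℂ) * mon X Y p
     = exp (I*φ)^2 * (((y^2/2:ℝ):ℂ) + ((y^3/6:ℝ):ℂ) * exp (I * φ)) + exp (I*θ)^2 * (((x^2/2:ℝ):ℂ) + ((x^4/24:ℝ):ℂ) * exp (I * ((2*θ:ℝ):ℂ))) := by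
    rw [Finset.sum_insert (by decide), Finset.sum_insert (by decide), Finset.sum_insert (by decide), Finset.sum_singleton, g1, g2, g3, g4]
    have : exp (I * ((2*θ:ℝ):ℂ)) = exp (I*θ)^2 := by
      rw [← exp_nat_mul]; congr 1; push_cast; ring
    rw [this, hX, hY]
    simp only [mon]
    push_cast
    ring
  rw [s1, s2] at h
  have t1 := norm_pair (A := y^2/2) (B := y^3/6) (by positivity) (by positivity) φ
  have t2 := norm_pair (A := x^2/2) (B := x^4/24) (by positivity) (by positivity) (2*θ)
  have n1 : ‖exp (I*φ)^2 * (((y^2/2:ℝ):ℂ) + ((y^3/6:ℝ):ℂ) * exp (I * φ)) + exp (I*θ)^2 * (((x^2/2:ℝ):ℂ) + ((x^4/24:ℝ):ℂ) * exp (I * ((2*θ:ℝ):ℂ)))‖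
     ≤ ‖((y^2/2:ℝ):ℂ) + ((y^3/6:ℝ):ℂ) * exp (I * φ)‖ + ‖((x^2/2:ℝ):ℂ) + ((x^4/24:ℝ):ℂ) * exp (I * ((2*θ:ℝ):ℂ))‖ := by
    refine (norm_add_le _ _).trans ?_
    rw [norm_mul, norm_mul, norm_pow, norm_pow, mul_comm I, mul_comm I (θ:ℂ), norm_exp_ofReal_mul_I, norm_exp_ofReal_mul_I]
    simp
  have e1 : y^2/2*(y^3/6)/(y^2/2+y^3/6) = y^3/(2*(3+y)) := by field_simp; ring
  have e2 : x^2/2*(x^4/24)/(x^2/2+x^4/24) = x^4/(2*(12+x^2)) := by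
    rcases hx.eq_or_lt with rfl | hx
    · simp
    · field_simp; ring
  rw [e1] at t1
  rw [e2] at t2
  linarith

theorem GR_ge {x y : ℝ} (hy : 0 < y) : gg y ≤ GR x y := by
  unfold GR gg
  have := Real.one_le_cosh x
  nlinarith [Real.exp_pos y]

theorem GR_pos {x y : ℝ} (hy : 0 < y) : 0 < GR x y := (gg_pos hy.ne').trans_le (GR_ge hy)

theorem GR_le {x y K : ℝ} (hx : 0 ≤ x) (hx2 : x ≤ K) (hy : 0 < y) (hy2 : y ≤ K) : GR x y ≤ Real.cosh K * Real.exp K := by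
  unfold GR
  have h1 : Real.cosh x ≤ Real.cosh K := by
    rw [Real.cosh_le_cosh, abs_of_nonneg hx, abs_of_nonneg (hx.trans hx2)]; exact hx2
  have h2 := Real.exp_le_exp.2 hy2
  have : Real.cosh x * Real.exp y ≤ Real.cosh K * Real.exp K :=
    mul_le_mul h1 h2 (Real.exp_pos _).le (Real.cosh_pos _).le
  linarith

/-- decay rate along y -/
noncomputable def cd (z0 K : ℝ) : ℝ := min (z0^3/(2*(3+K))) (z0^4/(2*(12+K^2))) / (Real.cosh K * Real.exp K)

theorem cd_pos {z0 K : ℝ} (hz : 0 < z0) (hK : 0 < K) : 0 < cd z0 K := by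
  unfold cd
  have := Real.cosh_pos K
  have h1 : 0 < z0^3/(2*(3+K)) := by positivity
  have h2 : 0 < z0^4/(2*(12+K^2)) := by positivity
  exact div_pos (lt_min h1 h2) (by positivity)

theorem sub_le_mul_exp {G c s H : ℝ} (hG : 0 < G) (hGH : G ≤ H) (hc : 0 ≤ c) (hs : 0 ≤ s) : G - c * s ≤ G * Real.exp (-(c/H*s)) := by
  have h1 := Real.add_one_le_exp (-(c/H*s))
  have h2 : G * (-(c/H*s)+1) ≤ G * Real.exp (-(c/H*s)) := mul_le_mul_of_nonneg_left h1 hG.le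
  have h3 : G * (c/H*s) ≤ c * s := by
    have hH : 0 < H := hG.trans_le hGH
    have : G * (c/H*s) = c * s * (G / H) := by field_simp
    rw [this]
    exact mul_le_of_le_one_right (by positivity) ((div_le_one hH).2 hGH)
  linarith

open Complex in
theorem GC_D1 {z0 K x y : ℝ} (hz : 0 < z0) (hx : 0 ≤ x) (hxK : x ≤ K) (hy : z0 ≤ y) (hyK : y ≤ K) (φ : ℝ) :
    ‖GC x (y * exp (I*φ))‖ ≤ GR x y * Real.exp (-(cd z0 K * (1 - Real.cos φ))) := by
  have hy0 : 0 < y := hz.trans_le hy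
  have hK : 0 < K := hy0.trans_le hyK
  have h := GC_decay hx hy0 0 φ
  simp only [ofReal_zero, mul_zero, exp_zero, mul_one, Real.cos_zero, sub_self, sub_zero] at h
  have hs : 0 ≤ 1 - Real.cos φ := by linarith [Real.cos_le_one φ]
  have hm : min (z0^3/(2*(3+K))) (z0^4/(2*(12+K^2))) ≤ y^3/(2*(3+y)) :=
    (min_le_left _ _).trans (by gcongr)
  refine h.trans (le_trans ?_ (sub_le_mul_exp (GR_pos hy0) (GR_le hx hxK hy0 hyK) (c := min (z0^3/(2*(3+K))) (z0^4/(2*(12+K^2)))) ?_ hs))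
  · have := mul_le_mul_of_nonneg_right hm hs
    linarith
  · exact le_min (by positivity) (by positivity)

open Complex in
theorem GC_D2 {z0 K x y : ℝ} (hz : 0 < z0) (hx : z0 ≤ x) (hxK : x ≤ K) (hy : z0 ≤ y) (hyK : y ≤ K) (θ φ : ℝ) :
    ‖GC (x * exp (I*θ)) (y * exp (I*φ))‖ ≤ GR x y * Real.exp (-(cd z0 K * ((1 - Real.cos φ) + (1 - Real.cos (2*θ))))) := by
  have hy0 : 0 < y := hz.trans_le hy
  have hx0 : 0 < x := hz.trans_le hx
  have hK : 0 < K := hy0.trans_le hyK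
  have h := GC_decay hx0.le hy0 θ φ
  have hs : 0 ≤ 1 - Real.cos φ := by linarith [Real.cos_le_one φ]
  have hs2 : 0 ≤ 1 - Real.cos (2*θ) := by linarith [Real.cos_le_one (2*θ)]
  have hm : min (z0^3/(2*(3+K))) (z0^4/(2*(12+K^2))) ≤ y^3/(2*(3+y)) :=
    (min_le_left _ _).trans (by gcongr)
  have hm2 : min (z0^3/(2*(3+K))) (z0^4/(2*(12+K^2))) ≤ x^4/(2*(12+x^2)) :=
    (min_le_right _ _).trans (by gcongr)
  refine h.trans (le_trans ?_ (sub_le_mul_exp (GR_pos hy0) (GR_le hx0.le hxK hy0 hyK) (c := min (z0^3/(2*(3+K))) (z0^4/(2*(12+K^2)))) ?_ (add_nonneg hs hs2)))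
  · have := mul_le_mul_of_nonneg_right hm hs
    have := mul_le_mul_of_nonneg_right hm2 hs2
    linarith
  · exact le_min (by positivity) (by positivity)

theorem gauss_int {c : ℝ} (hc : 0 < c) : ∫ φ in (-Real.pi)..Real.pi, Real.exp (-(c * (1 - Real.cos φ))) ≤ 4 / √c := by
  have hpi := Real.pi_pos
  have h1 : ∫ φ in (-Real.pi)..Real.pi, Real.exp (-(c * (1 - Real.cos φ))) ≤ ∫ φ in (-Real.pi)..Real.pi, Real.exp (-(c*(2/Real.pi^2)) * φ^2) := by
    apply intervalIntegral.integral_mono_on (by linarith) (by apply Continuous.intervalIntegrable; fun_prop) (by apply Continuous.intervalIntegrable; fun_prop)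
    intro x hx
    apply Real.exp_le_exp.2
    have := Real.cos_le_one_sub_mul_cos_sq (x := x) (abs_le.2 ⟨hx.1, hx.2⟩)
    have h2 : c * (2/Real.pi^2*x^2) ≤ c * (1 - Real.cos x) := mul_le_mul_of_nonneg_left (by linarith) hc.le
    linarith
  have hb : 0 < c*(2/Real.pi^2) := by positivity
  have h2 : ∫ φ in (-Real.pi)..Real.pi, Real.exp (-(c*(2/Real.pi^2)) * φ^2) ≤ ∫ φ, Real.exp (-(c*(2/Real.pi^2)) * φ^2) := by
    rw [intervalIntegral.integral_of_le (by linarith)]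
    apply MeasureTheory.setIntegral_le_integral (integrable_exp_neg_mul_sq hb)
    exact Filter.Eventually.of_forall fun x => (Real.exp_pos _).le
  rw [integral_gaussian] at h2
  refine h1.trans (h2.trans ?_)
  have e : Real.pi / (c * (2/Real.pi^2)) = (Real.pi^3/2) / c := by field_simp
  rw [e, Real.sqrt_div (by positivity)]
  apply div_le_div_of_nonneg_right _ (Real.sqrt_nonneg _)
  rw [Real.sqrt_le_left (by norm_num)]
  have := Real.pi_lt_d2
  have h3 : Real.pi^3 ≤ 3.15^3 := by gcongr
  norm_num at h3 ⊢; linarith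

theorem gauss_int2 {c : ℝ} (hc : 0 < c) : ∫ φ in (-Real.pi)..Real.pi, Real.exp (-(c * (1 - Real.cos (2*φ)))) ≤ 4 / √c := by
  refine le_trans (le_of_eq ?_) (gauss_int hc)
  have hper : Function.Periodic (fun φ => Real.exp (-(c * (1 - Real.cos φ)))) (2*Real.pi) := by
    intro x; simp [Real.cos_add_two_pi]
  have hint : ∀ a b : ℝ, IntervalIntegrable (fun φ => Real.exp (-(c * (1 - Real.cos φ)))) MeasureTheory.volume a b := by
    intro a b; apply Continuous.intervalIntegrable; fun_prop
  have h := intervalIntegral.integral_comp_mul_left (a := -Real.pi) (b := Real.pi) (fun φ => Real.exp (-(c * (1 - Real.cos φ)))) (two_ne_zero (α := ℝ))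
  rw [h, ← intervalIntegral.integral_add_adjacent_intervals (hint (2 * -Real.pi) 0) (hint 0 (2*Real.pi))]
  have e1 := hper.intervalIntegral_add_eq (2 * -Real.pi) (-Real.pi)
  have e2 := hper.intervalIntegral_add_eq 0 (-Real.pi)
  have a1 : 2 * -Real.pi + 2 * Real.pi = 0 := by ring
  have a2 : -Real.pi + 2 * Real.pi = Real.pi := by ring
  rw [a1, a2] at e1
  rw [zero_add, a2] at e2
  rw [e1, e2]; simp; ring

theorem HasSum.congr_funR {ι : Type*} {f g : ι → ℝ} {a : ℝ} (h : HasSum f a) (hfg : ∀ i, g i = f i) : HasSum g a := by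
  rw [funext hfg]; exact h

open Complex in
theorem qq_fourier (n b : ℕ) (X : ℂ) (y : ℝ) :
    HasSum (fun p : ℕ × ℕ => if p.2 = b then (qq n p : ℂ) * mon X y p else 0)
      ((∫ φ in (-Real.pi)..Real.pi, GC X (y * exp (I * φ))^n * exp (-(I * b * φ))) / (2*Real.pi)) := by
  apply fourier_extract (fun p => (qq n p : ℂ) * mon X y p) (fun p => p.2) (qq_hasSum_aux X y n).1 b
    (fun φ => GC X (y * exp (I * φ))^n)
  intro φ
  refine (qq_hasSum X (y * exp (I * φ)) n).congr_fun' fun p => ?_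
  simp [mon, mul_pow]; ring

theorem norm_exp_neg_I (b : ℕ) (φ : ℝ) : ‖Complex.exp (-(Complex.I * b * φ))‖ = 1 := by
  rw [Complex.norm_exp]; simp

open Complex in
/-- one-variable local bound -/
theorem U1 {z0 K x y : ℝ} (hz : 0 < z0) (hx : 0 ≤ x) (hxK : x ≤ K) (hy : z0 ≤ y) (hyK : y ≤ K) {n : ℕ} (hn : 0 < n) (a b : ℕ) :
    qq n (a,b) * (x^a*y^b) ≤ (1/√(cd z0 K)) / √n * GR x y ^ n := by
  have hy0 : 0 < y := hz.trans_le hy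
  have hK : 0 < K := hy0.trans_le hyK
  have hc := cd_pos hz hK
  have hn' : (0:ℝ) < n := by exact_mod_cast hn
  have h := qq_fourier n b x y
  set J := ∫ φ in (-Real.pi)..Real.pi, GC x (y * exp (I * φ))^n * exp (-(I * b * φ)) with hJ
  have hG := GR_pos (x := x) hy0
  have hJn : ‖J‖ ≤ GR x y^n * (4 / √(n * cd z0 K)) := by
    refine le_trans ?_ (mul_le_mul_of_nonneg_left (gauss_int (c := n * cd z0 K) (by positivity)) (by positivity))
    rw [← intervalIntegral.integral_const_mul]
    apply intervalIntegral.norm_integral_le_of_norm_le (by linarith [Real.pi_pos])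
    · refine Filter.Eventually.of_forall fun φ _ => ?_
      rw [norm_mul, norm_exp_neg_I, mul_one, norm_pow]
      refine (pow_le_pow_left₀ (norm_nonneg _) (GC_D1 hz hx hxK hy hyK φ) n).trans (le_of_eq ?_)
      rw [mul_pow, ← Real.exp_nat_mul]; congr 2; ring
    · apply Continuous.intervalIntegrable; fun_prop
  have h2 : HasSum (fun p : ℕ × ℕ => if p.2 = b then qq n p * (x^p.1*y^p.2) else 0) (J/(2*Real.pi)).re := by
    have := (Complex.hasSum_iff _ _).1 h
    refine HasSum.congr_funR this.1 fun p => ?_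
    split_ifs
    · rw [mon, ← ofReal_pow, ← ofReal_pow, ← ofReal_mul, ← ofReal_mul, ofReal_re]
    · simp
  have h3 := le_hasSum h2 (a,b) (fun p _ => by
    split_ifs
    · exact mul_nonneg (qq_nonneg _ _) (by positivity)
    · exact le_rfl)
  simp only [if_true] at h3
  have h4 : (J/(2*Real.pi)).re ≤ ‖J‖ / (2*Real.pi) := by
    refine (Complex.re_le_norm _).trans (le_of_eq ?_)
    rw [norm_div]; congr 1; simp [abs_of_pos Real.pi_pos]
  refine h3.trans (h4.trans ?_)
  rw [div_le_iff₀ (by positivity)]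
  refine hJn.trans ?_
  rw [Real.sqrt_mul hn'.le]
  have : 1/√(cd z0 K) / √n * GR x y^n * (2*Real.pi) = GR x y^n * ((2*Real.pi) / (√n * √(cd z0 K))) := by
    field_simp
  rw [this]
  gcongr
  linarith [Real.pi_gt_three]

open Complex in
/-- two-variable local bound -/
theorem U2 {z0 K x y : ℝ} (hz : 0 < z0) (hx : z0 ≤ x) (hxK : x ≤ K) (hy : z0 ≤ y) (hyK : y ≤ K) {n : ℕ} (hn : 0 < n) (a b : ℕ) :
    qq n (a,b) * (x^a*y^b) ≤ (1/cd z0 K) / n * GR x y ^ n := by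
  have hy0 : 0 < y := hz.trans_le hy
  have hx0 : 0 < x := hz.trans_le hx
  have hK : 0 < K := hy0.trans_le hyK
  have hc := cd_pos hz hK
  have hn' : (0:ℝ) < n := by exact_mod_cast hn
  have hpi := Real.pi_pos
  set J : ℝ → ℂ := fun θ => ∫ φ in (-Real.pi)..Real.pi, GC (x * exp (I * θ)) (y * exp (I * φ))^n * exp (-(I * b * φ)) with hJ
  have hG := GR_pos (x := x) hy0
  have hJn : ∀ θ, ‖J θ‖ ≤ (GR x y^n * (4 / √(n * cd z0 K))) * Real.exp (-((n * cd z0 K) * (1 - Real.cos (2*θ)))) := by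
    intro θ
    have : (GR x y^n * (4 / √(n * cd z0 K))) * Real.exp (-((n * cd z0 K) * (1 - Real.cos (2*θ))))
      = (GR x y^n * Real.exp (-((n * cd z0 K) * (1 - Real.cos (2*θ))))) * (4 / √(n * cd z0 K)) := by ring
    rw [this]
    refine le_trans ?_ (mul_le_mul_of_nonneg_left (gauss_int (c := n * cd z0 K) (by positivity)) (by positivity))
    rw [← intervalIntegral.integral_const_mul]
    apply intervalIntegral.norm_integral_le_of_norm_le (by linarith [Real.pi_pos])
    · refine Filter.Eventually.of_forall fun φ _ => ?_
      rw [norm_mul, norm_exp_neg_I, mul_one, norm_pow]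
      refine (pow_le_pow_left₀ (norm_nonneg _) (GC_D2 hz hx hxK hy hyK θ φ) n).trans (le_of_eq ?_)
      rw [mul_pow, ← Real.exp_nat_mul, mul_assoc, ← Real.exp_add]; congr 2; ring
    · apply Continuous.intervalIntegrable; fun_prop
  have h := fourier_extract (fun p : ℕ × ℕ => if p.2 = b then (qq n p : ℂ) * mon x y p else 0) (fun p => p.1)
    (Summable.of_nonneg_of_le (fun _ => norm_nonneg _) (fun p => by
      split_ifs
      · exact le_rfl
      · rw [norm_zero]; exact norm_nonneg _) (qq_hasSum_aux x y n).1) a (fun θ => J θ / (2*Real.pi)) (fun θ => by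
        refine (qq_fourier n b (x * exp (I * θ)) y).congr_fun' fun p => ?_
        split_ifs
        · simp [mon, mul_pow]; ring
        · simp)
  set J2 := ∫ θ in (-Real.pi)..Real.pi, J θ / (2*Real.pi) * exp (-(I * a * θ)) with hJ2
  have hJ2n : ‖J2‖ ≤ (GR x y^n * (4 / √(n * cd z0 K))) / (2*Real.pi) * (4 / √(n * cd z0 K)) := by
    refine le_trans ?_ (mul_le_mul_of_nonneg_left (gauss_int2 (c := n * cd z0 K) (by positivity)) (by positivity))
    rw [← intervalIntegral.integral_const_mul]
    apply intervalIntegral.norm_integral_le_of_norm_le (by linarith [Real.pi_pos])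
    · refine Filter.Eventually.of_forall fun φ _ => ?_
      rw [norm_mul, norm_exp_neg_I, mul_one, norm_div]
      have : ‖(2*Real.pi : ℂ)‖ = 2*Real.pi := by simp [abs_of_pos Real.pi_pos]
      rw [this, div_mul_eq_mul_div]
      exact div_le_div_of_nonneg_right (hJn φ) (by positivity)
    · apply Continuous.intervalIntegrable; fun_prop
  have h2 : HasSum (fun p : ℕ × ℕ => if p.1 = a then (if p.2 = b then qq n p * (x^p.1*y^p.2) else 0) else 0) (J2/(2*Real.pi)).re := by
    have := (Complex.hasSum_iff _ _).1 h
    refine HasSum.congr_funR this.1 fun p => ?_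
    split_ifs
    · rw [mon, ← ofReal_pow, ← ofReal_pow, ← ofReal_mul, ← ofReal_mul, ofReal_re]
    · simp
    · simp
  have h3 := le_hasSum h2 (a,b) (fun p _ => by
    split_ifs
    · exact mul_nonneg (qq_nonneg _ _) (by positivity)
    · exact le_rfl
    · exact le_rfl)
  simp only [if_true] at h3
  have h4 : (J2/(2*Real.pi)).re ≤ ‖J2‖ / (2*Real.pi) := by
    refine (Complex.re_le_norm _).trans (le_of_eq ?_)
    rw [norm_div]; congr 1; simp [abs_of_pos Real.pi_pos]
  refine h3.trans (h4.trans ?_)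
  rw [div_le_iff₀ (by positivity)]
  refine hJ2n.trans ?_
  have e1 : GR x y^n * (4 / √(n * cd z0 K)) / (2*Real.pi) * (4 / √(n * cd z0 K)) = GR x y^n / (n * cd z0 K) * (8 / Real.pi) := by
    have hsq : √(n * cd z0 K) * √(n * cd z0 K) = n * cd z0 K := Real.mul_self_sqrt (by positivity)
    have hs0 : 0 < √(n * cd z0 K) := Real.sqrt_pos.2 (by positivity)
    set s := √(n * cd z0 K)
    rw [← hsq]; field_simp; norm_num
  have e2 : 1/cd z0 K / n * GR x y^n * (2*Real.pi) = GR x y^n / (n * cd z0 K) * (2*Real.pi) := by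
    field_simp
  rw [e1, e2]
  gcongr
  rw [div_le_iff₀ hpi]
  nlinarith [Real.pi_gt_three]

theorem norm_pow_sub_pow_le' {a b : ℂ} {R : ℝ} (ha : ‖a‖ ≤ R) (hb : ‖b‖ ≤ R) (n : ℕ) :
    ‖a^(n+1) - b^(n+1)‖ ≤ (n+1) * ‖a-b‖ * R^n := by
  have hR : 0 ≤ R := (norm_nonneg _).trans ha
  induction n with
  | zero => simp
  | succ n ih =>
    have e : a^(n+1+1) - b^(n+1+1) = a * (a^(n+1) - b^(n+1)) + (a-b) * b^(n+1) := by ring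
    rw [e]
    refine (norm_add_le _ _).trans ?_
    rw [norm_mul, norm_mul, norm_pow]
    have h1 : ‖a‖ * ‖a^(n+1) - b^(n+1)‖ ≤ R * ((n+1) * ‖a-b‖ * R^n) :=
      mul_le_mul ha ih (norm_nonneg _) hR
    have h2 : ‖a-b‖ * ‖b‖^(n+1) ≤ ‖a-b‖ * R^(n+1) := by gcongr
    push_cast
    have : R * ((n+1) * ‖a-b‖ * R^n) = (n+1) * ‖a-b‖ * R^(n+1) := by ring
    linarith

theorem cube_exp {b t : ℝ} (hb : 0 < b) : |t|^3 * Real.exp (-(b*t^2)) ≤ 1/(b*√b) * Real.exp (-(b/4)*t^2) := by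
  set s := √b * |t| with hs
  have hs0 : 0 ≤ s := by positivity
  have hs2 : s^2 = b * t^2 := by rw [hs, mul_pow, Real.sq_sqrt hb.le, sq_abs]
  have h1 : s ≤ Real.exp (s^2/4) := by
    have := Real.add_one_le_exp (s^2/4)
    nlinarith [sq_nonneg (s-2)]
  have h2 : s^3 ≤ Real.exp (3*s^2/4) := by
    calc s^3 ≤ Real.exp (s^2/4)^3 := by gcongr
      _ = _ := by rw [← Real.exp_nat_mul]; congr 1; push_cast; ring
  have h3 : s^3 = b * √b * |t|^3 := by
    have h0 := Real.sq_sqrt hb.le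
    rw [hs, mul_pow]
    have : √b^3 = b * √b := by
      calc √b^3 = √b^2 * √b := by ring
        _ = _ := by rw [h0]
    rw [this]
  have e : Real.exp (-(b/4)*t^2) = Real.exp (3*s^2/4) * Real.exp (-(b*t^2)) := by
    rw [← Real.exp_add, hs2]; congr 1; ring
  rw [e, div_mul_eq_mul_div, one_mul, le_div_iff₀ (by positivity)]
  calc |t|^3 * Real.exp (-(b*t^2)) * (b*√b) = s^3 * Real.exp (-(b*t^2)) := by rw [h3]; ring
    _ ≤ _ := by gcongr

theorem cube_int {b : ℝ} (hb : 0 < b) : ∫ t in (-Real.pi)..Real.pi, |t|^3 * Real.exp (-(b*t^2)) ≤ 4/b^2 := by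
  have hpi := Real.pi_pos
  have h1 : ∫ t in (-Real.pi)..Real.pi, |t|^3 * Real.exp (-(b*t^2)) ≤ ∫ t in (-Real.pi)..Real.pi, 1/(b*√b) * Real.exp (-(b/4)*t^2) := by
    apply intervalIntegral.integral_mono_on (by linarith) (by apply Continuous.intervalIntegrable; fun_prop) (by apply Continuous.intervalIntegrable; fun_prop)
    exact fun x _ => cube_exp hb
  have h2 : ∫ φ in (-Real.pi)..Real.pi, Real.exp (-(b/4) * φ^2) ≤ ∫ φ, Real.exp (-(b/4) * φ^2) := by
    rw [intervalIntegral.integral_of_le (by linarith)]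
    apply MeasureTheory.setIntegral_le_integral (integrable_exp_neg_mul_sq (by positivity))
    exact Filter.Eventually.of_forall fun x => (Real.exp_pos _).le
  rw [integral_gaussian] at h2
  rw [intervalIntegral.integral_const_mul] at h1
  refine h1.trans ((mul_le_mul_of_nonneg_left h2 (by positivity)).trans ?_)
  have e : Real.pi / (b/4) = (4*Real.pi)/b := by field_simp
  rw [e, Real.sqrt_div (by positivity)]
  have h4 : √(4*Real.pi) ≤ 4 := by
    rw [Real.sqrt_le_left (by norm_num)]; linarith [Real.pi_lt_four]
  have e2 : 1/(b*√b) * (√(4*Real.pi)/√b) = √(4*Real.pi) / b^2 := by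
    have h0 := Real.mul_self_sqrt hb.le
    have hs := Real.sqrt_pos.2 hb
    have : b^2 = b * (√b * √b) := by rw [h0]; ring
    rw [this]; field_simp
  rw [e2]
  gcongr

theorem llt_lower {T0 v0 c : ℝ} (hv0 : 0 < v0) (hc : 0 < c) (hT0 : 0 < T0) : ∃ c' > 0, ∃ n0 : ℕ, ∀ (v : ℝ) (ψ : ℝ → ℂ),
    v0 ≤ v → v ≤ T0 → Continuous ψ → (∀ θ ∈ Set.Icc (-Real.pi) Real.pi, ‖ψ θ‖ ≤ Real.exp (-(c*θ^2))) →
    (∀ θ ∈ Set.Icc (-Real.pi) Real.pi, ‖ψ θ - ((1 - v*θ^2/2 : ℝ) : ℂ)‖ ≤ T0 * |θ|^3) → ∀ n : ℕ, n0 ≤ n →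
    c' / √n ≤ (∫ θ in (-Real.pi)..Real.pi, ψ θ ^ n).re := by
  have hpi := Real.pi_pos
  set c1 := min c (v0/2) with hc1
  have hc1p : 0 < c1 := lt_min hc (by positivity)
  set T1 := T0 + T0^2 * Real.pi with hT1
  have hT1p : 0 < T1 := by positivity
  set E := 16 * T1 / c1^2 with hE
  set m0 := Real.exp (-(T0/2)) with hm0
  refine ⟨m0, Real.exp_pos _, max 2 (⌈(E/m0)^2⌉₊), ?_⟩
  intro v ψ hv hvT hcont hdec htay n hn
  have hn2 : 2 ≤ n := (le_max_left _ _).trans hn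
  have hn3 : (E/m0)^2 ≤ n := (Nat.le_ceil _).trans (by exact_mod_cast (le_max_right _ _).trans hn)
  obtain ⟨l, rfl⟩ : ∃ l, n = l + 1 := ⟨n-1, by omega⟩
  have hl : (1:ℝ) ≤ l := by exact_mod_cast (by omega : 1 ≤ l)
  set g : ℝ → ℝ := fun θ => Real.exp (-((l+1:ℕ) * (v*θ^2/2))) with hg
  have hgint : ∀ a b, IntervalIntegrable g MeasureTheory.volume a b := by
    intro a b; apply Continuous.intervalIntegrable; fun_prop
  have hdiff : ∀ θ ∈ Set.Icc (-Real.pi) Real.pi, ‖ψ θ^(l+1) - (g θ : ℂ)‖ ≤ (l+1) * T1 * (|θ|^3 * Real.exp (-((l*c1)*θ^2))) := by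
    intro θ hθ
    have habs : |θ| ≤ Real.pi := abs_le.2 hθ
    set b : ℂ := ((Real.exp (-(v*θ^2/2)) : ℝ) : ℂ) with hb
    have hgb : (g θ : ℂ) = b^(l+1) := by
      rw [hb, ← Complex.ofReal_pow, ← Real.exp_nat_mul, hg]; congr 2; ring
    have hR : ‖ψ θ‖ ≤ Real.exp (-(c1*θ^2)) := by
      refine (hdec θ hθ).trans (Real.exp_le_exp.2 ?_)
      have := mul_le_mul_of_nonneg_right (min_le_left c (v0/2)) (sq_nonneg θ)
      linarith
    have hRb : ‖b‖ ≤ Real.exp (-(c1*θ^2)) := by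
      rw [hb, Complex.norm_real, Real.norm_of_nonneg (Real.exp_pos _).le]
      apply Real.exp_le_exp.2
      have := mul_le_mul_of_nonneg_right ((min_le_right c (v0/2)).trans (by linarith : v0/2 ≤ v/2)) (sq_nonneg θ)
      linarith
    rw [hgb]
    refine (norm_pow_sub_pow_le' hR hRb l).trans ?_
    have hab : ‖ψ θ - b‖ ≤ T1 * |θ|^3 := by
      have e1 : ‖((1 - v*θ^2/2 : ℝ) : ℂ) - b‖ ≤ T0^2 * Real.pi * |θ|^3 := by
        rw [hb, ← Complex.ofReal_sub, Complex.norm_real, Real.norm_eq_abs]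
        set t := v*θ^2/2 with ht
        have ht0 : 0 ≤ t := by have : 0 ≤ v := by linarith
                               positivity
        have k1 : |1 - t - Real.exp (-t)| ≤ t^2 := by
          rw [abs_le]
          have a1 := Real.add_one_le_exp (-t)
          have a2 := Real.add_one_le_exp t
          have a3 : Real.exp t * Real.exp (-t) = 1 := by rw [← Real.exp_add]; simp
          constructor
          · have : (1+t) * Real.exp (-t) ≤ 1 := by nlinarith [Real.exp_pos (-t)]
            nlinarith [Real.exp_pos (-t)]
          · nlinarith
        refine k1.trans ?_
        have k2 : t^2 ≤ T0^2 * |θ|^4 := by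
          have : t ≤ T0 * |θ|^2 := by rw [ht, sq_abs]; nlinarith [sq_nonneg θ, mul_le_mul_of_nonneg_right hvT (sq_nonneg θ)]
          calc t^2 ≤ (T0 * |θ|^2)^2 := by gcongr
            _ = _ := by ring
        have k3 : |θ|^4 ≤ Real.pi * |θ|^3 := by
          have := mul_le_mul_of_nonneg_right habs (by positivity : 0 ≤ |θ|^3)
          calc |θ|^4 = |θ| * |θ|^3 := by ring
            _ ≤ _ := this
        calc t^2 ≤ T0^2*|θ|^4 := k2
          _ ≤ T0^2*(Real.pi * |θ|^3) := by gcongr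
          _ = _ := by ring
      have := norm_add_le (ψ θ - ((1 - v*θ^2/2 : ℝ) : ℂ)) (((1 - v*θ^2/2 : ℝ) : ℂ) - b)
      rw [sub_add_sub_cancel] at this
      have := htay θ hθ
      rw [hT1]; linarith
    have e2 : Real.exp (-(c1*θ^2))^l = Real.exp (-((l*c1)*θ^2)) := by
      rw [← Real.exp_nat_mul]; congr 1; ring
    rw [e2]
    calc (l+1) * ‖ψ θ - b‖ * Real.exp (-((l*c1)*θ^2)) ≤ (l+1) * (T1 * |θ|^3) * Real.exp (-((l*c1)*θ^2)) := by gcongr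
      _ = _ := by ring
  have hψint : IntervalIntegrable (fun θ => ψ θ^(l+1)) MeasureTheory.volume (-Real.pi) Real.pi := by
    apply Continuous.intervalIntegrable; fun_prop
  have hgint' : IntervalIntegrable (fun θ => (g θ : ℂ)) MeasureTheory.volume (-Real.pi) Real.pi := by
    apply Continuous.intervalIntegrable; fun_prop
  have hbound : ‖(∫ θ in (-Real.pi)..Real.pi, ψ θ^(l+1)) - ∫ θ in (-Real.pi)..Real.pi, (g θ : ℂ)‖ ≤ (l+1)*T1*(4/(l*c1)^2) := by
    rw [← intervalIntegral.integral_sub hψint hgint']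
    refine le_trans ?_ (mul_le_mul_of_nonneg_left (cube_int (b := l*c1) (by positivity)) (by positivity))
    rw [← intervalIntegral.integral_const_mul]
    apply intervalIntegral.norm_integral_le_of_norm_le (by linarith)
    · exact Filter.Eventually.of_forall fun θ hθ => hdiff θ (Set.Ioc_subset_Icc_self hθ)
    · apply Continuous.intervalIntegrable; fun_prop
  set N : ℝ := ((l+1:ℕ):ℝ) with hN
  have hNl : N = l + 1 := by rw [hN]; push_cast; ring
  have hN0 : 0 < N := by rw [hNl]; positivity
  have hsN : 0 < √N := Real.sqrt_pos.2 hN0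
  have hss : √N * √N = N := Real.mul_self_sqrt hN0.le
  have hmain : 2 * m0 / √N ≤ ∫ θ in (-Real.pi)..Real.pi, g θ := by
    have hs1 : 1/√N ≤ Real.pi := by
      have : 1 ≤ √N := by rw [Real.one_le_sqrt]; rw [hNl]; linarith
      have : 1/√N ≤ 1 := by rw [div_le_one hsN]; exact this
      linarith [Real.pi_gt_three]
    have hsp : 0 < 1/√N := by positivity
    have h1 : ∫ θ in (-(1/√N))..(1/√N), m0 ≤ ∫ θ in (-(1/√N))..(1/√N), g θ := by
      apply intervalIntegral.integral_mono_on (by linarith) (by simp) (hgint _ _)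
      intro θ hθ
      rw [hm0, hg]
      apply Real.exp_le_exp.2
      have ht2 : θ^2 ≤ (1/√N)^2 := sq_le_sq' hθ.1 hθ.2
      have e : (1/√N)^2 = 1/N := by rw [div_pow, one_pow, sq, hss]
      rw [e, le_div_iff₀ hN0] at ht2
      have : N * (v*θ^2/2) ≤ T0/2 := by
        calc N * (v*θ^2/2) = v/2 * (θ^2*N) := by ring
          _ ≤ v/2 * 1 := by
            apply mul_le_mul_of_nonneg_left ht2; linarith
          _ ≤ _ := by linarith
      linarith
    have h2 : ∫ θ in (-(1/√N))..(1/√N), g θ ≤ ∫ θ in (-Real.pi)..Real.pi, g θ := by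
      apply intervalIntegral.integral_mono_interval (by linarith) (by linarith) hs1 _ (hgint _ _)
      exact Filter.Eventually.of_forall fun x => (Real.exp_pos _).le
    rw [intervalIntegral.integral_const] at h1
    refine le_trans (le_of_eq ?_) (h1.trans h2)
    simp only [smul_eq_mul]; ring
  have hre : (∫ θ in (-Real.pi)..Real.pi, (g θ : ℂ)).re = ∫ θ in (-Real.pi)..Real.pi, g θ := by
    rw [intervalIntegral.integral_ofReal]; simp
  have h5 := Complex.re_le_norm (-((∫ θ in (-Real.pi)..Real.pi, ψ θ^(l+1)) - ∫ θ in (-Real.pi)..Real.pi, (g θ : ℂ)))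
  rw [norm_neg, Complex.neg_re, Complex.sub_re, hre] at h5
  have herr : (l+1)*T1*(4/(l*c1)^2) ≤ m0 / √N := by
    have h6 : (l+1)*T1*(4/(l*c1)^2) ≤ E / N := by
      have hl2 : N ≤ 2 * l := by rw [hNl]; linarith
      rw [hE, ← hNl]
      have : N*T1*(4/(l*c1)^2) = 4 * T1 / c1^2 * (N / l^2) := by field_simp
      rw [this]
      have h7 : N / l^2 ≤ 4 / N := by
        rw [div_le_div_iff₀ (by positivity) hN0]; nlinarith
      calc 4 * T1 / c1^2 * (N / l^2) ≤ 4 * T1 / c1^2 * (4/N) := by gcongr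
        _ = _ := by ring
    refine h6.trans ?_
    rw [div_le_div_iff₀ hN0 hsN]
    have h8 : E/m0 ≤ √N := Real.le_sqrt_of_sq_le hn3
    rw [div_le_iff₀ (Real.exp_pos _)] at h8
    calc E * √N ≤ (√N * m0) * √N := by gcongr
      _ = m0 * (√N*√N) := by ring
      _ = m0 * N := by rw [hss]
  have : 2 * m0/√N = m0/√N + m0/√N := by ring
  linarith

noncomputable def rR (z : ℝ) (d : ℕ) : ℝ := if 2 ≤ d then z^d / d.factorial else 0

theorem rR_nonneg {z : ℝ} (hz : 0 ≤ z) (d : ℕ) : 0 ≤ rR z d := by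
  unfold rR; split_ifs <;> positivity

theorem GC_zero (Y : ℂ) : GC 0 Y = Complex.exp Y - 1 - Y := by simp [GC]

theorem rC_hasSum (Y : ℂ) : HasSum (fun d : ℕ => (if 2 ≤ d then Y^d / d.factorial else 0 : ℂ)) (GC 0 Y) := by
  rw [GC_zero]
  have h1 : HasSum (fun p : ℕ => if p = 0 then (1:ℂ) else 0) 1 := hasSum_ite_eq _ _
  have h2 : HasSum (fun p : ℕ => if p = 1 then Y else 0) Y := hasSum_ite_eq _ _
  refine (((exp_hs Y).sub h1).sub h2).congr_fun' fun d => ?_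
  match d with
  | 0 => simp
  | 1 => simp
  | (d+2) => simp

theorem rR_hasSum (z : ℝ) : HasSum (rR z) (gg z) := by
  rw [← Complex.hasSum_ofReal]
  have := rC_hasSum z
  rw [GC_zero] at this
  have e : ((gg z : ℝ) : ℂ) = Complex.exp z - 1 - z := by simp [gg]
  rw [e]
  refine this.congr_fun' fun d => ?_
  unfold rR; split_ifs <;> simp

theorem rR_mean (z : ℝ) : HasSum (fun d : ℕ => rR z d * d) (z * (Real.exp z - 1)) := by
  rw [← hasSum_nat_add_iff' 1]
  have h0 : HasSum (fun d : ℕ => z^d/(d.factorial:ℝ)) (Real.exp z) := by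
    rw [Real.exp_eq_exp_ℝ]; exact NormedSpace.expSeries_div_hasSum_exp z
  have h1 : HasSum (fun p : ℕ => if p = 0 then (1:ℝ) else 0) 1 := hasSum_ite_eq _ _
  have := (h0.sub h1).mul_left z
  have e : z * (Real.exp z - 1) - ∑ i ∈ Finset.range 1, rR z i * i = z * (Real.exp z - 1) := by simp
  rw [e]
  refine this.congr_funR fun d => ?_
  match d with
  | 0 => simp [rR]
  | (d+1) =>
    simp only [rR, show 2 ≤ d+1+1 by omega, if_true, Nat.factorial_succ]
    push_cast
    have : ((d:ℝ)+1+1) ≠ 0 := by positivity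
    have : ((d:ℝ)+1) ≠ 0 := by positivity
    have : (d.factorial : ℝ) ≠ 0 := by positivity
    simp
    field_simp
    ring

theorem rR_expm (z : ℝ) : HasSum (fun d : ℕ => rR z d * Real.exp d) (gg (Real.exp 1 * z)) := by
  refine (rR_hasSum (Real.exp 1 * z)).congr_funR fun d => ?_
  unfold rR; split_ifs
  · rw [mul_pow, ← Real.exp_nat_mul]; simp; ring
  · simp

theorem cexp_taylor (x : ℝ) : ‖Complex.exp (Complex.I * x) - (1 + Complex.I * x - x^2/2)‖ ≤ 4 * |x|^3 := by
  rcases le_total |x| 1 with h | h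
  · have := Complex.exp_bound (x := Complex.I * x) (by simpa using h) (n := 3) (by norm_num)
    have e : ∑ m ∈ Finset.range 3, (Complex.I * x)^m / (m.factorial : ℂ) = 1 + Complex.I * x - x^2/2 := by
      simp [Finset.sum_range_succ, Nat.factorial, mul_pow]; ring
    rw [e] at this
    refine this.trans ?_
    simp [Nat.factorial]
    have : 0 ≤ |x|^3 := by positivity
    nlinarith
  · have h1 : ‖Complex.exp (Complex.I * x)‖ = 1 := by rw [mul_comm, Complex.norm_exp_ofReal_mul_I]
    have h2 : ‖(1 + Complex.I * x - x^2/2 : ℂ)‖ ≤ 1 + |x| + |x|^2/2 := by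
      refine (norm_sub_le _ _).trans ?_
      refine add_le_add ((norm_add_le _ _).trans ?_) ?_ <;> simp
    have h3 := norm_sub_le (Complex.exp (Complex.I * x)) (1 + Complex.I * x - x^2/2)
    have h4 : |x| ≤ |x|^3 := by nlinarith [sq_nonneg (|x|), mul_self_nonneg (|x|-1)]
    have h5 : |x|^2 ≤ |x|^3 := by nlinarith [sq_nonneg (|x|)]
    linarith

theorem cube_le_exp {x : ℝ} (hx : 0 ≤ x) : x^3 ≤ 6 * Real.exp x := by
  have := Real.pow_div_factorial_le_exp x hx 3
  norm_num [Nat.factorial] at this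
  linarith

open Complex in
theorem LB {z0 K : ℝ} (hz0 : 0 < z0) (hzK : z0 ≤ K) : ∃ c > 0, ∃ n0 : ℕ, ∀ (z : ℝ) (n M : ℕ), z0 ≤ z → z ≤ K → n0 ≤ n →
    kap z * n = M → c / √n * gg z ^ n ≤ qq n (0,M) * z^M := by
  have hK0 : 0 < K := hz0.trans_le hzK
  have hcd := cd_pos hz0 hK0
  set T : ℝ := 6 * Real.exp (2+K) * Real.exp (Real.exp 1 * K) / (z0^2/2) with hT
  set v0 := min (z0^2/2) (z0^3/6) / Real.exp K / 2 with hv0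
  have hv0p : 0 < v0 := by
    have : 0 < min (z0^2/2) (z0^3/6) := lt_min (by positivity) (by positivity)
    positivity
  have hTp : 0 < T := by positivity
  obtain ⟨c, hc, n0, H⟩ := llt_lower (T0 := 1 + 4*T) (v0 := v0) (c := cd z0 K * (2/Real.pi^2)) hv0p (by positivity) (by positivity)
  refine ⟨c/(2*Real.pi), by positivity, n0, ?_⟩
  intro z n M hz1 hz2 hn hM
  have hz : 0 < z := hz0.trans_le hz1
  have hg : 0 < gg z := gg_pos hz.ne'
  set κ := kap z with hκ
  have hκ2 : κ ≤ 2 + K := (kap_le hz).trans (by linarith)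
  have hκ0 : 2 ≤ κ := kap_two_lt hz
  have hgK : gg z ≤ Real.exp K := by
    have := Real.exp_le_exp.2 hz2
    unfold gg; linarith
  have hgl : z0^2/2 ≤ gg z := le_trans (by gcongr) (gg_ge hz.le)
  set p : ℕ → ℝ := fun d => rR z d / gg z with hp
  have hp0 : ∀ d, 0 ≤ p d := fun d => div_nonneg (rR_nonneg hz.le d) hg.le
  have s0 : HasSum p 1 := by
    have := (rR_hasSum z).div_const (gg z)
    rwa [div_self hg.ne'] at this
  have s1 : HasSum (fun d => p d * ((d:ℝ) - κ)) 0 := by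
    have h1 := ((rR_mean z).div_const (gg z)).sub (s0.mul_right κ)
    have e : z * (Real.exp z - 1) / gg z - 1 * κ = 0 := by rw [hκ, kap]; ring
    rw [e] at h1
    exact h1.congr_funR fun d => by rw [hp]; ring
  have s3 : HasSum (fun d => p d * (6 * Real.exp (2+K) * Real.exp d)) (6 * Real.exp (2+K) * (gg (Real.exp 1 * z) / gg z)) := by
    exact (((rR_expm z).div_const (gg z)).mul_left (6 * Real.exp (2+K))).congr_funR fun d => by rw [hp]; ring
  have hcube : ∀ d : ℕ, |(d:ℝ) - κ|^3 ≤ 6 * Real.exp (2+K) * Real.exp d := by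
    intro d
    have h1 : |(d:ℝ) - κ| ≤ d + κ := by rw [abs_le]; constructor <;> linarith [(Nat.cast_nonneg d : (0:ℝ) ≤ d)]
    calc |(d:ℝ) - κ|^3 ≤ 6 * Real.exp (|(d:ℝ) - κ|) := cube_le_exp (abs_nonneg _)
      _ ≤ 6 * Real.exp ((2+K) + d) := by gcongr; linarith
      _ = _ := by rw [Real.exp_add]; ring
  have hTle : 6 * Real.exp (2+K) * (gg (Real.exp 1 * z) / gg z) ≤ T := by
    have h1 : gg (Real.exp 1 * z) ≤ Real.exp (Real.exp 1 * K) := by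
      have : Real.exp (Real.exp 1 * z) ≤ Real.exp (Real.exp 1 * K) := Real.exp_le_exp.2 (by gcongr)
      have h2 : 0 < Real.exp 1 * z := by positivity
      unfold gg; linarith
    rw [hT, mul_div_assoc]
    gcongr
  have sc : Summable (fun d => p d * |(d:ℝ) - κ|^3) :=
    Summable.of_nonneg_of_le (fun d => mul_nonneg (hp0 d) (by positivity)) (fun d => mul_le_mul_of_nonneg_left (hcube d) (hp0 d)) s3.summable
  have hTc : ∑' d, p d * |(d:ℝ) - κ|^3 ≤ T := by
    refine le_trans ?_ hTle
    rw [← s3.tsum_eq]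
    exact sc.tsum_le_tsum (fun d => mul_le_mul_of_nonneg_left (hcube d) (hp0 d)) s3.summable
  have hsq : ∀ d : ℕ, ((d:ℝ)-κ)^2 ≤ 1 + |(d:ℝ) - κ|^3 := by
    intro d
    rw [← sq_abs]
    set x := |(d:ℝ)-κ|
    have hx : 0 ≤ x := abs_nonneg _
    rcases le_total x 1 with h | h
    · nlinarith [pow_nonneg hx 3]
    · nlinarith [sq_nonneg x]
  have ss : Summable (fun d => p d * ((d:ℝ)-κ)^2) := by
    refine Summable.of_nonneg_of_le (fun d => mul_nonneg (hp0 d) (by positivity)) (fun d => ?_) (s0.summable.add sc)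
    have := mul_le_mul_of_nonneg_left (hsq d) (hp0 d)
    linarith
  set v := ∑' d, p d * ((d:ℝ)-κ)^2 with hv
  have hv1 : v ≤ 1 + 4*T := by
    have : v ≤ ∑' d, (p d + p d * |(d:ℝ) - κ|^3) := ss.tsum_le_tsum (fun d => by
      have := mul_le_mul_of_nonneg_left (hsq d) (hp0 d)
      linarith) (s0.summable.add sc)
    rw [s0.summable.tsum_add sc, s0.tsum_eq] at this
    linarith
  have hv2 : v0 ≤ v := by
    have h1 := ss.sum_le_tsum {2,3} (fun d _ => mul_nonneg (hp0 d) (by positivity))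
    rw [Finset.sum_pair (by norm_num), ← hv] at h1
    refine le_trans ?_ h1
    have hmin : 0 < min (z0^2/2) (z0^3/6) := lt_min (by positivity) (by positivity)
    set u := min (z0^2/2) (z0^3/6) / Real.exp K with hu
    have hu0 : 0 < u := by positivity
    have p2 : u ≤ p 2 := by
      simp only [hp, rR, le_refl, if_true]
      rw [hu]; gcongr
      refine (min_le_left _ _).trans ?_
      norm_num [Nat.factorial]; gcongr
    have p3 : u ≤ p 3 := by
      simp only [hp, rR, show 2 ≤ 3 by norm_num, if_true]
      rw [hu]; gcongr
      refine (min_le_right _ _).trans ?_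
      norm_num [Nat.factorial]; gcongr
    have q2 := mul_le_mul_of_nonneg_right p2 (sq_nonneg (((2:ℕ):ℝ)-κ))
    have q3 := mul_le_mul_of_nonneg_right p3 (sq_nonneg (((3:ℕ):ℝ)-κ))
    have : u/2 ≤ u * (((2:ℕ):ℝ)-κ)^2 + u * (((3:ℕ):ℝ)-κ)^2 := by
      push_cast
      nlinarith [mul_nonneg hu0.le (sq_nonneg (2*κ-5))]
    rw [hv0]; exact this.trans (add_le_add q2 q3)
  set ψ : ℝ → ℂ := fun θ => GC 0 (z * exp (I * θ)) * exp (-(I * κ * θ)) / gg z with hψ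
  have hgc : (gg z : ℂ) ≠ 0 := by exact_mod_cast hg.ne'
  have hψs : ∀ θ : ℝ, HasSum (fun d => (p d : ℂ) * exp (I * (((d:ℝ)-κ)*θ:ℝ))) (ψ θ) := by
    intro θ
    refine (((rC_hasSum (z * exp (I * θ))).mul_right (exp (-(I * κ * θ)))).div_const (gg z : ℂ)).congr_fun' fun d => ?_
    simp only [hp, rR]
    split_ifs
    · rw [mul_pow, ← exp_nat_mul]
      have : exp (I * (((d:ℝ)-κ)*θ:ℝ)) = exp (d * (I*θ)) * exp (-(I * κ * θ)) := by
        rw [← exp_add]; congr 1; push_cast; ring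
      rw [this]; push_cast; ring
    · simp
  have hψc : Continuous ψ := by
    simp only [hψ, GC_zero]; fun_prop
  have hgr : GR 0 z = gg z := by simp [GR, gg]
  have hdec : ∀ θ ∈ Set.Icc (-Real.pi) Real.pi, ‖ψ θ‖ ≤ Real.exp (-(cd z0 K * (2/Real.pi^2) * θ^2)) := by
    intro θ hθ
    have h1 := GC_D1 (x := 0) hz0 le_rfl hK0.le hz1 hz2 θ
    rw [hgr] at h1
    simp only [hψ]
    rw [norm_div, norm_mul, norm_real, Real.norm_of_nonneg hg.le]
    have : ‖exp (-(I * κ * θ))‖ = 1 := by rw [norm_exp]; simp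
    rw [this, mul_one, div_le_iff₀ hg]
    rw [ofReal_zero] at h1
    refine h1.trans ?_
    have := Real.cos_le_one_sub_mul_cos_sq (x := θ) (abs_le.2 hθ)
    have h2 := mul_le_mul_of_nonneg_left (by linarith : 2/Real.pi^2*θ^2 ≤ 1 - Real.cos θ) hcd.le
    calc gg z * Real.exp (-(cd z0 K * (1 - Real.cos θ))) ≤ gg z * Real.exp (-(cd z0 K * (2/Real.pi^2) * θ^2)) :=
          mul_le_mul_of_nonneg_left (Real.exp_le_exp.2 (by linarith)) hg.le
      _ = _ := mul_comm _ _
  have htay : ∀ θ ∈ Set.Icc (-Real.pi) Real.pi, ‖ψ θ - ((1 - v*θ^2/2 : ℝ) : ℂ)‖ ≤ (1+4*T) * |θ|^3 := by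
    intro θ _
    have c0 : HasSum (fun d => (p d : ℂ)) 1 := by
      have := Complex.hasSum_ofReal.2 s0; simpa using this
    have c1 : HasSum (fun d => ((p d * ((d:ℝ)-κ) : ℝ) : ℂ)) 0 := by
      have := Complex.hasSum_ofReal.2 s1; simpa using this
    have c2 : HasSum (fun d => ((p d * ((d:ℝ)-κ)^2 : ℝ) : ℂ)) (v:ℂ) := Complex.hasSum_ofReal.2 ss.hasSum
    have h1 := (hψs θ).sub ((c0.add (c1.mul_left (I * θ))).sub (c2.mul_left ((θ:ℂ)^2/2)))
    have h2 : HasSum (fun d => 4 * |θ|^3 * (p d * |(d:ℝ) - κ|^3)) (4 * |θ|^3 * ∑' d, p d * |(d:ℝ) - κ|^3) := sc.hasSum.mul_left _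
    have h3 := h1.norm_le_of_bounded h2 (fun d => by
      have := cexp_taylor (((d:ℝ)-κ)*θ)
      have e : (p d : ℂ) * exp (I * (((d:ℝ)-κ)*θ:ℝ)) - ((p d : ℂ) + I * θ * ((p d * ((d:ℝ)-κ) : ℝ) : ℂ) - (θ:ℂ)^2/2 * ((p d * ((d:ℝ)-κ)^2 : ℝ) : ℂ))
        = (p d : ℂ) * (exp (I * (((d:ℝ)-κ)*θ:ℝ)) - (1 + I * (((d:ℝ)-κ)*θ:ℝ) - ((((d:ℝ)-κ)*θ:ℝ):ℂ)^2/2)) := by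
        push_cast; ring
      rw [e, norm_mul, norm_real, Real.norm_of_nonneg (hp0 d)]
      refine (mul_le_mul_of_nonneg_left this (hp0 d)).trans (le_of_eq ?_)
      rw [abs_mul, mul_pow]; ring)
    have e : ψ θ - (1 + I * θ * 0 - (θ:ℂ)^2/2 * v) = ψ θ - ((1 - v*θ^2/2 : ℝ) : ℂ) := by push_cast; ring
    rw [e] at h3
    refine h3.trans ?_
    have h4 : 0 ≤ |θ|^3 := by positivity
    nlinarith
  have hfin := H v ψ hv2 hv1 hψc hdec htay n hn
  -- identify
  have hq := qq_fourier n M 0 z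
  have hq2 : HasSum (fun q : ℕ × ℕ => if q.2 = M then (qq n q : ℂ) * mon 0 z q else 0) ((qq n (0,M) : ℂ) * z^M) := by
    have := hasSum_single (f := fun q : ℕ × ℕ => if q.2 = M then (qq n q : ℂ) * mon 0 z q else 0) (0,M) (fun q hq => by
      split_ifs with h
      · have : q.1 ≠ 0 := by
          intro h0; apply hq; ext <;> simp [h0, h]
        simp [mon, this]
      · rfl)
    simpa [mon] using this
  have hq3 := hq.unique hq2
  have hint : ∫ φ in (-Real.pi)..Real.pi, GC 0 (z * exp (I * φ))^n * exp (-(I * M * φ)) = (gg z : ℂ)^n * ∫ θ in (-Real.pi)..Real.pi, ψ θ ^ n := by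
    rw [← intervalIntegral.integral_const_mul]
    congr 1
    funext θ
    simp only [hψ]
    rw [div_pow, mul_pow, ← exp_nat_mul, mul_div_cancel₀ _ (pow_ne_zero n hgc)]
    congr 2
    rw [show (M:ℂ) = ((κ * n : ℝ):ℂ) by rw [hM]; simp]
    push_cast; ring
  rw [hint] at hq3
  have hq4 : qq n (0,M) * z^M = gg z^n * (∫ θ in (-Real.pi)..Real.pi, ψ θ ^ n).re / (2*Real.pi) := by
    have e1 : (((qq n (0,M) : ℂ) * z^M)).re = qq n (0,M) * z^M := by
      rw [← ofReal_pow, ← ofReal_mul, ofReal_re]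
    rw [← e1, ← hq3, ← ofReal_pow, show (2*Real.pi:ℂ) = ((2*Real.pi:ℝ):ℂ) by push_cast; ring, div_ofReal_re, re_ofReal_mul]
  rw [hq4, le_div_iff₀ (by positivity)]
  calc c/(2*Real.pi)/√n * gg z^n * (2*Real.pi) = gg z^n * (c/√n) := by field_simp
    _ ≤ _ := by gcongr

noncomputable def stp (n : ℕ) : ℝ := ((n:ℝ)/Real.exp 1)^n

theorem stp_pos {n : ℕ} (hn : 0 < n) : 0 < stp n := by unfold stp; positivity

theorem fact_ge {n : ℕ} : √n * stp n ≤ n.factorial := by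
  refine le_trans ?_ (Stirling.le_factorial_stirling n)
  unfold stp
  gcongr
  have := Real.pi_gt_three
  nlinarith [(Nat.cast_nonneg n : (0:ℝ) ≤ n)]

theorem fact_le {n : ℕ} (hn : 0 < n) : (n.factorial:ℝ) ≤ 3 * (√n * stp n) := by
  obtain ⟨j, rfl⟩ : ∃ j, n = j+1 := ⟨n-1, by omega⟩
  have h := Stirling.stirlingSeq'_antitone (Nat.zero_le j)
  simp only [Function.comp, Nat.succ_eq_add_one, zero_add, Stirling.stirlingSeq_one] at h
  unfold Stirling.stirlingSeq at h
  have hs := stp_pos hn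
  have h2 : √(2 * ((j+1:ℕ):ℝ)) * stp (j+1) > 0 := by positivity
  have h3 : ((j+1).factorial : ℝ) ≤ Real.exp 1 / √2 * (√(2 * ((j+1:ℕ):ℝ)) * stp (j+1)) := by
    rw [← div_le_iff₀ h2]; exact h
  refine h3.trans ?_
  rw [Real.sqrt_mul (by norm_num)]
  have : Real.exp 1 / √2 * (√2 * √((j+1:ℕ):ℝ) * stp (j+1)) = Real.exp 1 * (√((j+1:ℕ):ℝ) * stp (j+1)) := by
    field_simp
  rw [this]
  have := Real.exp_one_lt_three
  gcongr

theorem stp_mul (k l : ℕ) : stp (k*l) = ((k:ℝ)^l)^k * stp l ^k := by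
  unfold stp
  push_cast
  rw [← mul_pow, ← mul_pow, ← pow_mul, mul_div_assoc, mul_comm l k]

theorem stp_ratio {l l' : ℕ} (hl : 0 < l) (hl' : 0 < l') :
    (l:ℝ)^l*(l':ℝ)^l'/((l+l':ℕ):ℝ)^(l+l') = stp l * stp l' / stp (l+l') := by
  unfold stp
  have : ((l+l':ℕ):ℝ) ≠ 0 := by positivity
  simp only [div_pow, pow_add]
  field_simp

theorem CH {k l l' : ℕ} (hk : 1 ≤ k) (hl : 0 < l) (hl' : 0 < l') :
    ((l+l').choose l : ℝ) * (k*l).factorial * (k*l').factorial ≤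
      27 * √k * ((l:ℝ)^l*(l':ℝ)^l'/((l+l':ℕ):ℝ)^(l+l'))^(k-1) * (k*(l+l')).factorial := by
  rw [stp_ratio hl hl']
  have hm : 0 < l + l' := by omega
  have p1 := stp_pos hl
  have p2 := stp_pos hl'
  have p3 := stp_pos hm
  have s1 : 0 < √(l:ℝ) := by positivity
  have s2 : 0 < √(l':ℝ) := by positivity
  have s3 : 0 < √((l+l':ℕ):ℝ) := by positivity
  have hk0 : 0 < √(k:ℝ) := by positivity
  have hc : ((l+l').choose l : ℝ) * (l.factorial * l'.factorial) = (l+l').factorial := by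
    have := Nat.add_choose_mul_factorial_mul_factorial l l'
    rw [← this, Nat.choose_symm_add]; push_cast; ring
  have hc1 : ((l+l').choose l : ℝ) ≤ 3 * (√((l+l':ℕ):ℝ) * stp (l+l')) / ((√l * stp l)*(√l' * stp l')) := by
    rw [le_div_iff₀ (by positivity)]
    calc _ ≤ ((l+l').choose l : ℝ) * (l.factorial * l'.factorial) := by
          gcongr <;> exact fact_ge
      _ = _ := hc
      _ ≤ _ := fact_le hm
  have h1 := fact_le (n := k*l) (by positivity)
  have h2 := fact_le (n := k*l') (by positivity)
  have h3 := fact_ge (n := k*(l+l'))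
  rw [stp_mul] at h1 h2 h3
  rw [Nat.cast_mul, Real.sqrt_mul (by positivity)] at h1 h2 h3
  calc _ ≤ 3 * (√((l+l':ℕ):ℝ) * stp (l+l')) / ((√l * stp l)*(√l' * stp l')) * (3 * (√k * √l * (((k:ℝ)^l)^k * stp l ^k))) * (3 * (√k * √l' * (((k:ℝ)^l')^k * stp l' ^k))) := by
        gcongr
    _ = 27 * √k * (stp l * stp l' / stp (l+l'))^(k-1) * (√k * √((l+l':ℕ):ℝ) * (((k:ℝ)^(l+l'))^k * stp (l+l') ^k)) := by
        obtain ⟨j, rfl⟩ : ∃ j, k = j+1 := ⟨k-1, by omega⟩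
        simp only [Nat.add_sub_cancel, pow_succ, pow_add, div_pow, mul_pow]
        field_simp
        ring
    _ ≤ _ := by gcongr

theorem base_ratio {P z c G g Q D x y : ℝ} {n a b : ℕ} (hn : 0 < n) (hc : 0 < c) (hg : 0 < g) (hx : 0 < x) (hy : 0 < y) 
    (hz : 0 < z) (hP : c / √n * g^n ≤ P * z^(a+b)) (hQ : Q * (x^a*y^b) ≤ D * G^n) (hD : 0 ≤ D) (hG : 0 ≤ G):
    Q ≤ (D * √n / c) * ((z/x)^a * (z/y)^b) * (G/g)^n * P := by
  have hs : 0 < √(n:ℝ) := by positivity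
  have h1 : g^n ≤ √n/c * (P * z^(a+b)) := by
    have := mul_le_mul_of_nonneg_left hP (by positivity : 0 ≤ √n/c)
    refine le_trans (le_of_eq ?_) this
    field_simp
  have h2 : Q ≤ D * G^n / (x^a*y^b) := by rw [le_div_iff₀ (by positivity)]; exact hQ
  refine h2.trans ?_
  have e : D * G^n/(x^a*y^b) = D * (G/g)^n / (x^a*y^b) * g^n := by
    rw [div_pow]; field_simp
  rw [e]
  have h3 := mul_le_mul_of_nonneg_left h1 (by positivity : 0 ≤ D * (G/g)^n / (x^a*y^b))
  refine h3.trans (le_of_eq ?_)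
  rw [pow_add]; simp only [div_pow]; field_simp

theorem kap_ivt {κ0 k κ : ℝ} (h0 : 2 < κ0) (h1 : κ0 ≤ κ) (h2 : κ ≤ k) : ∃ z, κ0 - 2 ≤ z ∧ z ≤ k ∧ kap z = κ := by
  have hc : ContinuousOn kap (Set.Icc (κ0-2) k) := by
    intro z hz
    have hz0 : 0 < z := by linarith [hz.1]
    apply ContinuousAt.continuousWithinAt
    unfold kap
    exact ContinuousAt.div (by fun_prop) (gg_hasDeriv z).continuousAt (gg_pos hz0.ne').ne'
  have h := intermediate_value_Icc (by linarith) hc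
  have : κ ∈ Set.Icc (kap (κ0-2)) (kap k) := ⟨by linarith [kap_le (show 0 < κ0-2 by linarith)], by linarith [kap_ge (show 0 < k by linarith)]⟩
  obtain ⟨z, hz, e⟩ := h this
  exact ⟨z, hz.1, hz.2, e⟩

theorem setup {k : ℕ} {κ0 : ℝ} (h0 : 2 < κ0) (hκk : κ0 ≤ k) : ∃ c > 0, ∃ n0 : ℕ, 0 < n0 ∧ ∀ m n : ℕ, n0 ≤ n → κ0 * n ≤ k * m → m ≤ n →
    ∃ z, κ0 - 2 ≤ z ∧ z ≤ k ∧ kap z * n = k * m ∧ c/√n * gg z^n ≤ qq n (0,k*m) * z^(k*m) := by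
  obtain ⟨c, hc, n0, H⟩ := LB (z0 := κ0 - 2) (K := k) (by linarith) (by linarith)
  refine ⟨c, hc, n0+1, by omega, fun m n hn hm hmn => ?_⟩
  have hn0 : (0:ℝ) < n := by exact_mod_cast (by omega : 0 < n)
  have hmn' : (m:ℝ) ≤ n := by exact_mod_cast hmn
  obtain ⟨z, hz1, hz2, hz3⟩ := kap_ivt (κ := k*m/n) h0 (by rw [le_div_iff₀ hn0]; exact hm) (show _ ≤ (k:ℝ) by
    rw [div_le_iff₀ hn0]; gcongr)
  have e : kap z * n = k * m := by rw [hz3]; field_simp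
  exact ⟨z, hz1, hz2, e, H z n (k*m) hz1 hz2 (by omega) (by rw [e]; push_cast; ring)⟩

theorem setup_pos {P z c : ℝ} {n M : ℕ} (hn : 0 < n) (hc : 0 < c) (hz : 0 < z) (h : c/√n * gg z^n ≤ P * z^M) : 0 < P := by
  have := gg_pos hz.ne'
  have h1 : 0 < c/√n * gg z^n := by positivity
  have h2 := h1.trans_le h
  exact pos_of_mul_pos_left h2 (by positivity)

theorem cosh_small {x : ℝ} (h0 : 0 ≤ x) (h1 : x ≤ 1) : Real.cosh x - 1 ≤ x^2 := by
  have h := Real.cosh_le_exp_half_sq x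
  have h2 : Real.exp (x^2/2) ≤ 1 + x^2 := by
    have h3 := Real.add_one_le_exp (-(x^2/2))
    have h4 : Real.exp (x^2/2) * Real.exp (-(x^2/2)) = 1 := by rw [← Real.exp_add]; simp
    have h5 := Real.exp_pos (x^2/2)
    have h6 : x^2 ≤ 1 := by nlinarith
    have h7 : Real.exp (x^2/2) * (1 - x^2/2) ≤ 1 := by nlinarith
    by_contra hc
    push Not at hc
    nlinarith [sq_nonneg x]
  linarith

theorem GR_small {z0 K z x : ℝ} (hz0 : 0 < z0) (h1 : z0 ≤ z) (h2 : z ≤ K) (hx0 : 0 ≤ x) (hx1 : x ≤ 1) :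
    GR x z / gg z ≤ Real.exp (2 * Real.exp K / z0^2 * x^2) := by
  have hz : 0 < z := by linarith
  have hg := gg_pos hz.ne'
  have hg2 := gg_ge hz.le
  have e : GR x z = gg z + (Real.cosh x - 1) * Real.exp z := by unfold GR gg; ring
  have h3 := cosh_small hx0 hx1
  have h4 : Real.exp z ≤ 2 * Real.exp K / z0^2 * gg z := by
    have h5 : Real.exp z ≤ Real.exp K := Real.exp_le_exp.2 h2
    have h6 : z0^2/2 ≤ gg z := by nlinarith
    calc Real.exp z ≤ Real.exp K := h5
      _ = 2 * Real.exp K / z0^2 * (z0^2/2) := by field_simp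
      _ ≤ _ := by gcongr
  rw [div_le_iff₀ hg, e]
  have h5 := Real.add_one_le_exp (2 * Real.exp K / z0^2 * x^2)
  have h6 : (Real.cosh x - 1) * Real.exp z ≤ x^2 * (2 * Real.exp K / z0^2 * gg z) := by
    have := Real.exp_pos z
    gcongr
  nlinarith

theorem smallR {k : ℕ} (hk : 1 ≤ k) {κ0 : ℝ} (h0 : 2 < κ0) (hκk : κ0 ≤ k) : ∃ C1 > 0, ∃ C0 > 0, ∃ n0 : ℕ, 0 < n0 ∧ ∀ m n : ℕ, n0 ≤ n → κ0 * n ≤ k * m → m ≤ n →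
    0 < qq n (0,k*m) ∧ ∀ (x : ℝ) (a b : ℕ), 0 < x → x ≤ 1 → a + b = k * m → 
      qq n (a,b) ≤ C1 * (k/x)^a * Real.exp (C0 * x^2 * n) * qq n (0,k*m) := by
  obtain ⟨c, hc, n0, hn0, H⟩ := setup h0 hκk
  have hz0 : 0 < κ0 - 2 := by linarith
  have hk' : (1:ℝ) ≤ k := by exact_mod_cast hk
  have hcd := cd_pos hz0 (by linarith : (0:ℝ) < k)
  refine ⟨1/√(cd (κ0-2) k)/c, by positivity, 2 * Real.exp k / (κ0-2)^2, by positivity, n0, hn0, fun m n hn hm hmn => ?_⟩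
  obtain ⟨z, h1, h2, h3, h4⟩ := H m n hn hm hmn
  have hz : 0 < z := by linarith
  have hnp : 0 < n := by omega
  have hP := setup_pos hnp hc hz h4
  refine ⟨hP, fun x a b hx0 hx1 hab => ?_⟩
  have hU := U1 (K := k) hz0 hx0.le (by linarith) h1 h2 hnp a b
  have hg := gg_pos hz.ne'
  have hG := GR_pos (x := x) hz
  rw [← hab] at h4
  have := base_ratio hnp hc hg hx0 hz hz h4 hU (by positivity) hG.le
  rw [hab] at this
  refine this.trans ?_
  have hs : 0 < √(n:ℝ) := by positivity
  have e : 1/√(cd (κ0-2) k)/√n * √n / c = 1/√(cd (κ0-2) k)/c := by field_simp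
  rw [e, div_self hz.ne', one_pow, mul_one]
  gcongr
  calc (GR x z / gg z)^n ≤ Real.exp (2 * Real.exp k / (κ0-2)^2 * x^2)^n := by
        gcongr
        exact GR_small hz0 h1 h2 hx0.le hx1
    _ = _ := by rw [← Real.exp_nat_mul]; ring_nf

theorem pair_bound {k : ℕ} (hk : 1 ≤ k) {κ0 : ℝ} (h0 : 2 < κ0) (hκk : κ0 ≤ k) : ∃ C > 0, ∃ n0 : ℕ, 0 < n0 ∧ ∀ m n : ℕ, n0 ≤ n → κ0 * n ≤ k * m → m ≤ n →
    ((2).factorial : ℝ) * (k*m-2).factorial * qq n (2,k*m-2) ≤ C / n * ((k*m).factorial * qq n (0,k*m)) := by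
  obtain ⟨C1, hC1, C0, hC0, n0, hn0, H⟩ := smallR hk h0 hκk
  refine ⟨2*C1*k^2*Real.exp C0, by positivity, n0, hn0, fun m n hn hm hmn => ?_⟩
  obtain ⟨hP, H⟩ := H m n hn hm hmn
  have hnp : (1:ℝ) ≤ n := by exact_mod_cast (by omega : 1 ≤ n)
  have hs : 1 ≤ √(n:ℝ) := by rw [Real.one_le_sqrt]; exact hnp
  have hM : 2 * n ≤ k * m := by
    have : (2:ℝ) * n ≤ k * m := le_trans (by gcongr) hm
    exact_mod_cast this
  have hn1 : 1 ≤ n := by omega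
  have := H (1/√n) 2 (k*m-2) (by positivity) (by rw [div_le_one (by positivity)]; exact hs) (by omega)
  obtain ⟨j, hj⟩ : ∃ j, k*m = j+2 := ⟨k*m-2, by omega⟩
  rw [hj] at this ⊢
  simp only [Nat.add_sub_cancel] at this ⊢
  rw [div_pow, div_pow, Real.sq_sqrt (by positivity), one_pow] at this
  have e1 : C0 * (1 / (n:ℝ)) * n = C0 := by field_simp
  have e2 : ((k:ℝ)/(1/√n))^2 = k^2 * n := by
    rw [div_div_eq_mul_div, div_one, mul_pow, Real.sq_sqrt (by positivity)]
  have e3 : (1/√(n:ℝ))^2 = 1/n := by rw [div_pow, Real.sq_sqrt (by positivity), one_pow]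
  have hjn : n ≤ j + 1 := by omega
  have hjn' : (n:ℝ) ≤ j + 1 := by exact_mod_cast hjn
  have this' : qq n (2,j) ≤ C1 * (k^2 * n) * Real.exp C0 * qq n (0,j+2) := by
    refine this.trans (le_of_eq ?_)
    rw [e1]; congr 3
    rw [← e2, div_pow, div_pow, Real.sq_sqrt (by positivity), one_pow]
  rw [show (j+2).factorial = (j+2)*((j+1)*j.factorial) by simp [Nat.factorial_succ]]
  push_cast
  rw [hj] at hP
  calc ((2).factorial:ℝ) * j.factorial * qq n (2,j) ≤ 2 * j.factorial * (C1 * (k^2 * n) * Real.exp C0 * qq n (0,j+2)) := by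
        norm_num [Nat.factorial]; gcongr
    _ = 2*C1*k^2*Real.exp C0 / n * (n * (n * j.factorial) * qq n (0,j+2)) := by field_simp
    _ ≤ _ := by
        gcongr
        linarith

noncomputable def tm (k n l l' : ℕ) : ℝ := ((l+l').choose l : ℝ) * (k*l).factorial * (k*l').factorial * qq n (k*l,k*l')

theorem small_term {k : ℕ} (hk : 3 ≤ k) {κ0 : ℝ} (h0 : 2 < κ0) (hκk : κ0 ≤ k) : ∃ B > 0, ∃ ε > 0, ∃ n0 : ℕ, 0 < n0 ∧ ∀ l l' n : ℕ, n0 ≤ n → κ0 * n ≤ k * (l+l':ℕ) → l+l' ≤ n → 2 ≤ l → 1 ≤ l' → (l:ℝ) ≤ ε * (l+l':ℕ) →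
    tm k n l l' ≤ B / (l+l':ℕ)^(k-2) * ((l:ℝ)^(k-2)*(1/2)^l) * ((k*(l+l')).factorial * qq n (0,k*(l+l'))) := by
  obtain ⟨C1, hC1, C0, hC0, n0, hn0, H⟩ := smallR (by omega) h0 hκk
  set C2 := (k:ℝ)^k * Real.exp (C0*k) with hC2
  have hk0 : (0:ℝ) < k := by positivity
  have hC2p : 0 < C2 := by positivity
  refine ⟨27*√k*C1*4*C2^2, by positivity, 1/(4*C2^2), by positivity, n0, hn0, fun l l' n hn hm hmn hl hl' hε => ?_⟩
  obtain ⟨hP, H⟩ := H (l+l') n hn hm hmn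
  have hlp : (0:ℝ) < l := by positivity
  have hmp : (0:ℝ) < (l+l':ℕ) := by positivity
  set m := l + l' with hmdef
  have hlm : (l:ℝ) ≤ m := by exact_mod_cast (by omega : l ≤ m)
  set q := √((l:ℝ)/m) with hq
  have hq0 : 0 < q := by positivity
  have hq2 : q^2 = l/m := Real.sq_sqrt (by positivity)
  have hq1 : q ≤ 1 := by rw [hq, Real.sqrt_le_one]; rw [div_le_one hmp]; exact hlm
  have h1 := H q (k*l) (k*l') hq0 hq1 (by rw [hmdef]; ring)
  have h2 := CH (k := k) (by omega) (by omega : 0 < l) (by omega : 0 < l')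
  rw [← hmdef] at h2
  have h3 : ((l:ℝ)^l*(l':ℝ)^l'/(m:ℝ)^m)^(k-1) ≤ ((q^2)^l)^(k-1) := by
    gcongr
    have hl'm : (l':ℝ) ≤ m := by exact_mod_cast (by omega : l' ≤ m)
    have e : (m:ℝ)^m = m^l * m^l' := by rw [← pow_add]
    rw [hq2, div_pow, div_le_div_iff₀ (by positivity) (by positivity), e]
    calc (l:ℝ)^l*(l':ℝ)^l' * m^l ≤ (l:ℝ)^l*(m:ℝ)^l' * m^l := by gcongr
      _ = _ := by ring
  have h4 : Real.exp (C0 * q^2 * n) ≤ Real.exp (C0*k) ^ l := by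
    rw [← Real.exp_nat_mul]
    apply Real.exp_le_exp.2
    have h5 : q^2 * n ≤ k * l := by
      rw [hq2, div_mul_eq_mul_div, div_le_iff₀ hmp]
      have : (n:ℝ) ≤ k*m := by
        have : (0:ℝ) ≤ n := by positivity
        nlinarith
      nlinarith
    nlinarith
  have h5 : tm k n l l' ≤ 27 * √k * ((q^2)^l)^(k-1) * (k*m).factorial * (C1 * (k/q)^(k*l) * Real.exp (C0*k)^l * qq n (0,k*m)) := by
    unfold tm
    rw [← hmdef]
    have := qq_nonneg n (k*l,k*l')
    refine mul_le_mul (h2.trans (by gcongr)) (h1.trans (by gcongr)) this (by positivity)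
  refine h5.trans ?_
  have e : ((q^2)^l)^(k-1) * ((k/q)^(k*l) * Real.exp (C0*k)^l) = (C2 * q^(k-2))^l := by
    rw [hC2, pow_mul (k/q : ℝ) k l, pow_right_comm (q^2) l (k-1), ← mul_pow, ← mul_pow]
    congr 1
    obtain ⟨j, rfl⟩ : ∃ j, k = j+2 := ⟨k-2, by omega⟩
    have e1 : (q^2)^(j+1) = q^j * q^(j+2) := by rw [← pow_mul, ← pow_add]; congr 1; ring
    rw [show j+2-1 = j+1 by omega, e1, Nat.add_sub_cancel, div_pow]
    field_simp
  have h6 : (C2 * q^(k-2))^l ≤ 4 * C2^2 * ((l:ℝ)^(k-2)/m^(k-2)) * (1/2)^l := by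
    obtain ⟨j, rfl⟩ : ∃ j, l = j+2 := ⟨l-2, by omega⟩
    rw [pow_add, ← div_pow, ← hq2, mul_pow _ _ 2, pow_right_comm q, pow_add (1/2:ℝ)]
    have h7 : C2 * q^(k-2) ≤ 1/2 := by
      have : q^(k-2) ≤ q := pow_le_of_le_one hq0.le hq1 (by omega)
      have h8 : q ≤ 1/(2*C2) := by
        rw [hq]
        apply Real.sqrt_le_iff.2 ⟨by positivity, ?_⟩
        rw [div_le_iff₀ hmp]
        refine hε.trans (le_of_eq ?_)
        ring
      calc C2 * q^(k-2) ≤ C2 * (1/(2*C2)) := by gcongr; linarith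
        _ = 1/2 := by field_simp
    calc (C2 * q^(k-2))^j * (C2^2 * (q^2)^(k-2)) ≤ (1/2)^j * (C2^2 * (q^2)^(k-2)) := by gcongr
      _ = _ := by ring
  calc _ = 27 * √k * C1 * (((q^2)^l)^(k-1) * ((k/q)^(k*l) * Real.exp (C0*k)^l)) * ((k*m).factorial * qq n (0,k*m)) := by ring
    _ ≤ 27 * √k * C1 * (4 * C2^2 * ((l:ℝ)^(k-2)/m^(k-2)) * (1/2)^l) * ((k*m).factorial * qq n (0,k*m)) := by
        rw [e]; gcongr
    _ = _ := by ring

noncomputable def Vv (k : ℕ) (r : ℝ) : ℝ := (1+r^k)^(k-1)/(1+r^(k-1))^k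
noncomputable def Uu (k : ℕ) (r : ℝ) : ℝ := (1-r^(k-1))/(1+r^(k-1))
noncomputable def Yy (k : ℕ) (r : ℝ) : ℝ := r^(k-1)*(1-r)/(1+r^(k-1))

theorem Vv_pos {k : ℕ} {r : ℝ} (hr : 0 < r) : 0 < Vv k r := by unfold Vv; positivity

theorem Vv_inv {k : ℕ} (hk : 1 ≤ k) {r : ℝ} (hr : 0 < r) : Vv k r⁻¹ = Vv k r := by
  unfold Vv
  obtain ⟨j, rfl⟩ : ∃ j, k = j+1 := ⟨k-1, by omega⟩
  simp only [Nat.add_sub_cancel, inv_pow]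
  have e1 : 1 + (r^(j+1))⁻¹ = (1+r^(j+1))/r^(j+1) := by field_simp; ring
  have e2 : 1 + (r^j)⁻¹ = (1+r^j)/r^j := by field_simp; ring
  rw [e1, e2, div_pow, div_pow, ← pow_mul, ← pow_mul, mul_comm (j+1) j]
  field_simp

theorem Uu_inv {k : ℕ} {r : ℝ} (hr : 0 < r) : Uu k r⁻¹ = - Uu k r := by
  unfold Uu
  rw [inv_pow]
  have : 0 < r^(k-1) := by positivity
  field_simp
  ring

theorem Uu_nonneg {k : ℕ} {r : ℝ} (hr : 0 < r) (h1 : r ≤ 1) : 0 ≤ Uu k r := by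
  unfold Uu
  have := pow_le_one₀ hr.le h1 (n := k-1)
  apply div_nonneg <;> [linarith; positivity]

theorem Uu_le_one {k : ℕ} {r : ℝ} (hr : 0 < r) : Uu k r ≤ 1 := by
  unfold Uu
  have : 0 < r^(k-1) := by positivity
  rw [div_le_one (by positivity)]; linarith

theorem GR_tz {a z : ℝ} (ha : 0 < a) : GR (a/(1+a)*z) (1/(1+a)*z) = (gg z + gg ((1-a)/(1+a)*z))/2 := by
  have h : 1 + a ≠ 0 := by positivity
  unfold GR gg
  rw [Real.cosh_eq]
  have e1 : Real.exp z = Real.exp (a/(1+a)*z) * Real.exp (1/(1+a)*z) := by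
    rw [← Real.exp_add]; congr 1; field_simp; ring
  have e2 : Real.exp ((1-a)/(1+a)*z) = Real.exp (-(a/(1+a)*z)) * Real.exp (1/(1+a)*z) := by
    rw [← Real.exp_add]; congr 1; field_simp; ring
  rw [e1, e2]
  field_simp
  ring

theorem mid_base {k l l' n : ℕ} (hk : 1 ≤ k) (hl : 0 < l) (hl' : 0 < l') (hn : 0 < n) {r z c P D : ℝ} (hr : 0 < r)
    (hrl : r^k * l' = l) (hz : 0 < z) (hc : 0 < c) (hP : c/√n * gg z^n ≤ P * z^(k*(l+l'))) (hP0 : 0 < P) (hD : 0 ≤ D)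
    (hQ : qq n (k*l,k*l') * ((r^(k-1)/(1+r^(k-1))*z)^(k*l) * (1/(1+r^(k-1))*z)^(k*l')) ≤ D * GR (r^(k-1)/(1+r^(k-1))*z) (1/(1+r^(k-1))*z)^n) :
    tm k n l l' ≤ 27 * √k * (D * √n / c) * ((Vv k r)⁻¹^(l+l') * ((1 + gg (Uu k r * z)/gg z)/2)^n) * ((k*(l+l')).factorial * P) := by
  set a := r^(k-1) with ha
  have ha0 : 0 < a := by positivity
  have hg := gg_pos hz.ne'
  have hG : 0 ≤ GR (a/(1+a)*z) (1/(1+a)*z) := (GR_pos (by positivity)).le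
  have hP' : c/√n * gg z^n ≤ P * z^(k*l+k*l') := by rw [← mul_add]; exact hP
  have h1 := base_ratio hn hc hg (x := a/(1+a)*z) (y := 1/(1+a)*z) (by positivity) (by positivity) hz hP' hQ hD hG
  have h2 := CH hk hl hl'
  have hlp : (0:ℝ) < l' := by positivity
  have e1 : (l:ℝ)^l*(l':ℝ)^l'/((l+l':ℕ):ℝ)^(l+l') = (r^k)^l/(1+r^k)^(l+l') := by
    have : ((l+l':ℕ):ℝ) = (1+r^k)*l' := by push_cast; rw [← hrl]; ring
    rw [this, ← hrl]
    simp only [mul_pow, pow_add]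
    field_simp
  have e2 : GR (a/(1+a)*z) (1/(1+a)*z) / gg z = (1 + gg (Uu k r * z)/gg z)/2 := by
    rw [GR_tz ha0]
    unfold Uu
    rw [← ha]
    field_simp
  have e3 : z/(a/(1+a)*z) = (1+a)/a := by field_simp
  have e4 : z/(1/(1+a)*z) = 1+a := by field_simp
  rw [e2, e3, e4] at h1
  rw [e1] at h2
  have e5 : ((r^k)^l/(1+r^k)^(l+l'))^(k-1) * (((1+a)/a)^(k*l) * (1+a)^(k*l')) = (Vv k r)⁻¹^(l+l') := by
    unfold Vv
    have e6 : ((r^k)^l)^(k-1) = a^(k*l) := by rw [ha, ← pow_mul, ← pow_mul, ← pow_mul]; congr 1; ring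
    have e7 : ((1+a)^k)^(l+l') = (1+a)^(k*l) * (1+a)^(k*l') := by rw [← pow_mul, ← pow_add, mul_add]
    rw [← ha, inv_div, div_pow, div_pow, div_pow, e6, e7, pow_right_comm (1+r^k)]
    have : 0 < 1 + r^k := by positivity
    field_simp
  unfold tm
  calc _ ≤ (27 * √k * ((r^k)^l/(1+r^k)^(l+l'))^(k-1) * (k*(l+l')).factorial) * ((D * √n / c) * (((1+a)/a)^(k*l) * (1+a)^(k*l')) * ((1 + gg (Uu k r * z)/gg z)/2)^n * P) :=
        mul_le_mul h2 h1 (qq_nonneg _ _) (by positivity)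
    _ = 27 * √k * (D * √n / c) * ((((r^k)^l/(1+r^k)^(l+l'))^(k-1) * (((1+a)/a)^(k*l) * (1+a)^(k*l'))) * ((1 + gg (Uu k r * z)/gg z)/2)^n) * ((k*(l+l')).factorial * P) := by ring
    _ = _ := by rw [e5]

theorem FF_n {k m n : ℕ} {z u : ℝ} (hk : 1 ≤ k) (hz : 0 < z) (hu0 : 0 ≤ u) (hu1 : u ≤ 1) (hκ : kap z * n = k * m) (hmn : m ≤ n) (hn : 0 < n) :
    FF (kap z) u ^ n ≤ FF k u ^ m := by
  have h2 := kap_two_lt hz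
  have hk0 : (0:ℝ) < k := by positivity
  have hn0 : (0:ℝ) < n := by positivity
  have hmn' : (m:ℝ) ≤ n := by exact_mod_cast hmn
  have hle : kap z ≤ k := by
    have : kap z * n ≤ k * n := by rw [hκ]; gcongr
    exact le_of_mul_le_mul_right this hn0
  have h := FF_L2 h2 hle hu0 hu1
  have p1 := FF_pos h2 hu1
  have p2 := FF_pos (h2.trans hle) hu1
  rw [← Real.exp_log p1, ← Real.exp_log p2, ← Real.exp_nat_mul, ← Real.exp_nat_mul]
  apply Real.exp_le_exp.2
  calc (n:ℝ) * Real.log (FF (kap z) u) ≤ n * (kap z / k * Real.log (FF k u)) := by gcongr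
    _ = (kap z * n) / k * Real.log (FF k u) := by ring
    _ = _ := by rw [hκ]; field_simp

theorem FF_nc {k m n : ℕ} {z u : ℝ} (hk : 1 ≤ k) (hz : 0 < z) (hu0 : 0 ≤ u) (hu1 : u ≤ 1) (hκ : kap z * n = k * m) (hmn : m ≤ n) (hn : 0 < n)
    (hu : ((k:ℝ)+1)*u^2 ≤ 0.003) :
    FF (kap z) u ^ n ≤ FF k u ^ m * Real.exp (-0.69 * ((n:ℝ) - m)) := by
  have h2 := kap_two_lt hz
  have hk0 : (0:ℝ) < k := by positivity
  have hn0 : (0:ℝ) < n := by positivity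
  have hmn' : (m:ℝ) ≤ n := by exact_mod_cast hmn
  have hle : kap z ≤ k := by
    have : kap z * n ≤ k * n := by rw [hκ]; gcongr
    exact le_of_mul_le_mul_right this hn0
  have h := FF_L4 h2 hle hu0 hu1 hu
  have p1 := FF_pos h2 hu1
  have p2 := FF_pos (h2.trans hle) hu1
  rw [← Real.exp_log p1, ← Real.exp_log p2, ← Real.exp_nat_mul, ← Real.exp_nat_mul, ← Real.exp_add]
  apply Real.exp_le_exp.2
  calc (n:ℝ) * Real.log (FF (kap z) u) ≤ n * (kap z / k * Real.log (FF k u) - (1 - kap z/k)*0.69) := by gcongr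
    _ = (kap z * n) / k * Real.log (FF k u) - (n - (kap z * n)/k) * 0.69 := by ring
    _ = _ := by
      rw [hκ]
      have : (k:ℝ) * m / k = m := by field_simp
      rw [this]; ring

theorem gg_FF {z u : ℝ} (hz : 0 < z) (hu0 : 0 ≤ u) (hu1 : u ≤ 1) : (1 + gg (u*z)/gg z)/2 ≤ FF (kap z) u := by
  unfold FF; linarith [L1 hz hu0 hu1]

theorem V_FF {k m : ℕ} (hk : 3 ≤ k) {s : ℝ} (hs : 0 < s) (hs1 : s ≤ 1) :
    (Vv k s)⁻¹^m * FF k (Uu k s)^m ≤ Real.exp (-(Yy k s^2/2*m)) := by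
  have h := L3 k hk hs hs1
  have hV := Vv_pos (k := k) hs
  have hF : 0 < FF k (Uu k s) := FF_pos (by exact_mod_cast (by omega : 2 ≤ k)) (Uu_le_one hs)
  change FF k (Uu k s) ≤ Vv k s - Yy k s^2/2 at h
  have hV1 : Vv k s ≤ 1 := by
    unfold Vv
    rw [div_le_one (by positivity)]
    have : s^k ≤ s^(k-1) := pow_le_pow_of_le_one hs.le hs1 (by omega)
    calc (1+s^k)^(k-1) ≤ (1+s^(k-1))^(k-1) := by gcongr
      _ ≤ (1+s^(k-1))^k := by
        have : 0 < s^(k-1) := by positivity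
        exact pow_le_pow_right₀ (by linarith) (by omega)
  rw [← mul_pow]
  have h3 : (Vv k s)⁻¹ * FF k (Uu k s) ≤ Real.exp (-(Yy k s^2/2)) := by
    have h4 := Real.add_one_le_exp (-(Yy k s^2/2))
    refine le_trans ?_ h4
    rw [inv_mul_le_iff₀ hV]
    nlinarith [sq_nonneg (Yy k s)]
  calc _ ≤ Real.exp (-(Yy k s^2/2))^m := by gcongr
    _ = _ := by rw [← Real.exp_nat_mul]; ring_nf

theorem gg_gap {v0 K : ℝ} (h0 : 0 < v0) : ∃ ρ, 0 < ρ ∧ ρ < 1 ∧ ∀ v, v0 ≤ v → v ≤ K → gg (-v) ≤ ρ * gg v := by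
  have hs : 0 < Real.sinh v0 - v0 := by
    have := Real.sinh_sub_id_strictMono h0
    simpa using this
  set τ := (Real.sinh v0 - v0)/Real.exp K with hτ
  have hτ0 : 0 < τ := by positivity
  refine ⟨max (1/2) (1 - 2*τ), lt_max_of_lt_left (by norm_num), max_lt (by norm_num) (by linarith), fun v h1 h2 => ?_⟩
  have hv : 0 < v := by linarith
  have hg := gg_pos hv.ne'
  refine le_trans ?_ (mul_le_mul_of_nonneg_right (le_max_right _ _) hg.le)
  have h3 := Real.sinh_sub_id_strictMono.monotone h1
  have h4 : gg v ≤ Real.exp K := by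
    have : Real.exp v ≤ Real.exp K := Real.exp_le_exp.2 h2
    unfold gg; linarith
  have h5 : τ * gg v ≤ Real.sinh v0 - v0 := by
    rw [hτ, div_mul_eq_mul_div, div_le_iff₀ (Real.exp_pos _)]; gcongr
  replace h3 : Real.sinh v0 - v0 ≤ Real.sinh v - v := h3
  have h6 : gg v - gg (-v) = 2 * (Real.sinh v - v) := by
    unfold gg; rw [Real.sinh_eq]; ring
  linarith

theorem mid_left {k : ℕ} (hk : 3 ≤ k) {κ0 δ ε : ℝ} (h0 : 2 < κ0) (hκk : κ0 ≤ k) (hδ0 : 0 < δ) (hε : 0 < ε) : ∃ B > 0, ∃ η > 0, ∃ n0 : ℕ, 0 < n0 ∧ ∀ (l l' n : ℕ) (r : ℝ), n0 ≤ n → κ0 * n ≤ k * (l+l':ℕ) → l+l' ≤ n → 1 ≤ l → 1 ≤ l' → ε * (l+l':ℕ) ≤ l → 0 < r → r^k * l' = l → r ≤ 1 - δ → 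
    tm k n l l' ≤ B * √n * Real.exp (-(η * (l+l':ℕ))) * ((k*(l+l')).factorial * qq n (0,k*(l+l'))) := by
  obtain ⟨c, hc, n0, hn0, H⟩ := setup h0 hκk
  have hk0 : (0:ℝ) < k := by positivity
  refine ⟨27*√k/c, by positivity, (ε^(k-1)*δ/2)^2/2, by positivity, n0, hn0, fun l l' n r hn hm hmn hl hl' hεl hr hrl hrδ => ?_⟩
  obtain ⟨z, h1, h2, h3, h4⟩ := H (l+l') n hn hm hmn
  have hz : 0 < z := by linarith
  have hnp : 0 < n := by omega
  have hP := setup_pos hnp hc hz h4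
  have hr1 : r ≤ 1 := by linarith
  have ha : 0 < r^(k-1) := by positivity
  have hb := mid_base (by omega : 1 ≤ k) hl hl' hnp hr hrl hz hc h4 hP zero_le_one (by
    rw [one_mul]; exact U0 (by positivity) (by positivity) _ _ _)
  refine hb.trans ?_
  have hu0 := Uu_nonneg (k := k) hr hr1
  have hu1 := Uu_le_one (k := k) hr
  have hgz := gg_pos hz.ne'
  have hgu : 0 ≤ gg (Uu k r * z) := by
    have := gg_ge (mul_nonneg hu0 hz.le); nlinarith [sq_nonneg (Uu k r * z)]
  have f1 : ((1 + gg (Uu k r * z)/gg z)/2)^n ≤ FF k (Uu k r)^(l+l') := by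
    refine le_trans ?_ (FF_n (by omega) hz hu0 hu1 h3 hmn hnp)
    have : 0 ≤ (1 + gg (Uu k r * z)/gg z)/2 := by positivity
    gcongr
    exact gg_FF hz hu0 hu1
  have hV := Vv_pos (k := k) hr
  have hmul : (Vv k r)⁻¹^(l+l') * ((1 + gg (Uu k r * z)/gg z)/2)^n ≤ Real.exp (-((ε^(k-1)*δ/2)^2/2 * (l+l':ℕ))) := by
    calc _ ≤ (Vv k r)⁻¹^(l+l') * FF k (Uu k r)^(l+l') := by gcongr
      _ ≤ _ := V_FF hk hr hr1
      _ ≤ _ := by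
        apply Real.exp_le_exp.2
        have hl'p : (1:ℝ) ≤ l' := by exact_mod_cast hl'
        have hεr : ε ≤ r := by
          have h5 : r^k ≤ r := pow_le_of_le_one hr.le hr1 (by omega)
          have h6 : ε * l' ≤ r^k * l' := by
            rw [hrl]; refine le_trans ?_ hεl; push_cast; nlinarith [(Nat.cast_nonneg l : (0:ℝ) ≤ l)]
          exact (le_of_mul_le_mul_right h6 (by linarith)).trans h5
        have hy : ε^(k-1)*δ/2 ≤ Yy k r := by
          unfold Yy
          have : r^(k-1) ≤ 1 := pow_le_one₀ hr.le hr1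
          have h7 : 0 ≤ 1 - r := by linarith
          apply div_le_div₀ (by positivity) _ (by positivity) (by linarith)
          gcongr; linarith
        gcongr
  have e : 27 * √k * (1 * √n / c) = 27*√k/c*√n := by ring
  rw [e]
  gcongr

set_option maxHeartbeats 1000000 in
theorem mid_right {k : ℕ} (hk : 3 ≤ k) {κ0 δ : ℝ} (h0 : 2 < κ0) (hκk : κ0 ≤ k) (hδ0 : 0 < δ) : ∃ B > 0, ∃ η > 0, ∃ n0 : ℕ, 0 < n0 ∧ ∀ (l l' n : ℕ) (r : ℝ), n0 ≤ n → κ0 * n ≤ k * (l+l':ℕ) → l+l' ≤ n → 1 ≤ l → 1 ≤ l' → 0 < r → r^k * l' = l → r⁻¹ ≤ 1 - δ → 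
    tm k n l l' ≤ B * √n * Real.exp (-(η * (l+l':ℕ))) * ((k*(l+l')).factorial * qq n (0,k*(l+l'))) := by
  obtain ⟨c, hc, n0, hn0, H⟩ := setup h0 hκk
  have hk0 : (0:ℝ) < k := by positivity
  have hk3 : (3:ℝ) ≤ k := by exact_mod_cast hk
  have hz0 : 0 < κ0 - 2 := by linarith
  obtain ⟨ρ, hρ0, hρ1, hρ⟩ := gg_gap (v0 := δ/2*(κ0-2)) (K := k) (by positivity)
  have hη : 0 < (1-ρ)*((δ/2)^2/k)/2 := by
    have : 0 < 1 - ρ := by linarith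
    positivity
  refine ⟨27*√k/c, by positivity, (1-ρ)*((δ/2)^2/k)/2, hη, n0, hn0, fun l l' n r hn hm hmn hl hl' hr hrl hrδ => ?_⟩
  obtain ⟨z, h1, h2, h3, h4⟩ := H (l+l') n hn hm hmn
  have hz : 0 < z := by linarith
  have hnp : 0 < n := by omega
  have hP := setup_pos hnp hc hz h4
  have ha : 0 < r^(k-1) := by positivity
  have hb := mid_base (by omega : 1 ≤ k) hl hl' hnp hr hrl hz hc h4 hP zero_le_one (by
    rw [one_mul]; exact U0 (by positivity) (by positivity) _ _ _)
  refine hb.trans ?_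
  have hs : 0 < r⁻¹ := by positivity
  have hs1 : r⁻¹ ≤ 1 := by linarith
  rw [← Vv_inv (by omega) hr, show Uu k r = - Uu k r⁻¹ by rw [Uu_inv hr]; ring]
  set s := r⁻¹
  have hu0 := Uu_nonneg (k := k) hs hs1
  have hu1 := Uu_le_one (k := k) hs
  have hud : δ/2 ≤ Uu k s := by
    unfold Uu
    have h5 : s^(k-1) ≤ s := pow_le_of_le_one hs.le hs1 (by omega)
    have : 0 < s^(k-1) := by positivity
    exact div_le_div₀ (by linarith) (by linarith) (by positivity) (by linarith)
  have hgz := gg_pos hz.ne'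
  set u := Uu k s
  have hupos : 0 < u := by linarith
  have hκ2 := kap_two_lt hz
  have hn0' : (0:ℝ) < n := by positivity
  have hmn' : ((l+l':ℕ):ℝ) ≤ n := by exact_mod_cast hmn
  have hκk : kap z ≤ k := by
    have : kap z * n ≤ k * n := by rw [h3]; gcongr
    exact le_of_mul_le_mul_right this hn0'
  have hL := L1 hz hu0 hu1
  set L := u^2/(1+(kap z-2)*(1-u)) with hLdef
  have hden : 1 ≤ 1+(kap z-2)*(1-u) := by linarith [mul_nonneg (sub_nonneg.2 hκ2) (sub_nonneg.2 hu1)]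
  have hL1 : L ≤ 1 := by
    rw [hLdef, div_le_one (by linarith)]; linarith [pow_le_one₀ hu0 hu1 (n := 2)]
  have hL0 : (δ/2)^2/k ≤ L := by
    rw [hLdef]
    apply div_le_div₀ (by positivity) (by gcongr) (by linarith)
    have := mul_le_of_le_one_right (sub_nonneg.2 hκ2) (by linarith : 1-u ≤ 1)
    linarith
  have hLp : 0 ≤ L := le_trans (by positivity) hL0
  have hgap := hρ (u*z) (by gcongr) ((mul_le_of_le_one_left hz.le hu1).trans h2)
  have key : (1 + gg (-u * z)/gg z)/2 ≤ FF (kap z) u * Real.exp (-((1-ρ)*((δ/2)^2/k)/2)) := by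
    have k1 : gg (-u*z)/gg z ≤ ρ * L := by
      calc gg (-u*z)/gg z ≤ ρ * gg (u*z) / gg z := by
            rw [neg_mul]; gcongr
        _ = ρ * (gg (u*z)/gg z) := by ring
        _ ≤ _ := by gcongr
    have k2 := Real.add_one_le_exp (-((1-ρ)*((δ/2)^2/k)/2))
    have k3 : FF (kap z) u = (1+L)/2 := rfl
    rw [k3]
    calc _ ≤ (1+ρ*L)/2 := by linarith
      _ ≤ (1+L)/2 * (-((1-ρ)*((δ/2)^2/k)/2) + 1) := by
        have k4 : 0 ≤ (1-ρ) * (L - (δ/2)^2/k) := mul_nonneg (by linarith) (by linarith)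
        have k5 : 0 ≤ (1-ρ) * ((δ/2)^2/k) * (1 - L) := mul_nonneg (by linarith) (by linarith)
        linarith
      _ ≤ _ := by gcongr
  have hgu : 0 ≤ gg (-u*z) := (gg_pos (by rw [neg_mul, neg_ne_zero]; positivity)).le
  have hV := Vv_pos (k := k) hs
  have hFp : 0 < FF (kap z) u := FF_pos hκ2 hu1
  have hFp2 : 0 < FF k u := FF_pos (by linarith) hu1
  have hmul : (Vv k s)⁻¹^(l+l') * ((1 + gg (-u * z)/gg z)/2)^n ≤ Real.exp (-((1-ρ)*((δ/2)^2/k)/2 * (l+l':ℕ))) := by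
    calc _ ≤ (Vv k s)⁻¹^(l+l') * (FF (kap z) u * Real.exp (-((1-ρ)*((δ/2)^2/k)/2)))^n := by gcongr
      _ = (Vv k s)⁻¹^(l+l') * FF (kap z) u^n * Real.exp (-((1-ρ)*((δ/2)^2/k)/2))^n := by rw [mul_pow]; ring
      _ ≤ (Vv k s)⁻¹^(l+l') * FF k u^(l+l') * Real.exp (-((1-ρ)*((δ/2)^2/k)/2))^n := by
        gcongr
        exact FF_n (by omega) hz hu0 hu1 h3 hmn hnp
      _ ≤ 1 * Real.exp (-((1-ρ)*((δ/2)^2/k)/2))^n := by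
        gcongr
        refine (V_FF hk hs hs1).trans ?_
        rw [Real.exp_le_one_iff]
        have : 0 ≤ Yy k s^2/2*(l+l':ℕ) := by positivity
        linarith
      _ ≤ _ := by
        rw [one_mul, ← Real.exp_nat_mul]
        apply Real.exp_le_exp.2
        linarith [mul_le_mul_of_nonneg_left hmn' hη.le]
  have e : 27 * √k * (1 * √n / c) = 27*√k/c*√n := by ring
  rw [e]
  gcongr

theorem last_term {k : ℕ} (hk : 3 ≤ k) {κ0 : ℝ} (h0 : 2 < κ0) (hκk : κ0 ≤ k) : ∃ B > 0, ∃ η > 0, ∃ n0 : ℕ, 0 < n0 ∧ ∀ (l n : ℕ), n0 ≤ n → κ0 * n ≤ k * (l:ℕ) → l ≤ n → 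
    tm k n l 0 ≤ B * √n * Real.exp (-(η * l)) * ((k*l).factorial * qq n (0,k*l)) := by
  obtain ⟨c, hc, n0, hn0, H⟩ := setup h0 hκk
  have hk0 : (0:ℝ) < k := by positivity
  have hz0 : 0 < κ0 - 2 := by linarith
  obtain ⟨ρ, hρ0, hρ1, hρ⟩ := gg_gap (v0 := (κ0-2)) (K := k) (by positivity)
  refine ⟨1/c, by positivity, (1-ρ)/2, by linarith, n0, hn0, fun l n hn hm hmn => ?_⟩
  obtain ⟨z, h1, h2, h3, h4⟩ := H l n hn hm hmn
  have hz : 0 < z := by linarith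
  have hnp : 0 < n := by omega
  have hP := setup_pos hnp hc hz h4
  have hg := gg_pos hz.ne'
  have hU := U0 hz.le (le_refl 0) n (k*l) 0
  have hGR : GR z 0 = (gg z + gg (-z))/2 := by unfold GR gg; rw [Real.cosh_eq]; simp; try ring
  have hgap := hρ z h1 h2
  have hG1 : GR z 0 ≤ gg z * Real.exp (-((1-ρ)/2)) := by
    have := Real.add_one_le_exp (-((1-ρ)/2))
    rw [hGR]; nlinarith
  have hG0 : 0 ≤ GR z 0 := by
    unfold GR; have := Real.one_le_cosh z; simp
  have hq : qq n (k*l,0) ≤ √n/c * Real.exp (-((1-ρ)/2 * l)) * qq n (0,k*l) := by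
    have hs : 0 < √(n:ℝ) := by positivity
    have hzp : 0 < z^(k*l) := by positivity
    have a1 : qq n (k*l,0) * z^(k*l) ≤ (√n/c * Real.exp (-((1-ρ)/2 * l)) * qq n (0,k*l)) * z^(k*l) := by
      calc _ ≤ GR z 0^n := by simpa using hU
        _ ≤ (gg z * Real.exp (-((1-ρ)/2)))^n := by gcongr
        _ = √n/c * Real.exp (-((1-ρ)/2))^n * (c/√n * gg z^n) := by rw [mul_pow]; field_simp
        _ ≤ √n/c * Real.exp (-((1-ρ)/2))^n * (qq n (0,k*l) * z^(k*l)) := by gcongr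
        _ ≤ √n/c * Real.exp (-((1-ρ)/2*l)) * (qq n (0,k*l) * z^(k*l)) := by
          gcongr
          rw [← Real.exp_nat_mul]
          apply Real.exp_le_exp.2
          have : (l:ℝ) ≤ n := by exact_mod_cast hmn
          nlinarith
        _ = _ := by ring
    exact le_of_mul_le_mul_right a1 hzp
  unfold tm
  simp only [add_zero, Nat.choose_self, Nat.cast_one, one_mul, mul_zero, Nat.factorial_zero, mul_one]
  calc ((k*l).factorial:ℝ) * qq n (k*l,0) ≤ (k*l).factorial * (√n/c * Real.exp (-((1-ρ)/2 * l)) * qq n (0,k*l)) := by gcongr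
    _ = _ := by ring

theorem center_s {k : ℕ} (hk : 3 ≤ k) {s : ℝ} (hs : 1 - 1/(40*((k:ℝ)+1)^2) ≤ s) (hs1 : s ≤ 1) :
    1/2 ≤ s^(k-1) ∧ Uu k s ≤ 1/2 ∧ ((k:ℝ)+1)*(Uu k s)^2 ≤ 0.003 ∧ (1 - s^k)/(4*k) ≤ Yy k s := by
  have hk3 : (3:ℝ) ≤ k := by exact_mod_cast hk
  have hd : 1/(40*((k:ℝ)+1)^2) ≤ 1/640 := by
    apply one_div_le_one_div_of_le (by norm_num); nlinarith
  have hs0 : 0 < s := by linarith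
  have hb : 1 - k * (1-s) ≤ s^k := by
    have := one_add_mul_le_pow (a := s-1) (by linarith) k
    have e : (1 + (s-1)) = s := by ring
    rw [e] at this; linarith
  have hpk : s^k ≤ s^(k-1) := pow_le_pow_of_le_one hs0.le hs1 (by omega)
  have hkd : (k:ℝ) * (1-s) ≤ 1/(40*(k+1)) := by
    calc (k:ℝ) * (1-s) ≤ (k+1) * (1/(40*((k:ℝ)+1)^2)) := by
          apply mul_le_mul <;> linarith
      _ = _ := by field_simp
  have hkd2 : 1/(40*((k:ℝ)+1)) ≤ 1/160 := by
    apply one_div_le_one_div_of_le (by norm_num); linarith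
  have h1 : 1/2 ≤ s^(k-1) := by linarith
  have hu0 := Uu_nonneg (k := k) hs0 hs1
  have hu : Uu k s ≤ 1/(40*(k+1)) := by
    unfold Uu
    rw [div_le_iff₀ (by positivity)]
    have h2 : 0 ≤ 1/(40*((k:ℝ)+1)) := by positivity
    nlinarith
  refine ⟨h1, by linarith, ?_, ?_⟩
  · calc ((k:ℝ)+1)*(Uu k s)^2 ≤ (k+1) * (1/(40*(k+1)))^2 := by gcongr
      _ = 1/(40*((k:ℝ)+1))/40 := by field_simp
      _ ≤ _ := by linarith
  · unfold Yy
    have hp1 : s^(k-1) ≤ 1 := pow_le_one₀ hs0.le hs1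
    have h3 : (1 - s^k)/(4*k) ≤ (1-s)/4 := by
      rw [div_le_div_iff₀ (by positivity) (by norm_num)]; nlinarith
    refine h3.trans ?_
    have h4 : 0 ≤ 1 - s := by linarith
    rw [div_le_div_iff₀ (by norm_num) (by positivity)]
    nlinarith

theorem frac_eq {k : ℕ} {r : ℝ} (hr : 0 < r) : r^(k-1)/(1+r^(k-1)) = (1 - Uu k r)/2 ∧ 1/(1+r^(k-1)) = (1 + Uu k r)/2 := by
  have : 0 < r^(k-1) := by positivity
  unfold Uu
  constructor <;> field_simp <;> ring

theorem gg_nonneg (z : ℝ) : 0 ≤ gg z := by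
  unfold gg; linarith [Real.add_one_le_exp z]

theorem wz {a z k w : ℝ} (h1 : a ≤ z) (h2 : z ≤ k) (hz : 0 < z) (h3 : 1/4 ≤ w) (h4 : w ≤ 1) : a/4 ≤ w*z ∧ w*z ≤ k := by
  constructor <;> nlinarith

set_option maxHeartbeats 1000000 in
theorem center {k : ℕ} (hk : 3 ≤ k) {κ0 : ℝ} (h0 : 2 < κ0) (hκk : κ0 ≤ k) : ∃ B > 0, ∃ n0 : ℕ, 0 < n0 ∧ ∀ (l l' n : ℕ) (r s : ℝ), n0 ≤ n → κ0 * n ≤ k * (l+l':ℕ) → l+l' ≤ n → 1 ≤ l → 1 ≤ l' → 0 < r → r^k * l' = l → 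
    1 - 1/(40*((k:ℝ)+1)^2) ≤ s → s ≤ 1 → (s = r ∨ s = r⁻¹) →
    tm k n l l' ≤ B / √n * Real.exp (-0.69 * ((n:ℝ) - (l+l':ℕ))) * Real.exp (-(1/(32*k^2)*((l:ℝ)-l')^2/(l+l':ℕ))) * ((k*(l+l')).factorial * qq n (0,k*(l+l'))) := by
  obtain ⟨c, hc, n0, hn0, H⟩ := setup h0 hκk
  have hk0 : (0:ℝ) < k := by positivity
  have hz0 : 0 < κ0 - 2 := by linarith
  have hcd := cd_pos (by linarith : 0 < (κ0-2)/4) hk0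
  refine ⟨27*√k*(1/cd ((κ0-2)/4) k)/c, by positivity, n0, hn0, fun l l' n r s hn hm hmn hl hl' hr hrl hs hs1 hrs => ?_⟩
  obtain ⟨z, h1, h2, h3, h4⟩ := H (l+l') n hn hm hmn
  obtain ⟨c1, c2, c3, c4⟩ := center_s hk hs hs1
  have hz : 0 < z := by linarith
  have hnp : 0 < n := by omega
  have hP := setup_pos hnp hc hz h4
  have hs0 : 0 < s := by rcases hrs with h | h <;> rw [h] <;> positivity
  have hu0 := Uu_nonneg (k := k) hs0 hs1
  have hu1 := Uu_le_one (k := k) hs0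
  have hVs : Vv k r = Vv k s := by
    rcases hrs with h | h
    · rw [h]
    · rw [h, Vv_inv (by omega) hr]
  have hUs : Uu k r = Uu k s ∨ Uu k r = - Uu k s := by
    rcases hrs with h | h
    · left; rw [h]
    · right; rw [h, Uu_inv hr, neg_neg]
  have hgg : gg (Uu k r * z) ≤ gg (Uu k s * z) := by
    rcases hUs with h | h
    · rw [h]
    · rw [h, neg_mul]; exact gg_neg_le (by positivity)
  have hUa : -(1/2) ≤ Uu k r ∧ Uu k r ≤ 1/2 := by
    rcases hUs with h | h <;> rw [h] <;> constructor <;> linarith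
  obtain ⟨f1, f2⟩ := frac_eq (k := k) hr
  have hx1 : (κ0-2)/4 ≤ r^(k-1)/(1+r^(k-1))*z := by rw [f1]; exact (wz h1 h2 hz (by linarith [hUa.2]) (by linarith [hUa.1])).1
  have hx2 : r^(k-1)/(1+r^(k-1))*z ≤ k := by rw [f1]; exact (wz h1 h2 hz (by linarith [hUa.2]) (by linarith [hUa.1])).2
  have hy1 : (κ0-2)/4 ≤ 1/(1+r^(k-1))*z := by rw [f2]; exact (wz h1 h2 hz (by linarith [hUa.1]) (by linarith [hUa.2])).1
  have hy2 : 1/(1+r^(k-1))*z ≤ k := by rw [f2]; exact (wz h1 h2 hz (by linarith [hUa.1]) (by linarith [hUa.2])).2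
  have hb := mid_base (by omega : 1 ≤ k) hl hl' hnp hr hrl hz hc h4 hP (by positivity) 
    (U2 (by linarith) hx1 hx2 hy1 hy2 hnp _ _)
  refine hb.trans ?_
  rw [hVs]
  have hgz := gg_pos hz.ne'
  have hn0' : (0:ℝ) < n := by positivity
  have hmp : (0:ℝ) < (l+l':ℕ) := by positivity
  have hsq : √(n:ℝ) * √n = n := Real.mul_self_sqrt hn0'.le
  have hsp : 0 < √(n:ℝ) := by positivity
  have hV := Vv_pos (k := k) hs0
  have hgr := gg_nonneg (Uu k r * z)
  have hY : |(l:ℝ)-l'|/(4*k*(l+l':ℕ)) ≤ Yy k s := by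
    refine le_trans ?_ c4
    have hlp : (0:ℝ) < l := by positivity
    have hlp' : (0:ℝ) < l' := by positivity
    have : |(l:ℝ)-l'|/(l+l':ℕ) ≤ 1 - s^k := by
      have hsk : s^k ≤ 1 := pow_le_one₀ hs0.le hs1
      push_cast
      rw [div_le_iff₀ (by positivity)]
      rcases hrs with h | h
      · rw [← h] at hrl
        have : (l:ℝ) ≤ l' := by rw [← hrl]; exact mul_le_of_le_one_left hlp'.le hsk
        rw [abs_of_nonpos (by linarith)]
        linarith [mul_nonneg (sub_nonneg.2 hsk) hlp.le]
      · have e : s^k * l = l' := by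
          rw [h, ← hrl, inv_pow]; field_simp
        have : (l':ℝ) ≤ l := by rw [← e]; exact mul_le_of_le_one_left hlp.le hsk
        rw [abs_of_nonneg (by linarith)]
        linarith [mul_nonneg (sub_nonneg.2 hsk) hlp'.le]
    calc _ = |(l:ℝ)-l'|/(l+l':ℕ) / (4*k) := by field_simp
      _ ≤ _ := by gcongr
  have hmul : (Vv k s)⁻¹^(l+l') * ((1 + gg (Uu k r * z)/gg z)/2)^n ≤ Real.exp (-0.69 * ((n:ℝ) - (l+l':ℕ))) * Real.exp (-(1/(32*k^2)*((l:ℝ)-l')^2/(l+l':ℕ))) := by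
    calc _ ≤ (Vv k s)⁻¹^(l+l') * FF (kap z) (Uu k s)^n := by
          gcongr
          refine le_trans ?_ (gg_FF hz hu0 hu1)
          gcongr
      _ ≤ (Vv k s)⁻¹^(l+l') * (FF k (Uu k s)^(l+l') * Real.exp (-0.69 * ((n:ℝ) - (l+l':ℕ)))) := by
          gcongr
          exact FF_nc (by omega) hz hu0 hu1 h3 hmn hnp c3
      _ = Real.exp (-0.69 * ((n:ℝ) - (l+l':ℕ))) * ((Vv k s)⁻¹^(l+l') * FF k (Uu k s)^(l+l')) := by ring
      _ ≤ Real.exp (-0.69 * ((n:ℝ) - (l+l':ℕ))) * Real.exp (-(Yy k s^2/2*(l+l':ℕ))) := by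
          gcongr
          exact V_FF hk hs0 hs1
      _ ≤ _ := by
          gcongr
          calc 1/(32*(k:ℝ)^2)*((l:ℝ)-l')^2/(l+l':ℕ) = (|(l:ℝ)-l'|/(4*k*(l+l':ℕ)))^2/2*(l+l':ℕ) := by
                rw [div_pow, sq_abs]; field_simp; ring
            _ ≤ _ := by gcongr
  have e : 27 * √k * (1/cd ((κ0-2)/4) k/n * √n / c) = 27*√k*(1/cd ((κ0-2)/4) k)/c/√n := by
    have : √(n:ℝ)/n = 1/√n := by rw [div_eq_div_iff hn0'.ne' hsp.ne', hsq]; ring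
    calc _ = 27*√k*(1/cd ((κ0-2)/4) k)/c * (√n/n) := by ring
      _ = _ := by rw [this]; ring
  rw [e, mul_assoc (27*√k*(1/cd ((κ0-2)/4) k)/c/√n) (Real.exp _)]
  exact mul_le_mul_of_nonneg_right (mul_le_mul_of_nonneg_left hmul (by positivity)) (by positivity)

theorem geom_le_aux {q : ℝ} (h0 : 0 ≤ q) (h1 : q < 1) (N : ℕ) : ∑ j ∈ Finset.range N, q^j ≤ 1/(1-q) := by
  have := (summable_geometric_of_lt_one h0 h1).sum_le_tsum (Finset.range N) (fun i _ => by positivity)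
  rw [tsum_geometric_of_lt_one h0 h1] at this
  rwa [one_div]

theorem geom_two {q : ℝ} (h0 : 0 ≤ q) (h1 : q < 1) (h m : ℕ) (hm : h ≤ m) :
    ∑ l ∈ Finset.range (m+1), q^((l:ℤ)-h).natAbs ≤ 2/(1-q) := by
  rw [← Finset.sum_range_add_sum_Ico _ (by omega : h ≤ m+1)]
  have e1 : ∑ l ∈ Finset.range h, q^((l:ℤ)-h).natAbs ≤ 1/(1-q) := by
    rw [← Finset.sum_range_reflect]
    refine le_trans (Finset.sum_le_sum fun j hj => ?_) (geom_le_aux h0 h1 h)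
    rw [Finset.mem_range] at hj
    exact pow_le_pow_of_le_one h0 h1.le (by omega)
  have e2 : ∑ l ∈ Finset.Ico h (m+1), q^((l:ℤ)-h).natAbs ≤ 1/(1-q) := by
    rw [Finset.sum_Ico_eq_sum_range]
    refine le_trans (Finset.sum_le_sum fun j hj => ?_) (geom_le_aux h0 h1 _)
    exact pow_le_pow_of_le_one h0 h1.le (by omega)
  calc _ ≤ 1/(1-q) + 1/(1-q) := add_le_add e1 e2
    _ = _ := by ring

theorem gauss_sum {c : ℝ} (hc : 0 < c) : ∃ C > 0, ∀ m : ℕ, 1 ≤ m →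
    ∑ l ∈ Finset.range (m+1), Real.exp (-(c * ((l:ℝ) - (m-l:ℕ))^2/m)) ≤ C * √m := by
  refine ⟨Real.exp c * (2 * (1/(2*c) + 1)), by positivity, fun m hm => ?_⟩
  have hm1 : (1:ℝ) ≤ m := by exact_mod_cast hm
  have hs : 1 ≤ √(m:ℝ) := by rw [Real.one_le_sqrt]; exact hm1
  have hsq : √(m:ℝ)^2 = m := Real.sq_sqrt (by linarith)
  set t := 2*c/√m with ht
  have ht0 : 0 < t := by positivity
  set q := Real.exp (-t) with hq
  have hq0 : 0 < q := Real.exp_pos _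
  have hq1 : q < 1 := by rw [hq, Real.exp_lt_one_iff]; linarith
  have hterm : ∀ l ∈ Finset.range (m+1), Real.exp (-(c * ((l:ℝ) - (m-l:ℕ))^2/m)) ≤ Real.exp c * q^((l:ℤ)-(m/2:ℕ)).natAbs := by
    intro l hl
    rw [Finset.mem_range] at hl
    rw [Nat.cast_sub (by omega)]
    set x : ℝ := |(l:ℝ) - (m - l)| with hx
    have h1 : (((l:ℤ)-(m/2:ℕ)).natAbs : ℝ) ≤ x := by
      have e : x = (((l:ℤ) - (m-l)).natAbs : ℝ) := by
        rw [hx, Nat.cast_natAbs]; push_cast; rfl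
      rw [e]
      exact_mod_cast (by omega : ((l:ℤ)-(m/2:ℕ)).natAbs ≤ ((l:ℤ) - (m-l)).natAbs)
    have h2 : Real.exp (-(c * ((l:ℝ) - (m-l))^2/m)) ≤ Real.exp (c + -t * x) := by
      apply Real.exp_le_exp.2
      rw [← sq_abs, ← hx, ← hsq, ht]
      have : 0 ≤ c * (x/√m - 1)^2 := by positivity
      have e : c * x^2/√(m:ℝ)^2 + (c + -(2*c/√m)*x) = c * (x/√m - 1)^2 := by field_simp; ring
      linarith
    refine h2.trans ?_
    rw [Real.exp_add, hq, ← Real.exp_nat_mul]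
    refine mul_le_mul_of_nonneg_left (Real.exp_le_exp.2 ?_) (Real.exp_pos _).le
    have := mul_le_mul_of_nonneg_left h1 ht0.le
    linarith
  refine (Finset.sum_le_sum hterm).trans ?_
  rw [← Finset.mul_sum, mul_assoc]
  gcongr
  refine (geom_two hq0.le hq1 (m/2) m (Nat.div_le_self _ _)).trans ?_
  have h3 : q ≤ 1/(1+t) := by
    rw [hq, Real.exp_neg, inv_eq_one_div]
    apply one_div_le_one_div_of_le (by positivity)
    linarith [Real.add_one_le_exp t]
  have h4 : t/(1+t) ≤ 1 - q := by
    have : t/(1+t) = 1 - 1/(1+t) := by field_simp; ring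
    linarith
  calc 2/(1-q) ≤ 2/(t/(1+t)) := by gcongr
    _ = 2 * (√m/(2*c) + 1) := by rw [ht]; field_simp
    _ ≤ 2 * (√m/(2*c) + √m) := by gcongr
    _ = _ := by ring

theorem poly_exp {k : ℕ} {η : ℝ} (hη : 0 < η) (m : ℕ) : (m:ℝ)^k * Real.exp (-(η*m)) ≤ k.factorial/η^k := by
  have h := Real.pow_div_factorial_le_exp (η*m) (by positivity) k
  rw [Real.exp_neg, ← div_eq_mul_inv, div_le_div_iff₀ (Real.exp_pos _) (by positivity)]
  rw [div_le_iff₀ (by positivity), mul_pow] at h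
  linarith

theorem term_bound {k : ℕ} (hk : 3 ≤ k) {κ0 : ℝ} (h0 : 2 < κ0) (hκk : κ0 ≤ k) : ∃ B > 0, ∃ η > 0, ∃ n0 : ℕ, 0 < n0 ∧ ∀ (l l' n : ℕ), n0 ≤ n → κ0 * n ≤ k * (l+l':ℕ) → l+l' ≤ n → 2 ≤ l →
    tm k n l l' ≤ (B / (l+l':ℕ)^(k-2) * ((l:ℝ)^(k-2)*(1/2)^l) + B * √n * Real.exp (-(η * (l+l':ℕ))) + B / √n * Real.exp (-0.69 * ((n:ℝ) - (l+l':ℕ))) * Real.exp (-(1/(32*k^2)*((l:ℝ)-l')^2/(l+l':ℕ)))) * ((k*(l+l')).factorial * qq n (0,k*(l+l'))) := by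
  obtain ⟨B1, hB1, ε, hε, n1, hn1, H1⟩ := small_term hk h0 hκk
  have hδ : (0:ℝ) < 1/(40*((k:ℝ)+1)^2) := by positivity
  obtain ⟨B2, hB2, η2, hη2, n2, hn2, H2⟩ := mid_left hk h0 hκk hδ hε
  obtain ⟨B3, hB3, η3, hη3, n3, hn3, H3⟩ := mid_right hk h0 hκk hδ
  obtain ⟨B4, hB4, η4, hη4, n4, hn4, H4⟩ := last_term hk h0 hκk
  obtain ⟨B5, hB5, n5, hn5, H5⟩ := center hk h0 hκk
  refine ⟨B1+B2+B3+B4+B5, by positivity, min η2 (min η3 η4), by positivity, n1+n2+n3+n4+n5, by omega, fun l l' n hn hm hmn hl => ?_⟩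
  have hW : 0 ≤ ((k*(l+l')).factorial : ℝ) * qq n (0,k*(l+l')) := mul_nonneg (by positivity) (qq_nonneg _ _)
  set B := B1+B2+B3+B4+B5 with hB
  set η := min η2 (min η3 η4) with hη
  have a2 : η ≤ η2 := min_le_left _ _
  have a3 : η ≤ η3 := (min_le_right _ _).trans (min_le_left _ _)
  have a4 : η ≤ η4 := (min_le_right _ _).trans (min_le_right _ _)
  have hexp : ∀ (B' η' : ℝ), 0 ≤ B' → B' ≤ B → η ≤ η' → B' * √n * Real.exp (-(η' * (l+l':ℕ))) ≤ B * √n * Real.exp (-(η * (l+l':ℕ))) := by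
    intro B' η' hp h1 h2
    gcongr
  set X := B / (l+l':ℕ)^(k-2) * ((l:ℝ)^(k-2)*(1/2)^l) with hX
  set Y := B * √n * Real.exp (-(η * (l+l':ℕ))) with hY
  set Z := B / √n * Real.exp (-0.69 * ((n:ℝ) - (l+l':ℕ))) * Real.exp (-(1/(32*k^2)*((l:ℝ)-l')^2/(l+l':ℕ))) with hZ
  have hX0 : 0 ≤ X := by positivity
  have hY0 : 0 ≤ Y := by positivity
  have hZ0 : 0 ≤ Z := by positivity
  rcases Nat.eq_zero_or_pos l' with rfl | hl'
  · refine (H4 l n (by omega) (by simpa using hm) (by simpa using hmn)).trans ?_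
    simp only [add_zero] at hW hexp hY ⊢
    refine mul_le_mul_of_nonneg_right ?_ hW
    have := hexp B4 η4 hB4.le (by linarith) a4
    linarith
  have hl'p : (0:ℝ) < l' := by positivity
  have hlp : (0:ℝ) < l := by positivity
  rcases le_total (l:ℝ) (ε * (l+l':ℕ)) with hs | hs
  · refine (H1 l l' n (by omega) hm hmn hl hl' hs).trans (mul_le_mul_of_nonneg_right ?_ hW)
    have : B1 / (l+l':ℕ)^(k-2) * ((l:ℝ)^(k-2)*(1/2)^l) ≤ X := by
      rw [hX]; gcongr; linarith
    linarith
  set r : ℝ := ((l:ℝ)/l')^((k:ℝ)⁻¹) with hr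
  have hr0 : 0 < r := by positivity
  have hrk : r^k * l' = l := by
    rw [hr, Real.rpow_inv_natCast_pow (by positivity) (by omega)]; field_simp
  have hcen : ∀ s : ℝ, 1 - 1/(40*((k:ℝ)+1)^2) ≤ s → s ≤ 1 → (s = r ∨ s = r⁻¹) → tm k n l l' ≤ (X+Y+Z) * ((k*(l+l')).factorial * qq n (0,k*(l+l'))) := by
    intro s s1 s2 s3
    refine (H5 l l' n r s (by omega) hm hmn (by omega) hl' hr0 hrk s1 s2 s3).trans (mul_le_mul_of_nonneg_right ?_ hW)
    have : B5 / √n * Real.exp (-0.69 * ((n:ℝ) - (l+l':ℕ))) * Real.exp (-(1/(32*k^2)*((l:ℝ)-l')^2/(l+l':ℕ))) ≤ Z := by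
      rw [hZ]; gcongr; linarith
    linarith
  rcases le_total r 1 with h1 | h1
  · rcases le_total r (1 - 1/(40*((k:ℝ)+1)^2)) with h2 | h2
    · refine (H2 l l' n r (by omega) hm hmn (by omega) hl' hs hr0 hrk h2).trans (mul_le_mul_of_nonneg_right ?_ hW)
      have := hexp B2 η2 hB2.le (by linarith) a2
      linarith
    · exact hcen r h2 h1 (Or.inl rfl)
  · have h1' : r⁻¹ ≤ 1 := inv_le_one_of_one_le₀ h1
    rcases le_total r⁻¹ (1 - 1/(40*((k:ℝ)+1)^2)) with h2 | h2
    · refine (H3 l l' n r (by omega) hm hmn (by omega) hl' hr0 hrk h2).trans (mul_le_mul_of_nonneg_right ?_ hW)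
      have := hexp B3 η3 hB3.le (by linarith) a3
      linarith
    · exact hcen r⁻¹ h2 h1' (Or.inr rfl)

theorem thmB {k : ℕ} (hk : 3 ≤ k) {κ0 : ℝ} (h0 : 2 < κ0) (hκk : κ0 ≤ k) : ∃ K > 0, ∃ n0 : ℕ, 0 < n0 ∧ ∀ (m n : ℕ), n0 ≤ n → κ0 * n ≤ k * m → m ≤ n → 
    0 < qq n (0,k*m) ∧ ∑ l ∈ Finset.Icc 2 m, tm k n l (m-l) ≤ K * (1/(m:ℝ)^(k-2) + Real.exp (-0.69 * ((n:ℝ) - m))) * ((k*m).factorial * qq n (0,k*m)) := by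
  obtain ⟨B, hB, η, hη, n1, hn1, H⟩ := term_bound hk h0 hκk
  obtain ⟨_, _, _, _, n2, hn2, H2⟩ := smallR (by omega : 1 ≤ k) h0 hκk
  obtain ⟨C, hC, HC⟩ := gauss_sum (c := 1/(32*(k:ℝ)^2)) (by positivity)
  have hsum : Summable (fun l : ℕ => (l:ℝ)^(k-2)*(1/2:ℝ)^l) := summable_pow_mul_geometric_of_norm_lt_one _ (by norm_num)
  set S := ∑' l : ℕ, (l:ℝ)^(k-2)*(1/2:ℝ)^l with hS
  have hS0 : 0 ≤ S := tsum_nonneg (fun l => by positivity)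
  refine ⟨B*S + B*(k*(k.factorial/η^k)) + B*C, by positivity, n1+n2, by omega, fun m n hn hm hmn => ?_⟩
  have hP := (H2 m n (by omega) hm hmn).1
  refine ⟨hP, ?_⟩
  set W := ((k*m).factorial:ℝ) * qq n (0,k*m) with hW
  have hW0 : 0 ≤ W := by positivity
  have hn0 : (0:ℝ) < n := by exact_mod_cast (by omega : 0 < n)
  have hkm : 0 < (k:ℝ) * m := lt_of_lt_of_le (by nlinarith) hm
  have hm0 : 0 < m := by
    rcases Nat.eq_zero_or_pos m with h | h
    · subst h; simp at hkm
    · exact h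
  have hm1 : (1:ℝ) ≤ m := by exact_mod_cast hm0
  have hmn' : (m:ℝ) ≤ n := by exact_mod_cast hmn
  have hnk : (n:ℝ) ≤ k*m := by nlinarith
  have hsn : √(n:ℝ) ≤ n := by
    rw [Real.sqrt_le_left hn0.le]; nlinarith
  have hb : ∀ l ∈ Finset.Icc 2 m, tm k n l (m-l) ≤ (B / (m:ℝ)^(k-2) * ((l:ℝ)^(k-2)*(1/2)^l) + B * √n * Real.exp (-(η * m)) + B / √n * Real.exp (-0.69 * ((n:ℝ) - m)) * Real.exp (-(1/(32*k^2)*((l:ℝ)-(m-l:ℕ))^2/m))) * W := by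
    intro l hl
    rw [Finset.mem_Icc] at hl
    have e : l + (m-l) = m := by omega
    have := H l (m-l) n (by omega) (by rw [e]; exact hm) (by rw [e]; exact hmn) hl.1
    rw [e] at this
    exact this
  refine (Finset.sum_le_sum hb).trans ?_
  rw [← Finset.sum_mul]
  refine mul_le_mul_of_nonneg_right ?_ hW0
  rw [Finset.sum_add_distrib, Finset.sum_add_distrib, Finset.sum_const, ← Finset.mul_sum, ← Finset.mul_sum]
  have s1 : ∑ l ∈ Finset.Icc 2 m, (l:ℝ)^(k-2)*(1/2:ℝ)^l ≤ S := hsum.sum_le_tsum _ (fun l _ => by positivity)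
  have s3 : ∑ l ∈ Finset.Icc 2 m, Real.exp (-(1/(32*k^2)*((l:ℝ)-(m-l:ℕ))^2/m)) ≤ C * √m := by
    refine le_trans (Finset.sum_le_sum_of_subset_of_nonneg ?_ (fun _ _ _ => (Real.exp_pos _).le)) (HC m hm0)
    intro l hl; rw [Finset.mem_Icc] at hl; rw [Finset.mem_range]; omega
  have s2 : (Finset.Icc 2 m).card • (B * √n * Real.exp (-(η * m))) ≤ B*(k*(k.factorial/η^k)) * (1/(m:ℝ)^(k-2)) := by
    rw [nsmul_eq_mul]
    have hc : ((Finset.Icc 2 m).card:ℝ) ≤ m := by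
      rw [Nat.card_Icc]; exact_mod_cast (by omega : m+1-2 ≤ m)
    calc _ ≤ (m:ℝ) * (B * (k*m) * Real.exp (-(η * m))) := by gcongr; linarith
      _ = B * (k * ((m:ℝ)^k * Real.exp (-(η*m)))) * (1/(m:ℝ)^(k-2)) := by
        obtain ⟨j, rfl⟩ : ∃ j, k = j+2 := ⟨k-2, by omega⟩
        simp only [Nat.add_sub_cancel]
        field_simp
        try ring
      _ ≤ _ := by gcongr; exact poly_exp hη m
  have s4 : B / √n * Real.exp (-0.69 * ((n:ℝ) - m)) * ∑ l ∈ Finset.Icc 2 m, Real.exp (-(1/(32*k^2)*((l:ℝ)-(m-l:ℕ))^2/m)) ≤ B * C * Real.exp (-0.69 * ((n:ℝ) - m)) := by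
    have hsp : 0 < √(n:ℝ) := by positivity
    calc _ ≤ B / √n * Real.exp (-0.69 * ((n:ℝ) - m)) * (C * √n) := by
          gcongr
          exact s3.trans (by gcongr)
      _ = _ := by field_simp
  have s5 : B / (m:ℝ)^(k-2) * ∑ l ∈ Finset.Icc 2 m, (l:ℝ)^(k-2)*(1/2:ℝ)^l ≤ B * S * (1/(m:ℝ)^(k-2)) := by
    calc _ ≤ B / (m:ℝ)^(k-2) * S := by gcongr
      _ = _ := by ring
  set p := 1/(m:ℝ)^(k-2) with hp
  set x := Real.exp (-0.69 * ((n:ℝ) - m)) with hx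
  have hp0 : 0 ≤ p := by positivity
  have hx0 : 0 ≤ x := (Real.exp_pos _).le
  refine (add_le_add (add_le_add s5 s2) s4).trans ?_
  have t1 : 0 ≤ B * S * x := by positivity
  have t2 : 0 ≤ B*(k*(k.factorial/η^k)) * x := by positivity
  have t3 : 0 ≤ B * C * p := by positivity
  linarith

noncomputable def GG {P : Type*} [Fintype P] (Q : Finset P → Prop) (n : ℕ) (s : Finset P) : Finset (P → ℕ) :=
  (Fintype.piFinset (fun p => if p ∈ s then Finset.range n else {0})).filter (fun f => ∀ c < n, Q (s.filter (fun p => f p = c)))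

theorem mem_GG {P : Type*} [Fintype P] {Q : Finset P → Prop} {n : ℕ} {s : Finset P} {f : P → ℕ} :
    f ∈ GG Q n s ↔ (∀ p ∈ s, f p < n) ∧ (∀ p ∉ s, f p = 0) ∧ ∀ c < n, Q (s.filter (fun p => f p = c)) := by
  unfold GG
  rw [Finset.mem_filter, Fintype.mem_piFinset, ← and_assoc]
  refine and_congr_left' ⟨fun h => ⟨fun p hp => ?_, fun p hp => ?_⟩, fun h p => ?_⟩
  · have := h p; rw [if_pos hp] at this; simpa using this
  · have := h p; rw [if_neg hp] at this; simpa using this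
  · by_cases hp : p ∈ s
    · rw [if_pos hp]; simpa using h.1 p hp
    · rw [if_neg hp]; simpa using h.2 p hp

theorem GG_succ {P : Type*} [Fintype P] (Q : Finset P → Prop) (n : ℕ) (s : Finset P) :
    (GG Q (n+1) s).card = ∑ t ∈ s.powerset, if Q t then (GG Q n (s \ t)).card else 0 := by
  rw [Finset.card_eq_sum_card_fiberwise (f := fun f => s.filter (fun p => f p = n)) (t := s.powerset)]
  swap
  · intro f _; exact Finset.mem_coe.2 (Finset.mem_powerset.2 (Finset.filter_subset _ _))
  refine Finset.sum_congr rfl fun t ht => ?_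
  rw [Finset.mem_powerset] at ht
  by_cases hQ : Q t
  · rw [if_pos hQ]
    refine Finset.card_nbij' (fun f p => if p ∈ t then 0 else f p) (fun g p => if p ∈ t then n else g p) ?_ ?_ ?_ ?_
    · intro f hf
      simp only [Finset.coe_filter, Set.mem_ofPred_eq, mem_GG] at hf
      obtain ⟨⟨h1, h2, h3⟩, rfl⟩ := hf
      simp only [Finset.mem_coe, mem_GG, Finset.mem_sdiff, Finset.mem_filter, not_and]
      refine ⟨fun p hp => ?_, fun p hp => ?_, fun c hc => ?_⟩
      · have := h1 p hp.1
        have := hp.2 hp.1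
        rw [if_neg (fun h => hp.2 h.1 h.2)]; omega
      · split_ifs with h
        · rfl
        · by_cases hs : p ∈ s
          · exact absurd (hp hs) (by tauto)
          · exact h2 p hs
      · convert h3 c (by omega) using 1
        ext p
        simp only [Finset.mem_filter, Finset.mem_sdiff]
        constructor
        · rintro ⟨⟨a, b⟩, h⟩
          rw [if_neg b] at h; exact ⟨a, h⟩
        · rintro ⟨a, b⟩
          have : ¬ (p ∈ s ∧ f p = n) := by rintro ⟨_, h⟩; omega
          exact ⟨⟨a, this⟩, by rw [if_neg this]; exact b⟩
    · intro g hg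
      rw [Finset.mem_coe, mem_GG] at hg
      obtain ⟨h1, h2, h3⟩ := hg
      simp only [Finset.mem_sdiff] at h1 h2
      have hfib : s.filter (fun p => (if p ∈ t then n else g p) = n) = t := by
        ext p
        simp only [Finset.mem_filter]
        constructor
        · rintro ⟨a, b⟩
          by_contra hc
          rw [if_neg hc] at b
          have := h1 p ⟨a, hc⟩; omega
        · intro h; exact ⟨ht h, by rw [if_pos h]⟩
      simp only [Finset.coe_filter, Set.mem_ofPred_eq, mem_GG]
      refine ⟨⟨fun p hp => ?_, fun p hp => ?_, fun c hc => ?_⟩, hfib⟩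
      · split_ifs with h
        · omega
        · have := h1 p ⟨hp, h⟩; omega
      · rw [if_neg (fun h => hp (ht h))]
        exact h2 p (by tauto)
      · rcases Nat.lt_succ_iff_lt_or_eq.1 hc with h | rfl
        · convert h3 c h using 1
          ext p
          simp only [Finset.mem_filter, Finset.mem_sdiff]
          constructor
          · rintro ⟨a, b⟩
            split_ifs at b with hpt
            · omega
            · exact ⟨⟨a, hpt⟩, b⟩
          · rintro ⟨⟨a, b⟩, h⟩
            exact ⟨a, by rw [if_neg b]; exact h⟩
        · rw [hfib]; exact hQ
    · intro f hf
      simp only [Finset.coe_filter, Set.mem_ofPred_eq, mem_GG] at hf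
      obtain ⟨_, rfl⟩ := hf
      funext p
      by_cases h : p ∈ s ∧ f p = n <;> simp [h]
    · intro g hg
      rw [Finset.mem_coe, mem_GG] at hg
      funext p
      by_cases h : p ∈ t
      · simp only [h, if_true]; exact (hg.2.1 p (by simp [h])).symm
      · simp [h]
  · rw [if_neg hQ, Finset.card_eq_zero, Finset.filter_eq_empty_iff]
    rintro f hf rfl
    rw [mem_GG] at hf
    exact hQ (hf.2.2 n (by omega))

theorem sum_powerset_two {P : Type*} [Fintype P] (a s : Finset P) (h : ℕ → ℕ → ℝ) :
    ∑ t ∈ s.powerset, h (t ∩ a).card (t \ a).card = ∑ i ∈ Finset.range ((s ∩ a).card+1), ∑ j ∈ Finset.range ((s \ a).card+1), ((s ∩ a).card.choose i * (s \ a).card.choose j : ℝ) * h i j := by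
  have e : ∑ t ∈ s.powerset, h (t ∩ a).card (t \ a).card = ∑ x ∈ (s ∩ a).powerset ×ˢ (s \ a).powerset, h x.1.card x.2.card := by
    refine Finset.sum_nbij' (fun t => (t ∩ a, t \ a)) (fun x => x.1 ∪ x.2) ?_ ?_ ?_ ?_ ?_
    · intro t ht
      rw [Finset.mem_powerset] at ht
      simp only [Finset.mem_product, Finset.mem_powerset]
      exact ⟨Finset.inter_subset_inter_right ht, Finset.sdiff_subset_sdiff ht le_rfl⟩
    · intro x hx
      simp only [Finset.mem_product, Finset.mem_powerset] at hx
      rw [Finset.mem_powerset]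
      exact Finset.union_subset (hx.1.trans Finset.inter_subset_left) (hx.2.trans Finset.sdiff_subset)
    · intro t _
      ext p; simp only [Finset.mem_union, Finset.mem_inter, Finset.mem_sdiff]; tauto
    · rintro ⟨u, v⟩ hx
      simp only [Finset.mem_product, Finset.mem_powerset] at hx
      have h1 : ∀ p ∈ u, p ∈ a := fun p hp => (Finset.mem_inter.1 (hx.1 hp)).2
      have h2 : ∀ p ∈ v, p ∉ a := fun p hp => (Finset.mem_sdiff.1 (hx.2 hp)).2
      ext p
      · simp only [Finset.mem_union, Finset.mem_inter]
        have := h1 p; have := h2 p; tauto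
      · simp only [Finset.mem_union, Finset.mem_sdiff]
        have := h1 p; have := h2 p; tauto
    · intro t _; rfl
  rw [e, Finset.sum_product, Finset.sum_powerset_apply_card (fun i => ∑ y ∈ (s \ a).powerset, h i y.card)]
  refine Finset.sum_congr rfl fun i _ => ?_
  rw [Finset.sum_powerset_apply_card (fun j => h i j), nsmul_eq_mul, Finset.mul_sum]
  refine Finset.sum_congr rfl fun j _ => ?_
  rw [nsmul_eq_mul]; ring

theorem GG_card {P : Type*} [Fintype P] (a : Finset P) (n : ℕ) : ∀ s : Finset P,
    ((GG (fun t => Even (t ∩ a).card ∧ 2 ≤ t.card) n s).card : ℝ) = (s ∩ a).card.factorial * (s \ a).card.factorial * qq n ((s ∩ a).card, (s \ a).card) := by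
  induction n with
  | zero =>
    intro s
    have hq : qq 0 ((s ∩ a).card, (s \ a).card) = if ((s ∩ a).card, (s \ a).card) = 0 then 1 else 0 := rfl
    rw [hq]
    by_cases hs : s = ∅
    · subst hs
      have : GG (fun t => Even (t ∩ a).card ∧ 2 ≤ t.card) 0 (∅ : Finset P) = {fun _ => 0} := by
        ext f; rw [mem_GG]; simp [funext_iff]
      rw [this]; simp
    · have : GG (fun t => Even (t ∩ a).card ∧ 2 ≤ t.card) 0 s = ∅ := by
        ext f; rw [mem_GG]
        obtain ⟨p, hp⟩ := Finset.nonempty_iff_ne_empty.2 hs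
        simp only [Finset.notMem_empty, iff_false]
        rintro ⟨h, _⟩
        have := h p hp; omega
      rw [this, if_neg]
      · simp
      · intro h
        have h1 := congrArg Prod.fst h
        have h2 := congrArg Prod.snd h
        simp only [Prod.fst_zero, Prod.snd_zero] at h1 h2
        have := Finset.card_inter_add_card_sdiff s a
        rw [h1, h2] at this
        exact hs (Finset.card_eq_zero.1 this.symm)
  | succ n ih =>
    intro s
    rw [GG_succ]
    push_cast
    set x := (s ∩ a).card with hx
    set y := (s \ a).card with hy
    have e : ∀ t ∈ s.powerset, ((if Even (t ∩ a).card ∧ 2 ≤ t.card then ((GG (fun t => Even (t ∩ a).card ∧ 2 ≤ t.card) n (s \ t)).card : ℝ) else 0) : ℝ) = (fun i j => if Even i ∧ 2 ≤ i + j then ((x-i).factorial * (y-j).factorial * qq n (x-i,y-j) : ℝ) else 0) (t ∩ a).card (t \ a).card := by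
      intro t ht
      rw [Finset.mem_powerset] at ht
      have hc := Finset.card_inter_add_card_sdiff t a
      have h1 : ((s \ t) ∩ a).card = x - (t ∩ a).card := by
        rw [hx, ← Finset.card_sdiff_of_subset (Finset.inter_subset_inter_right ht)]
        congr 1; ext p; simp only [Finset.mem_inter, Finset.mem_sdiff]; tauto
      have h2 : ((s \ t) \ a).card = y - (t \ a).card := by
        rw [hy, ← Finset.card_sdiff_of_subset (Finset.sdiff_subset_sdiff ht le_rfl)]
        congr 1; ext p; simp only [Finset.mem_sdiff]; tauto
      simp only [hc]
      rw [ih, h1, h2]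
    rw [Finset.sum_congr rfl e]
    refine (sum_powerset_two a s (fun i j => if Even i ∧ 2 ≤ i + j then ((x-i).factorial * (y-j).factorial * qq n (x-i,y-j) : ℝ) else 0)).trans ?_
    rw [← hx, ← hy]
    have hq : qq (n+1) (x,y) = ∑ z ∈ Finset.HasAntidiagonal.antidiagonal (x,y), gam z.1 * qq n z.2 := rfl
    rw [hq, sum_prodAntidiag, Finset.Nat.sum_antidiagonal_eq_sum_range_succ_mk, Finset.mul_sum]
    refine Finset.sum_congr rfl fun i hi => ?_
    rw [Finset.Nat.sum_antidiagonal_eq_sum_range_succ_mk, Finset.mul_sum]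
    refine Finset.sum_congr rfl fun j hj => ?_
    rw [Finset.mem_range] at hi hj
    simp only [gam]
    by_cases h : Even i ∧ 2 ≤ i + j
    · rw [if_pos h, if_pos h]
      have c1 : ((x.choose i : ℝ) * i.factorial * (x-i).factorial) = x.factorial := by exact_mod_cast Nat.choose_mul_factorial_mul_factorial (by omega)
      have c2 : ((y.choose j : ℝ) * j.factorial * (y-j).factorial) = y.factorial := by exact_mod_cast Nat.choose_mul_factorial_mul_factorial (by omega)
      rw [← c1, ← c2]
      field_simp
    · rw [if_neg h, if_neg h]; ring

/-- number of maps with all fibers of size at least two and even on `a` -/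
noncomputable def Om {P : Type*} [Fintype P] (n : ℕ) (a : Finset P) : Finset (P → Fin n) :=
  Finset.univ.filter (fun f => ∀ c, Even (a.filter (fun p => f p = c)).card ∧ 2 ≤ (Finset.univ.filter (fun p => f p = c)).card)

theorem Om_card {P : Type*} [Fintype P] (n : ℕ) (a : Finset P) :
    ((Om n a).card : ℝ) = a.card.factorial * (Fintype.card P - a.card).factorial * qq n (a.card, Fintype.card P - a.card) := by
  have h := GG_card a n Finset.univ
  rw [Finset.univ_inter, ← Finset.compl_eq_univ_sdiff, Finset.card_compl] at h
  rw [← h]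
  norm_cast
  have key : ∀ (f : P → ℕ) (c : ℕ), (Finset.univ.filter (fun p => f p = c)) ∩ a = a.filter (fun p => f p = c) := by
    intro f c; ext p; simp [and_comm]
  refine Finset.card_bij (fun f _ p => (f p : ℕ)) ?_ ?_ ?_
  · intro f hf
    simp only [Om, Finset.mem_filter, Finset.mem_univ, true_and] at hf
    rw [mem_GG]
    refine ⟨fun p _ => (f p).2, by simp, fun c hc => ?_⟩
    have := hf ⟨c, hc⟩
    simp only [Fin.ext_iff] at this
    rw [key]; exact this
  · intro f _ g _ h
    funext p; exact Fin.ext (congrFun h p)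
  · intro g hg
    rw [mem_GG] at hg
    refine ⟨fun p => ⟨g p, hg.1 p (Finset.mem_univ _)⟩, ?_, rfl⟩
    simp only [Om, Finset.mem_filter, Finset.mem_univ, true_and]
    intro c
    have := hg.2.2 c c.2
    simp only [key] at this
    simp only [Fin.ext_iff]; exact this

noncomputable def Dset {m k n : ℕ} (f : Fin m × Fin k → Fin n) : Finset ((Fin m × Fin k) × (Fin m × Fin k)) :=
  Finset.univ.filter (fun x => f x.1 = f x.2)

noncomputable def Bp {m k n : ℕ} (f : Fin m × Fin k → Fin n) : Finset ((Fin m × Fin k) × (Fin m × Fin k)) :=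
  Finset.univ.filter (fun x => x.1 ≠ x.2 ∧ x.1.1 = x.2.1 ∧ f x.1 = f x.2)

noncomputable def Vl {m k n : ℕ} (f : Fin m × Fin k → Fin n) (p : Fin m × Fin k) : Finset (Fin m × Fin k) :=
  Finset.univ.filter (fun q => q.1 ≠ p.1 ∧ (∀ i, f (p.1,i) ≠ f q) ∧ (∀ i, f (q.1,i) ≠ f p))

theorem fib_le {m k n : ℕ} (f : Fin m × Fin k → Fin n) (c : Fin n) {X : ℝ} (hX : ((Dset f).card : ℝ) ≤ X) :
    ((Finset.univ.filter (fun p => f p = c)).card : ℝ) ≤ √X := by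
  apply Real.le_sqrt_of_sq_le
  refine le_trans ?_ hX
  have : (Finset.univ.filter (fun p => f p = c)) ×ˢ (Finset.univ.filter (fun p => f p = c)) ⊆ Dset f := by
    rintro ⟨x, y⟩ h
    simp only [Finset.mem_product, Finset.mem_filter, Finset.mem_univ, true_and] at h
    simp only [Dset, Finset.mem_filter, Finset.mem_univ, true_and]
    rw [h.1, h.2]
  have := Finset.card_le_card this
  rw [Finset.card_product, ← sq] at this
  exact_mod_cast this

theorem Vl_card {m k n : ℕ} (f : Fin m × Fin k → Fin n) (p : Fin m × Fin k) {X : ℝ} (hX : ((Dset f).card : ℝ) ≤ X)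
    (hb : 2 * (k + (k + k^2) * √X) ≤ (k:ℝ)*m) : (k:ℝ)*m/2 ≤ (Vl f p).card := by
  have hsub : (Vl f p)ᶜ ⊆ (({p.1} : Finset (Fin m)) ×ˢ (Finset.univ : Finset (Fin k))) ∪
      ((Finset.univ : Finset (Fin k)).biUnion (fun i => Finset.univ.filter (fun q => f q = f (p.1,i))) ∪
       (Finset.univ : Finset (Fin k)).biUnion (fun i => Finset.univ.filter (fun q => f (q.1,i) = f p))) := by
    intro q hq
    simp only [Vl, Finset.mem_compl, Finset.mem_filter, Finset.mem_univ, true_and] at hq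
    simp only [Finset.mem_union, Finset.mem_product, Finset.mem_singleton, Finset.mem_univ, and_true, Finset.mem_biUnion, Finset.mem_filter, true_and]
    by_contra hc
    push Not at hc
    exact hq ⟨hc.1, fun i => (hc.2.1 i).symm, hc.2.2⟩
  have h1 : ((((Finset.univ : Finset (Fin k)).biUnion (fun i => Finset.univ.filter (fun q => f q = f (p.1,i)))).card : ℕ) : ℝ) ≤ k * √X := by
    have : (((Finset.univ : Finset (Fin k)).biUnion (fun i => Finset.univ.filter (fun q => f q = f (p.1,i)))).card : ℝ) ≤ ∑ i : Fin k, ((Finset.univ.filter (fun q => f q = f (p.1,i))).card : ℝ) := by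
      exact_mod_cast Finset.card_biUnion_le
    refine this.trans ((Finset.sum_le_sum fun i _ => fib_le f _ hX).trans ?_)
    simp
  have h2 : ((((Finset.univ : Finset (Fin k)).biUnion (fun i => Finset.univ.filter (fun q : Fin m × Fin k => f (q.1,i) = f p))).card : ℕ) : ℝ) ≤ k^2 * √X := by
    have : (((Finset.univ : Finset (Fin k)).biUnion (fun i => Finset.univ.filter (fun q : Fin m × Fin k => f (q.1,i) = f p))).card : ℝ) ≤ ∑ i : Fin k, ((Finset.univ.filter (fun q : Fin m × Fin k => f (q.1,i) = f p)).card : ℝ) := by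
      exact_mod_cast Finset.card_biUnion_le
    refine this.trans ((Finset.sum_le_sum (g := fun _ => k * √X) fun i _ => ?_).trans ?_)
    · have hc : (Finset.univ.filter (fun q : Fin m × Fin k => f (q.1,i) = f p)).card ≤ ((Finset.univ.filter (fun q => f q = f p)) ×ˢ (Finset.univ : Finset (Fin k))).card := by
        refine Finset.card_le_card_of_injOn (fun q => ((q.1,i),q.2)) ?_ ?_
        · intro q hq
          simpa using hq
        · rintro ⟨a, b⟩ _ ⟨c, d⟩ _ h
          simp only [Prod.mk.injEq, and_true] at h
          rw [h.1, h.2]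
      rw [Finset.card_product, Finset.card_univ, Fintype.card_fin] at hc
      have hc' : ((Finset.univ.filter (fun q : Fin m × Fin k => f (q.1,i) = f p)).card : ℝ) ≤ (Finset.univ.filter (fun q => f q = f p)).card * k := by exact_mod_cast hc
      refine hc'.trans ?_
      rw [mul_comm]
      exact mul_le_mul_of_nonneg_left (fib_le f _ hX) (by positivity)
    · simp; apply le_of_eq; ring
  have h3 := (Finset.card_le_card hsub).trans ((Finset.card_union_le _ _).trans (Nat.add_le_add_left (Finset.card_union_le _ _) _))
  have h4 : (((Vl f p)ᶜ).card : ℝ) ≤ k + (k * √X + k^2 * √X) := by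
    have : (((Vl f p)ᶜ).card : ℝ) ≤ k + (((Finset.univ : Finset (Fin k)).biUnion (fun i => Finset.univ.filter (fun q => f q = f (p.1,i)))).card + ((Finset.univ : Finset (Fin k)).biUnion (fun i => Finset.univ.filter (fun q : Fin m × Fin k => f (q.1,i) = f p))).card : ℝ) := by
      refine le_trans (Nat.cast_le.2 h3) ?_
      push_cast
      simp
    linarith
  have h5 : ((Vl f p).card : ℝ) + ((Vl f p)ᶜ).card = k * m := by
    have := Finset.card_add_card_compl (Vl f p)
    rw [Fintype.card_prod, Fintype.card_fin, Fintype.card_fin] at this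
    have h' : ((Vl f p).card : ℝ) + ((Vl f p)ᶜ).card = (m*k:ℕ) := by exact_mod_cast this
    rw [h']; push_cast; ring
  linarith

theorem swap_Dset {m k n : ℕ} (f : Fin m × Fin k → Fin n) (σ : Equiv.Perm (Fin m × Fin k)) :
    (Dset (f ∘ σ)).card = (Dset f).card := by
  refine Finset.card_equiv (Equiv.prodCongr σ σ) ?_
  intro x; simp [Dset]

theorem swap_Om {m k n : ℕ} (f : Fin m × Fin k → Fin n) (σ : Equiv.Perm (Fin m × Fin k)) (hf : f ∈ Om n (∅ : Finset (Fin m × Fin k))) :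
    f ∘ σ ∈ Om n (∅ : Finset (Fin m × Fin k)) := by
  simp only [Om, Finset.filter_empty, Finset.card_empty, Even.zero, true_and, Finset.mem_filter, Finset.mem_univ] at hf ⊢
  intro c
  refine (hf c).trans (le_of_eq ?_)
  symm
  refine Finset.card_equiv σ ?_
  intro x; simp

theorem swap_Bp {m k n : ℕ} (f : Fin m × Fin k → Fin n) (p p' q : Fin m × Fin k) (hp : (p,p') ∈ Bp f) (hq : q ∈ Vl f p) :
    (Bp (f ∘ Equiv.swap p q)).card < (Bp f).card := by
  simp only [Vl, Finset.mem_filter, Finset.mem_univ, true_and] at hq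
  obtain ⟨hq1, hq2, hq3⟩ := hq
  have hnb : ∀ x y, (x,y) ∈ Bp (f ∘ Equiv.swap p q) → x ≠ p ∧ x ≠ q := by
    rintro x y h
    simp only [Bp, Finset.mem_filter, Finset.mem_univ, true_and, Function.comp] at h
    obtain ⟨h1, h2, h3⟩ := h
    constructor
    · rintro rfl
      have hyq : y ≠ q := by rintro rfl; exact hq1 h2.symm
      rw [Equiv.swap_apply_left, Equiv.swap_apply_of_ne_of_ne (Ne.symm h1) hyq] at h3
      apply hq2 y.2
      rw [h2]; exact h3.symm
    · rintro rfl
      have hyp : y ≠ p := by rintro rfl; exact hq1 h2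
      rw [Equiv.swap_apply_right, Equiv.swap_apply_of_ne_of_ne hyp (Ne.symm h1)] at h3
      apply hq3 y.2
      rw [h2]; exact h3.symm
  have hsymm : ∀ (g : Fin m × Fin k → Fin n) x y, (x,y) ∈ Bp g → (y,x) ∈ Bp g := by
    intro g x y h
    simp only [Bp, Finset.mem_filter, Finset.mem_univ, true_and] at h ⊢
    exact ⟨h.1.symm, h.2.1.symm, h.2.2.symm⟩
  apply Finset.card_lt_card
  rw [Finset.ssubset_iff_of_subset]
  · exact ⟨(p,p'), hp, fun h => (hnb _ _ h).1 rfl⟩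
  · rintro ⟨x, y⟩ h
    have h1 := hnb x y h
    have h2 := hnb y x (hsymm _ _ _ h)
    simp only [Bp, Finset.mem_filter, Finset.mem_univ, true_and, Function.comp] at h ⊢
    rw [Equiv.swap_apply_of_ne_of_ne h1.1 h1.2, Equiv.swap_apply_of_ne_of_ne h2.1 h2.2] at h
    exact h

noncomputable def XX (m k n : ℕ) (X : ℝ) (i : ℕ) : Finset (Fin m × Fin k → Fin n) :=
  (Om n (∅ : Finset (Fin m × Fin k))).filter (fun f => ((Dset f).card : ℝ) ≤ X ∧ (Bp f).card ≤ i)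

theorem switch {m k n : ℕ} {C1 : ℝ} (hC : 0 ≤ C1) (hM : 0 < (k:ℝ)*m)
    (hb : 2 * (k + (k + k^2) * √(C1*(k*m))) ≤ (k:ℝ)*m) (i : ℕ) :
    ((XX m k n (C1*(k*m)) (i+1)).card : ℝ) ≤ (1+2*k*C1) * (XX m k n (C1*(k*m)) i).card := by
  set X := C1*(k*m:ℝ) with hX
  set Y := (XX m k n X (i+1)) \ (XX m k n X i) with hY
  have hY1 : ∀ f ∈ Y, f ∈ Om n (∅ : Finset (Fin m × Fin k)) ∧ ((Dset f).card : ℝ) ≤ X ∧ (Bp f).card = i+1 := by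
    intro f hf
    simp only [hY, XX, Finset.mem_sdiff, Finset.mem_filter] at hf
    refine ⟨hf.1.1, hf.1.2.1, ?_⟩
    have h1 := hf.1.2.2
    by_contra h
    exact hf.2 ⟨hf.1.1, hf.1.2.1, by omega⟩
  have hch : ∀ f : Fin m × Fin k → Fin n, ∃ x : (Fin m × Fin k) × (Fin m × Fin k), f ∈ Y → x ∈ Bp f := by
    intro f
    by_cases hf : f ∈ Y
    · have : 0 < (Bp f).card := by rw [(hY1 f hf).2.2]; omega
      obtain ⟨x, hx⟩ := Finset.card_pos.1 this
      exact ⟨x, fun _ => hx⟩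
    · have : Nonempty ((Fin m × Fin k) × (Fin m × Fin k)) := by
        have h1 : 0 < k * m := by exact_mod_cast hM
        have h2 : 0 < k := Nat.pos_of_mul_pos_right h1
        have h3 : 0 < m := Nat.pos_of_mul_pos_left h1
        exact ⟨((⟨0,h3⟩,⟨0,h2⟩),(⟨0,h3⟩,⟨0,h2⟩))⟩
      exact ⟨this.some, fun h => absurd h hf⟩
  choose b hb' using hch
  have hle : (Y.sigma (fun f => Vl f (b f).1)).card ≤ ((XX m k n X i).sigma (fun g => Dset g ×ˢ (Finset.univ : Finset (Fin k)))).card := by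
    refine Finset.card_le_card_of_injOn (fun x => ⟨x.1 ∘ Equiv.swap (b x.1).1 x.2, (((b x.1).2, x.2), (b x.1).1.2)⟩) ?_ ?_
    · rintro ⟨f, q⟩ h
      simp only [Finset.coe_sigma, Set.mem_sigma_iff, Finset.mem_coe] at h
      obtain ⟨hf, hq⟩ := h
      obtain ⟨hf1, hf2, hf3⟩ := hY1 f hf
      have hbf := hb' f hf
      have hlt := swap_Bp f (b f).1 (b f).2 q hbf hq
      simp only [Finset.coe_sigma, Set.mem_sigma_iff, Finset.mem_coe, Finset.mem_product, Finset.mem_univ, and_true]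
      refine ⟨?_, ?_⟩
      · simp only [XX, Finset.mem_filter]
        refine ⟨swap_Om _ _ hf1, by rw [swap_Dset]; exact hf2, by omega⟩
      · simp only [Bp, Finset.mem_filter, Finset.mem_univ, true_and] at hbf
        simp only [Vl, Finset.mem_filter, Finset.mem_univ, true_and] at hq
        simp only [Dset, Finset.mem_filter, Finset.mem_univ, true_and, Function.comp]
        have hne : (b f).2 ≠ q := by
          intro h; apply hq.1; rw [← h]; exact hbf.2.1.symm
        rw [Equiv.swap_apply_right, Equiv.swap_apply_of_ne_of_ne hbf.1.symm hne]
        exact hbf.2.2.symm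
    · rintro ⟨f, q⟩ h ⟨f', q'⟩ h' heq
      simp only [Finset.coe_sigma, Set.mem_sigma_iff, Finset.mem_coe] at h h'
      have hbf := hb' f h.1
      have hbf' := hb' f' h'.1
      simp only [Bp, Finset.mem_filter, Finset.mem_univ, true_and] at hbf hbf'
      simp only [Sigma.mk.injEq, heq_eq_eq, Prod.mk.injEq] at heq
      obtain ⟨e1, ⟨e2, e3⟩, e4⟩ := heq
      have e5 : (b f).1 = (b f').1 := by
        apply Prod.ext
        · rw [hbf.2.1, hbf'.2.1, e2]
        · exact e4
      subst e3
      rw [e5] at e1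
      have e6 : f = f' := by
        funext x
        have := congrFun e1 (Equiv.swap (b f').1 q x)
        simpa using this
      subst e6
      rfl
  rw [Finset.card_sigma, Finset.card_sigma] at hle
  have hle' : (∑ f ∈ Y, ((Vl f (b f).1).card : ℝ)) ≤ ∑ g ∈ XX m k n X i, ((Dset g).card * k : ℝ) := by
    have : ((∑ f ∈ Y, (Vl f (b f).1).card : ℕ) : ℝ) ≤ ((∑ g ∈ XX m k n X i, (Dset g ×ˢ (Finset.univ : Finset (Fin k))).card : ℕ) : ℝ) := Nat.cast_le.2 hle
    push_cast [Finset.card_product] at this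
    simpa using this
  have hlo : (Y.card : ℝ) * (k*m/2) ≤ ∑ f ∈ Y, ((Vl f (b f).1).card : ℝ) := by
    rw [← nsmul_eq_mul, ← Finset.sum_const]
    exact Finset.sum_le_sum fun f hf => Vl_card f _ (hY1 f hf).2.1 hb
  have hhi : ∑ g ∈ XX m k n X i, ((Dset g).card * k : ℝ) ≤ (XX m k n X i).card * (X * k) := by
    rw [← nsmul_eq_mul, ← Finset.sum_const]
    refine Finset.sum_le_sum fun g hg => ?_
    simp only [XX, Finset.mem_filter] at hg
    exact mul_le_mul_of_nonneg_right hg.2.1 (by positivity)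
  have hY2 : (Y.card : ℝ) ≤ 2*k*C1 * (XX m k n X i).card := by
    have h := hlo.trans (hle'.trans hhi)
    rw [hX] at h ⊢
    have h2 : ((k:ℝ)*m) * Y.card ≤ ((k:ℝ)*m) * (2*k*C1 * (XX m k n (C1*(k*m)) i).card) := by linarith
    exact le_of_mul_le_mul_left h2 hM
  have hs : ((XX m k n X (i+1)).card : ℝ) ≤ Y.card + (XX m k n X i).card := by
    have := Finset.card_le_card_sdiff_add_card (t := XX m k n X i) (s := XX m k n X (i+1))
    exact_mod_cast this
  linarith

theorem switch_iter {m k n : ℕ} {C1 : ℝ} (hC : 0 ≤ C1) (hM : 0 < (k:ℝ)*m)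
    (hb : 2 * (k + (k + k^2) * √(C1*(k*m))) ≤ (k:ℝ)*m) (i : ℕ) :
    ((XX m k n (C1*(k*m)) i).card : ℝ) ≤ (1+2*k*C1)^i * (XX m k n (C1*(k*m)) 0).card := by
  induction i with
  | zero => simp
  | succ i ih =>
    refine (switch hC hM hb i).trans ?_
    have h0 : (0:ℝ) ≤ 1+2*k*C1 := by positivity
    rw [pow_succ', mul_assoc (1+2*k*C1)]
    exact mul_le_mul_of_nonneg_left ih h0

theorem markov_aux {α : Type*} (Ω : Finset α) (g : α → ℕ) {a : ℝ} (ha : 0 < a)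
    (h : ∑ f ∈ Ω, (g f : ℝ) ≤ a/4 * Ω.card) : ((Ω.filter (fun f => a < g f)).card : ℝ) ≤ Ω.card / 4 := by
  have h1 : ((Ω.filter (fun f => a < g f)).card : ℝ) * a ≤ ∑ f ∈ Ω, (g f : ℝ) := by
    rw [← nsmul_eq_mul, ← Finset.sum_const]
    refine (Finset.sum_le_sum (g := fun f => (g f : ℝ)) fun f hf => ?_).trans
      (Finset.sum_le_sum_of_subset_of_nonneg (Finset.filter_subset _ _) fun _ _ _ => by positivity)
    exact (Finset.mem_filter.1 hf).2.le
  have h2 : a * ((Ω.filter (fun f => a < g f)).card : ℝ) ≤ a * (Ω.card/4) := by linarith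
  exact le_of_mul_le_mul_left h2 ha

theorem pair_sum {m k n : ℕ} {E : ℝ} (Q : Finset ((Fin m × Fin k) × (Fin m × Fin k))) (hQ : ∀ x ∈ Q, x.1 ≠ x.2)
    (hE : ((2).factorial:ℝ)*(k*m-2).factorial*qq n (2,k*m-2) ≤ E) :
    ∑ f ∈ Om n (∅ : Finset (Fin m × Fin k)), ((Q.filter (fun x => f x.1 = f x.2)).card : ℝ) ≤ Q.card * E := by
  simp only [Finset.card_filter]
  push_cast
  rw [Finset.sum_comm, ← nsmul_eq_mul, ← Finset.sum_const]
  refine Finset.sum_le_sum fun x hx => ?_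
  have hne := hQ x hx
  have h := Om_card n ({x.1,x.2} : Finset (Fin m × Fin k))
  rw [Finset.card_pair hne, Fintype.card_prod, Fintype.card_fin, Fintype.card_fin, mul_comm m k] at h
  rw [← h] at hE
  refine le_trans ?_ hE
  rw [← Nat.cast_one, ← Nat.cast_zero]
  simp only [← Nat.cast_ite]
  rw [← Nat.cast_sum, ← Finset.card_filter, Nat.cast_le]
  apply Finset.card_le_card
  intro f hf
  simp only [Om, Finset.mem_filter, Finset.mem_univ, true_and] at hf ⊢
  intro c
  refine ⟨?_, (hf.1 c).2⟩
  by_cases hc : f x.1 = c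
  · have : ({x.1, x.2} : Finset (Fin m × Fin k)).filter (fun p => f p = c) = {x.1,x.2} := by
      apply Finset.filter_true_of_mem
      intro p hp
      rw [Finset.mem_insert, Finset.mem_singleton] at hp
      rcases hp with rfl | rfl
      · exact hc
      · rw [← hf.2]; exact hc
    rw [this, Finset.card_pair hne]; exact even_two
  · have : ({x.1, x.2} : Finset (Fin m × Fin k)).filter (fun p => f p = c) = ∅ := by
      apply Finset.filter_false_of_mem
      intro p hp
      rw [Finset.mem_insert, Finset.mem_singleton] at hp
      rcases hp with rfl | rfl
      · exact hc
      · rw [← hf.2]; exact hc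
    rw [this]; simp

set_option maxHeartbeats 1000000 in
theorem rowinj {k : ℕ} (hk : 1 ≤ k) {κ0 : ℝ} (h0 : 2 < κ0) (hκk : κ0 ≤ k) : ∃ c > 0, ∃ n0 : ℕ, 0 < n0 ∧ ∀ m n : ℕ, n0 ≤ n → κ0 * n ≤ k * m → m ≤ n →
    c * (((k*m).factorial : ℝ) * qq n (0,k*m)) ≤ ((Om n (∅ : Finset (Fin m × Fin k))).filter (fun f => ∀ i, Function.Injective (fun j => f (i,j)))).card := by
  obtain ⟨C, hC, n1, hn1, H⟩ := pair_bound hk h0 hκk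
  have hk0 : (0:ℝ) < k := by exact_mod_cast hk
  set C1 : ℝ := 1 + 4*k*C with hC1
  have hC1p : 0 < C1 := by positivity
  set L0 : ℝ := 4*k^2*C with hL0
  have hL0p : 0 < L0 := by positivity
  set L := ⌊L0⌋₊ with hL
  obtain ⟨n2, hn2⟩ := exists_nat_ge (4*k + 16*((k:ℝ)+k^2)^2*C1)
  refine ⟨1/(2*(1+2*k*C1)^L), by positivity, n1+n2, by omega, fun m n hn hm hmn => ?_⟩
  have hnp : (0:ℝ) < n := by exact_mod_cast (by omega : 0 < n)
  have hnM : (n:ℝ) ≤ k*m := le_trans (le_mul_of_one_le_left hnp.le (by linarith)) hm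
  have hMp : (0:ℝ) < k*m := by linarith
  have hMkn : (k:ℝ)*m ≤ k*n := mul_le_mul_of_nonneg_left (by exact_mod_cast hmn) hk0.le
  have hMb : 4*k + 16*((k:ℝ)+k^2)^2*C1 ≤ (k:ℝ)*m := by
    refine hn2.trans (le_trans ?_ hnM)
    exact_mod_cast (by omega : n2 ≤ n)
  have hq : 0 ≤ 16*((k:ℝ)+k^2)^2*C1 := by positivity
  set M : ℝ := (k:ℝ)*m with hMdef
  have hsq : ((k:ℝ) + k^2) * √(C1*M) ≤ M/4 := by
    have h1 : √(C1*M) ≤ M/(4*((k:ℝ)+k^2)) := by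
      apply Real.sqrt_le_iff.2
      refine ⟨by positivity, ?_⟩
      rw [div_pow, le_div_iff₀ (by positivity)]
      have h2 : (16*((k:ℝ)+k^2)^2*C1) * M ≤ M * M := mul_le_mul_of_nonneg_right (by linarith) hMp.le
      linarith
    calc ((k:ℝ) + k^2) * √(C1*M) ≤ ((k:ℝ) + k^2) * (M/(4*((k:ℝ)+k^2))) := mul_le_mul_of_nonneg_left h1 (by positivity)
      _ = M/4 := by field_simp
  have hb : 2 * (k + (k + k^2) * √(C1*M)) ≤ M := by linarith
  have hT := Om_card n (∅ : Finset (Fin m × Fin k))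
  rw [Finset.card_empty, Fintype.card_prod, Fintype.card_fin, Fintype.card_fin, Nat.sub_zero, mul_comm m k, Nat.factorial_zero, Nat.cast_one, one_mul] at hT
  have HE := H m n (by omega) hm hmn
  rw [← hT] at HE ⊢
  set Ω := Om n (∅ : Finset (Fin m × Fin k)) with hΩ
  have hTp : (0:ℝ) ≤ Ω.card := by positivity
  -- off diagonal pairs
  set Q1 : Finset ((Fin m × Fin k) × (Fin m × Fin k)) := Finset.univ.filter (fun x => x.1 ≠ x.2) with hQ1
  set Q2 : Finset ((Fin m × Fin k) × (Fin m × Fin k)) := Finset.univ.filter (fun x => x.1 ≠ x.2 ∧ x.1.1 = x.2.1) with hQ2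
  have c1 : (Q1.card : ℝ) ≤ M * M := by
    have : Q1.card ≤ (k*m)*(k*m) := by
      refine (Finset.card_le_univ _).trans (le_of_eq ?_)
      simp [Fintype.card_prod]; ring
    rw [hMdef]; exact_mod_cast this
  have c2 : (Q2.card : ℝ) ≤ M * k := by
    have : Q2.card ≤ (Finset.univ : Finset ((Fin m × Fin k) × Fin k)).card := by
      refine Finset.card_le_card_of_injOn (fun x => (x.1, x.2.2)) (fun _ _ => Finset.mem_coe.2 (Finset.mem_univ _)) ?_
      rintro ⟨x, y⟩ hx ⟨x', y'⟩ hx' h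
      simp only [hQ2, Finset.coe_filter, Finset.mem_univ, true_and, Set.mem_ofPred_eq] at hx hx'
      simp only [Prod.mk.injEq] at h
      have : y = y' := Prod.ext (by rw [← hx.2, ← hx'.2, h.1]) h.2
      rw [h.1, this]
    rw [Finset.card_univ, Fintype.card_prod, Fintype.card_prod, Fintype.card_fin, Fintype.card_fin, mul_comm m k] at this
    rw [hMdef]; exact_mod_cast this
  have s1 := pair_sum (n := n) Q1 (fun x hx => (Finset.mem_filter.1 hx).2) HE
  have s2 := pair_sum (n := n) Q2 (fun x hx => (Finset.mem_filter.1 hx).2.1) HE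
  have hMn : M / n ≤ k := by rw [div_le_iff₀ hnp]; exact hMkn
  have k1 : ((Ω.filter (fun f => 4*k*C*M < ((Q1.filter (fun x => f x.1 = f x.2)).card : ℕ))).card : ℝ) ≤ Ω.card / 4 := by
    refine markov_aux Ω _ (by positivity) (s1.trans ?_)
    calc (Q1.card:ℝ) * (C/n*Ω.card) ≤ (M*M)*(C/n*Ω.card) := by gcongr
      _ = (M/n) * (M*C*Ω.card) := by ring
      _ ≤ k * (M*C*Ω.card) := by gcongr
      _ = _ := by ring
  have k2 : ((Ω.filter (fun f => L0 < ((Q2.filter (fun x => f x.1 = f x.2)).card : ℕ))).card : ℝ) ≤ Ω.card / 4 := by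
    refine markov_aux Ω _ (by positivity) (s2.trans ?_)
    calc (Q2.card:ℝ) * (C/n*Ω.card) ≤ (M*k)*(C/n*Ω.card) := by gcongr
      _ = (M/n) * (k*C*Ω.card) := by ring
      _ ≤ k * (k*C*Ω.card) := by gcongr
      _ = _ := by rw [hL0]; ring
  have hD : ∀ f : Fin m × Fin k → Fin n, ((Dset f).card : ℝ) ≤ M + (Q1.filter (fun x => f x.1 = f x.2)).card := by
    intro f
    have : Dset f ⊆ (Finset.univ : Finset (Fin m × Fin k)).image (fun p => (p,p)) ∪ Q1.filter (fun x => f x.1 = f x.2) := by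
      rintro ⟨x, y⟩ h
      simp only [Dset, Finset.mem_filter, Finset.mem_univ, true_and] at h
      simp only [hQ1, Finset.mem_union, Finset.mem_image, Finset.mem_filter, Finset.mem_univ, true_and, Prod.mk.injEq]
      by_cases hxy : x = y
      · exact Or.inl ⟨x, rfl, hxy⟩
      · exact Or.inr ⟨hxy, h⟩
    have h1 := (Finset.card_le_card this).trans (Finset.card_union_le _ _)
    have h2 : ((Finset.univ : Finset (Fin m × Fin k)).image (fun p => (p,p))).card ≤ k*m := by
      refine Finset.card_image_le.trans (le_of_eq ?_)
      rw [Finset.card_univ, Fintype.card_prod, Fintype.card_fin, Fintype.card_fin, mul_comm]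
    have h3 : (Dset f).card ≤ k*m + (Q1.filter (fun x => f x.1 = f x.2)).card := h1.trans (Nat.add_le_add_right h2 _)
    rw [hMdef]; exact_mod_cast h3
  have hB : ∀ f : Fin m × Fin k → Fin n, Bp f = Q2.filter (fun x => f x.1 = f x.2) := by
    intro f; ext x; simp [Bp, hQ2, and_assoc]
  have hcov : Ω ⊆ XX m k n (C1*M) L ∪ (Ω.filter (fun f => 4*k*C*M < ((Q1.filter (fun x => f x.1 = f x.2)).card : ℕ)) ∪ Ω.filter (fun f => L0 < ((Q2.filter (fun x => f x.1 = f x.2)).card : ℕ))) := by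
    intro f hf
    rw [Finset.mem_union, Finset.mem_union, Finset.mem_filter, Finset.mem_filter]
    by_cases h1 : 4*k*C*M < ((Q1.filter (fun x => f x.1 = f x.2)).card : ℕ)
    · exact Or.inr (Or.inl ⟨hf, h1⟩)
    by_cases h2 : L0 < ((Q2.filter (fun x => f x.1 = f x.2)).card : ℕ)
    · exact Or.inr (Or.inr ⟨hf, h2⟩)
    left
    rw [XX, Finset.mem_filter]
    refine ⟨hf, ?_, ?_⟩
    · have := hD f
      rw [hC1]; linarith
    · rw [hB]; exact Nat.le_floor (not_lt.1 h2)
  have h3 := (Finset.card_le_card hcov).trans ((Finset.card_union_le _ _).trans (Nat.add_le_add_left (Finset.card_union_le _ _) _))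
  have h3' : (Ω.card : ℝ) ≤ (XX m k n (C1*M) L).card + (((Ω.filter (fun f => 4*k*C*M < ((Q1.filter (fun x => f x.1 = f x.2)).card : ℕ))).card : ℝ) + ((Ω.filter (fun f => L0 < ((Q2.filter (fun x => f x.1 = f x.2)).card : ℕ))).card : ℝ)) := by
    refine (Nat.cast_le.2 h3).trans (le_of_eq ?_)
    rw [Nat.cast_add, Nat.cast_add]
  have h4 := switch_iter (m := m) (k := k) (n := n) hC1p.le hMp hb L
  have h5 : ((XX m k n (C1*M) 0).card : ℝ) ≤ (Ω.filter (fun f => ∀ i, Function.Injective (fun j => f (i,j)))).card := by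
    apply Nat.cast_le.2
    apply Finset.card_le_card
    intro f hf
    rw [XX, Finset.mem_filter] at hf
    rw [Finset.mem_filter]
    refine ⟨hf.1, fun i x y hxy => ?_⟩
    by_contra hne
    have : Bp f = ∅ := Finset.card_eq_zero.1 (Nat.le_zero.1 hf.2.2)
    have h6 : ((i,x),(i,y)) ∈ Bp f := by
      simp only [Bp, Finset.mem_filter, Finset.mem_univ, true_and]
      exact ⟨fun h => hne (Prod.mk.injEq _ _ _ _ ▸ h).2, hxy⟩
    rw [this] at h6
    exact absurd h6 (Finset.notMem_empty _)
  have hpw : (0:ℝ) < (1+2*k*C1)^L := by positivity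
  rw [one_div, inv_mul_le_iff₀ (by positivity)]
  have h7 := mul_le_mul_of_nonneg_left h5 hpw.le
  linarith

theorem inj_image_card {k n : ℕ} (s : Finset (Fin n)) (hs : s.card = k) :
    (Finset.univ.filter (fun g : Fin k → Fin n => Function.Injective g ∧ Finset.univ.image g = s)).card = k.factorial := by
  have e : Fin k ≃ s := (Finset.equivFinOfCardEq hs).symm
  have h1 : (Finset.univ : Finset (Equiv.Perm (Fin k))).card = k.factorial := by
    rw [Finset.card_univ, Fintype.card_perm, Fintype.card_fin]
  rw [← h1]
  symm
  refine Finset.card_bij (fun σ _ j => (e (σ j) : Fin n)) ?_ ?_ ?_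
  · intro σ _
    rw [Finset.mem_filter]
    refine ⟨Finset.mem_univ _, fun x y h => ?_, ?_⟩
    · exact σ.injective (e.injective (Subtype.ext h))
    · ext c
      simp only [Finset.mem_image, Finset.mem_univ, true_and]
      constructor
      · rintro ⟨j, rfl⟩; exact (e (σ j)).2
      · intro hc; exact ⟨σ.symm (e.symm ⟨c, hc⟩), by simp⟩
  · intro σ _ τ _ h
    ext j
    exact congrArg _ (e.injective (Subtype.ext (congrFun h j)))
  · intro g hg
    rw [Finset.mem_filter] at hg
    obtain ⟨_, hi, him⟩ := hg
    have hmem : ∀ j, g j ∈ s := fun j => by rw [← him]; exact Finset.mem_image_of_mem _ (Finset.mem_univ _)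
    have hinj : Function.Injective (fun j => e.symm ⟨g j, hmem j⟩) := by
      intro x y h
      have := e.symm.injective h
      exact hi (Subtype.mk.inj this)
    refine ⟨Equiv.ofBijective _ (Finite.injective_iff_bijective.1 hinj), Finset.mem_univ _, ?_⟩
    funext j
    simp

noncomputable def Mt {m k n : ℕ} (f : Fin m × Fin k → Fin n) : Matrix (Fin m) (Fin n) (ZMod 2) :=
  fun i c => if ∃ j, f (i,j) = c then 1 else 0

theorem Mt_one {m k n : ℕ} (f : Fin m × Fin k → Fin n) (i : Fin m) (c : Fin n) : Mt f i c = 1 ↔ ∃ j, f (i,j) = c := by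
  unfold Mt; split_ifs with h <;> simp [h]

theorem zmod2_ext {a b : ZMod 2} (h : a = 1 ↔ b = 1) : a = b := by
  revert h; revert a b; decide

noncomputable def Fb {m k n : ℕ} (A : Matrix (Fin m) (Fin n) (ZMod 2)) : Finset (Fin m × Fin k → Fin n) :=
  Finset.univ.filter (fun f => (∀ i, Function.Injective (fun j => f (i,j))) ∧ Mt f = A)

theorem Fb_card {m k n : ℕ} (A : Matrix (Fin m) (Fin n) (ZMod 2))
    (hA : ∀ i : Fin m, (Finset.univ.filter (fun j : Fin n => A i j = 1)).card = k) :
    (Fb A : Finset (Fin m × Fin k → Fin n)).card = k.factorial ^ m := by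
  have h : (Fintype.piFinset (fun i : Fin m => Finset.univ.filter (fun g : Fin k → Fin n => Function.Injective g ∧ Finset.univ.image g = Finset.univ.filter (fun j : Fin n => A i j = 1)))).card = k.factorial ^ m := by
    rw [Fintype.card_piFinset, Finset.prod_congr rfl (fun i _ => inj_image_card _ (hA i))]
    simp
  rw [← h]
  refine Finset.card_equiv (Equiv.curry _ _ _) ?_
  intro f
  simp only [Fb, Finset.mem_filter, Finset.mem_univ, true_and, Fintype.mem_piFinset]
  constructor
  · rintro ⟨h1, rfl⟩ i
    refine ⟨h1 i, ?_⟩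
    ext c
    simp [Mt_one, Function.curry]
  · intro h
    refine ⟨fun i => (h i).1, ?_⟩
    funext i c
    apply zmod2_ext
    rw [Mt_one]
    have := Finset.ext_iff.1 (h i).2 c
    simpa [Function.curry] using this

theorem fib_col {m k n : ℕ} (f : Fin m × Fin k → Fin n) (hf : ∀ i, Function.Injective (fun j => f (i,j))) (S : Finset (Fin m)) (c : Fin n) :
    ((S ×ˢ (Finset.univ : Finset (Fin k))).filter (fun p => f p = c)).card = (S.filter (fun i => Mt f i c = 1)).card := by
  refine Finset.card_bij (fun p _ => p.1) ?_ ?_ ?_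
  · rintro ⟨i, j⟩ h
    simp only [Finset.mem_filter, Finset.mem_product, Finset.mem_univ, and_true] at h
    simp only [Finset.mem_filter, Mt_one]
    exact ⟨h.1, j, h.2⟩
  · rintro ⟨i, j⟩ h ⟨i', j'⟩ h' e
    simp only [Finset.mem_filter, Finset.mem_product, Finset.mem_univ, and_true] at h h'
    simp only at e
    subst e
    have : j = j' := hf i (h.2.trans h'.2.symm)
    rw [this]
  · intro i hi
    simp only [Finset.mem_filter, Mt_one] at hi
    obtain ⟨h1, j, h2⟩ := hi
    refine ⟨(i,j), ?_, rfl⟩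
    simp [h1, h2]

theorem sum_zmod2 {m n : ℕ} (A : Matrix (Fin m) (Fin n) (ZMod 2)) (S : Finset (Fin m)) (c : Fin n) :
    ∑ i ∈ S, A i c = ((S.filter (fun i => A i c = 1)).card : ZMod 2) := by
  rw [Finset.card_filter]
  push_cast
  refine Finset.sum_congr rfl fun i _ => ?_
  apply zmod2_ext
  split_ifs with h <;> simp [h]

noncomputable def Bd (k m n : ℕ) (S : Finset (Fin m)) : Finset (Matrix (Fin m) (Fin n) (ZMod 2)) :=
  (constrainedSet k m n).filter (fun A => ∀ c, ∑ i ∈ S, A i c = 0)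

theorem Bd_le {k m n : ℕ} (S : Finset (Fin m)) :
    ((k.factorial ^ m * (Bd k m n S).card : ℕ) : ℝ) ≤ (k*S.card).factorial * (k*(m-S.card)).factorial * qq n (k*S.card, k*(m-S.card)) := by
  have h := Om_card n (S ×ˢ (Finset.univ : Finset (Fin k)))
  rw [Finset.card_product, Fintype.card_prod, Finset.card_univ, Fintype.card_fin, Fintype.card_fin, ← Nat.sub_mul, mul_comm _ k, mul_comm _ k] at h
  rw [← h, Nat.cast_le, mul_comm]
  have h2 : (Bd k m n S).card * k.factorial^m = ∑ A ∈ Bd k m n S, (Fb A : Finset (Fin m × Fin k → Fin n)).card := by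
    rw [← smul_eq_mul, ← Finset.sum_const]
    refine Finset.sum_congr rfl fun A hA => (Fb_card A ?_).symm
    simp only [Bd, constrainedSet, Finset.mem_filter] at hA
    exact hA.1.2.1
  rw [h2, ← Finset.card_biUnion]
  · apply Finset.card_le_card
    intro f hf
    rw [Finset.mem_biUnion] at hf
    obtain ⟨A, hA, hf⟩ := hf
    simp only [Fb, Finset.mem_filter, Finset.mem_univ, true_and] at hf
    obtain ⟨hi, rfl⟩ := hf
    simp only [Bd, constrainedSet, Finset.mem_filter, Finset.mem_univ, true_and] at hA
    simp only [Om, Finset.mem_filter, Finset.mem_univ, true_and]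
    intro c
    constructor
    · rw [fib_col f hi, ← ZMod.natCast_eq_zero_iff_even, ← sum_zmod2]
      exact hA.2 c
    · have := fib_col f hi Finset.univ c
      rw [Finset.univ_product_univ] at this
      rw [this]; exact hA.1.2 c
  · intro A _ B _ hAB
    rw [Function.onFun, Finset.disjoint_left]
    intro f hf hf'
    simp only [Fb, Finset.mem_filter] at hf hf'
    exact hAB (hf.2.2.symm.trans hf'.2.2)

theorem CS_ge {k m n : ℕ} :
    ((Om n (∅ : Finset (Fin m × Fin k))).filter (fun f => ∀ i, Function.Injective (fun j => f (i,j)))).card ≤ k.factorial ^ m * (constrainedSet k m n).card := by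
  have h2 : (constrainedSet k m n).card * k.factorial^m = ∑ A ∈ constrainedSet k m n, (Fb A : Finset (Fin m × Fin k → Fin n)).card := by
    rw [← smul_eq_mul, ← Finset.sum_const]
    refine Finset.sum_congr rfl fun A hA => (Fb_card A ?_).symm
    simp only [constrainedSet, Finset.mem_filter] at hA
    exact hA.2.1
  rw [mul_comm, h2]
  refine le_trans (Finset.card_le_card ?_) Finset.card_biUnion_le
  intro f hf
  simp only [Om, Finset.mem_filter, Finset.mem_univ, true_and] at hf
  obtain ⟨hf, hi⟩ := hf
  rw [Finset.mem_biUnion]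
  refine ⟨Mt f, ?_, ?_⟩
  · simp only [constrainedSet, Finset.mem_filter, Finset.mem_univ, true_and]
    constructor
    · intro i
      have : Finset.univ.filter (fun c => Mt f i c = 1) = Finset.univ.image (fun j => f (i,j)) := by
        ext c; simp [Mt_one]
      rw [this, Finset.card_image_of_injective _ (hi i)]; simp
    · intro c
      have := fib_col f hi Finset.univ c
      rw [Finset.univ_product_univ] at this
      rw [← this]; exact (hf c).2
  · simp only [Fb, Finset.mem_filter, Finset.mem_univ, true_and]
    exact ⟨hi, trivial⟩

theorem surj_of_good {m n : ℕ} (A : Matrix (Fin m) (Fin n) (ZMod 2))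
    (h : ∀ S : Finset (Fin m), S.Nonempty → ¬ ∀ c, ∑ i ∈ S, A i c = 0) (b : Fin m → ZMod 2) : ∃ x, A.mulVec x = b := by
  have hinj : Function.Injective (fun v => Matrix.vecMul v A) := by
    intro v w hvw
    by_contra hne
    have hu : Matrix.vecMul (v - w) A = 0 := by
      have := Matrix.sub_vecMul A v w
      rw [this, sub_eq_zero]; exact hvw
    have hu0 : v - w ≠ 0 := sub_ne_zero.2 hne
    obtain ⟨i, hi⟩ := Function.ne_iff.1 hu0
    have z2 : ∀ a : ZMod 2, a ≠ 0 → a = 1 := by decide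
    refine h (Finset.univ.filter (fun i => (v - w) i = 1)) ⟨i, ?_⟩ ?_
    · rw [Finset.mem_filter]; exact ⟨Finset.mem_univ _, z2 _ hi⟩
    · intro c
      have hc := congrFun hu c
      rw [Matrix.vecMul, dotProduct] at hc
      rw [Finset.sum_filter]
      refine Eq.trans (Finset.sum_congr rfl fun i _ => ?_) hc
      by_cases h1 : (v - w) i = 1
      · rw [if_pos h1, h1, one_mul]
      · have : (v - w) i = 0 := by by_contra h2; exact h1 (z2 _ h2)
        rw [if_neg h1, this, zero_mul]
  have hli : LinearIndependent (ZMod 2) A.row := Matrix.vecMul_injective_iff.1 hinj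
  have hr := hli.rank_matrix
  have : LinearMap.range A.mulVecLin = ⊤ := by
    apply Submodule.eq_top_of_finrank_eq
    rw [← Matrix.rank, hr]; simp
  obtain ⟨x, hx⟩ := LinearMap.range_eq_top.1 this b
  exact ⟨x, hx⟩

theorem Bd_small {k m n : ℕ} (hk : 1 ≤ k) (S : Finset (Fin m)) (hS : S.Nonempty) (h2 : ¬ 2 ≤ S.card) : Bd k m n S = ∅ := by
  have h1 : S.card = 1 := by have := Finset.card_pos.2 hS; omega
  obtain ⟨i, rfl⟩ := Finset.card_eq_one.1 h1
  rw [Bd, Finset.filter_eq_empty_iff]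
  intro A hA h
  simp only [constrainedSet, Finset.mem_filter, Finset.mem_univ, true_and] at hA
  have h3 := hA.1 i
  simp only [Finset.sum_singleton] at h
  simp [h] at h3
  omega

theorem unsat_le {k m n : ℕ} (hk : 1 ≤ k) (hne : 0 < (constrainedSet k m n).card) :
    (1 - satProb k m n) * (constrainedSet k m n).card ≤ ∑ S ∈ (Finset.univ : Finset (Fin m)).powerset, if 2 ≤ S.card then ((Bd k m n S).card : ℝ) else 0 := by
  set CS := constrainedSet k m n with hCS
  set good := CS.filter (fun A => ∀ S : Finset (Fin m), S.Nonempty → ¬ ∀ c, ∑ i ∈ S, A i c = 0) with hg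
  have hne' : (0:ℝ) < CS.card := by exact_mod_cast hne
  have h1 : (good.card : ℝ) * 2^m ≤ (((CS ×ˢ (Finset.univ : Finset (Fin m → ZMod 2))).filter
      (fun p => ∃ x : Fin n → ZMod 2, p.1.mulVec x = p.2)).card : ℝ) := by
    have : (good ×ˢ (Finset.univ : Finset (Fin m → ZMod 2))).card = good.card * 2^m := by
      rw [Finset.card_product, Finset.card_univ, Fintype.card_fun, ZMod.card, Fintype.card_fin]
    have h2 : good.card * 2^m ≤ ((CS ×ˢ (Finset.univ : Finset (Fin m → ZMod 2))).filter
      (fun p => ∃ x : Fin n → ZMod 2, p.1.mulVec x = p.2)).card := by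
      rw [← this]
      apply Finset.card_le_card
      rintro ⟨A, b⟩ h
      rw [Finset.mem_product, hg, Finset.mem_filter] at h
      rw [Finset.mem_filter, Finset.mem_product]
      exact ⟨⟨h.1.1, Finset.mem_univ _⟩, surj_of_good A h.1.2 b⟩
    exact_mod_cast h2
  have h2 : (good.card : ℝ) ≤ satProb k m n * CS.card := by
    rw [satProb, ← hCS, div_mul_eq_mul_div, le_div_iff₀ (by positivity)]
    have := mul_le_mul_of_nonneg_right h1 hne'.le
    linarith
  have h3 : CS ⊆ good ∪ (Finset.univ : Finset (Fin m)).powerset.biUnion (fun S => if 2 ≤ S.card then Bd k m n S else ∅) := by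
    intro A hA
    rw [Finset.mem_union]
    by_cases hgA : A ∈ good
    · exact Or.inl hgA
    right
    rw [hg, Finset.mem_filter] at hgA
    push Not at hgA
    obtain ⟨S, hS, hc⟩ := hgA hA
    rw [Finset.mem_biUnion]
    refine ⟨S, by simp, ?_⟩
    have hB : A ∈ Bd k m n S := by rw [Bd, Finset.mem_filter]; exact ⟨hA, hc⟩
    by_cases h2 : 2 ≤ S.card
    · rw [if_pos h2]; exact hB
    · rw [Bd_small hk S hS h2] at hB; exact absurd hB (Finset.notMem_empty _)
  have h4 := (Finset.card_le_card h3).trans ((Finset.card_union_le _ _).trans (Nat.add_le_add_left Finset.card_biUnion_le _))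
  have h5 : (CS.card : ℝ) ≤ good.card + ∑ S ∈ (Finset.univ : Finset (Fin m)).powerset, if 2 ≤ S.card then ((Bd k m n S).card : ℝ) else 0 := by
    refine (Nat.cast_le.2 h4).trans (le_of_eq ?_)
    push_cast
    congr 1
    refine Finset.sum_congr rfl fun S _ => ?_
    split_ifs <;> simp
  linarith

theorem case1 {k : ℕ} (hk : 3 ≤ k) {κ0 : ℝ} (h0 : 2 < κ0) (hκk : κ0 ≤ k) : ∃ K > 0, ∃ n0 : ℕ, ∀ m n : ℕ, n0 ≤ n → κ0 * n ≤ k * m → m ≤ n →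
    1 - satProb k m n ≤ K * (1/(m:ℝ)^(k-2) + Real.exp (-0.69 * ((n:ℝ) - m))) := by
  obtain ⟨K, hK, n1, _, H1⟩ := thmB hk h0 hκk
  obtain ⟨c, hc, n2, _, H2⟩ := rowinj (by omega : 1 ≤ k) h0 hκk
  refine ⟨K/c, by positivity, n1+n2, fun m n hn hm hmn => ?_⟩
  obtain ⟨hq, hB⟩ := H1 m n (by omega) hm hmn
  have hR := H2 m n (by omega) hm hmn
  set T := ((k*m).factorial : ℝ) * qq n (0,k*m) with hT
  have hT0 : 0 < T := by positivity
  set F : ℝ := (k.factorial : ℝ)^m with hF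
  have hF0 : 0 < F := by positivity
  have hCS : c * T ≤ F * (constrainedSet k m n).card := by
    refine hR.trans ?_
    have := CS_ge (k := k) (m := m) (n := n)
    rw [hF]; exact_mod_cast this
  have hCp : (0:ℝ) < (constrainedSet k m n).card := by
    have : 0 < F * (constrainedSet k m n).card := lt_of_lt_of_le (by positivity) hCS
    exact (pos_iff_pos_of_mul_pos this).1 hF0
  have hU := unsat_le (by omega : 1 ≤ k) (by exact_mod_cast hCp : 0 < (constrainedSet k m n).card)
  have hS : F * (∑ S ∈ (Finset.univ : Finset (Fin m)).powerset, if 2 ≤ S.card then ((Bd k m n S).card : ℝ) else 0) ≤ ∑ l ∈ Finset.Icc 2 m, tm k n l (m-l) := by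
    rw [Finset.mul_sum]
    have e : ∑ S ∈ (Finset.univ : Finset (Fin m)).powerset, (fun l => if 2 ≤ l then ((k*l).factorial * (k*(m-l)).factorial * qq n (k*l, k*(m-l)) : ℝ) else 0) S.card = ∑ l ∈ Finset.Icc 2 m, tm k n l (m-l) := by
      rw [Finset.sum_powerset_apply_card (fun l => if 2 ≤ l then ((k*l).factorial * (k*(m-l)).factorial * qq n (k*l, k*(m-l)) : ℝ) else 0)]
      rw [Finset.card_univ, Fintype.card_fin]
      symm
      have hsub : Finset.Icc 2 m ⊆ Finset.range (m+1) := by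
        intro l hl; rw [Finset.mem_Icc] at hl; rw [Finset.mem_range]; omega
      rw [← Finset.sum_subset hsub]
      · refine Finset.sum_congr rfl fun l hl => ?_
        rw [Finset.mem_Icc] at hl
        rw [if_pos hl.1, tm, Nat.add_sub_cancel' hl.2, nsmul_eq_mul]
        ring
      · intro l hl hl'
        rw [Finset.mem_range] at hl
        rw [Finset.mem_Icc] at hl'
        rw [if_neg (by omega), smul_zero]
    rw [← e]
    refine Finset.sum_le_sum fun S _ => ?_
    simp only
    split_ifs with h
    · have := Bd_le (k := k) (n := n) S
      push_cast at this
      exact this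
    · simp
  set Z := 1/(m:ℝ)^(k-2) + Real.exp (-0.69 * ((n:ℝ) - m)) with hZ
  have hZ0 : 0 < Z := by positivity
  rw [div_mul_eq_mul_div, le_div_iff₀ hc]
  by_cases hs : 1 - satProb k m n ≤ 0
  · have : (1 - satProb k m n) * c ≤ 0 := mul_nonpos_of_nonpos_of_nonneg hs hc.le
    have : 0 < K * Z := by positivity
    linarith
  push Not at hs
  have a1 := mul_le_mul_of_nonneg_left hU hF0.le
  have a2 := mul_le_mul_of_nonneg_left hCS hs.le
  have a3 : ((1 - satProb k m n) * c) * T ≤ (K * Z) * T := by linarith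
  exact le_of_mul_le_mul_right a3 hT0

theorem satProb_le_one (k m n : ℕ) : satProb k m n ≤ 1 := by
  unfold satProb
  apply div_le_one_of_le₀ _ (by positivity)
  have h := Finset.card_filter_le (constrainedSet k m n ×ˢ (Finset.univ : Finset (Fin m → ZMod 2))) (fun p => ∃ x : Fin n → ZMod 2, p.1.mulVec x = p.2)
  rw [Finset.card_product, Finset.card_univ (α := Fin m → ZMod 2), Fintype.card_fun, ZMod.card, Fintype.card_fin] at h
  exact_mod_cast h

theorem satProb_nonneg (k m n : ℕ) : 0 ≤ satProb k m n := by
  unfold satProb; positivity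

theorem case2 (k m n : ℕ) : satProb k m n ≤ 2^n/2^m := by
  unfold satProb
  set CS := constrainedSet k m n with hCS
  have h : ((CS ×ˢ (Finset.univ : Finset (Fin m → ZMod 2))).filter
      (fun p => ∃ x : Fin n → ZMod 2, p.1.mulVec x = p.2)).card ≤ CS.card * 2^n := by
    have : (CS ×ˢ (Finset.univ : Finset (Fin n → ZMod 2))).card = CS.card * 2^n := by
      rw [Finset.card_product, Finset.card_univ, Fintype.card_fun, ZMod.card, Fintype.card_fin]
    rw [← this]
    refine le_trans (Finset.card_le_card (t := (CS ×ˢ (Finset.univ : Finset (Fin n → ZMod 2))).image (fun p => (p.1, p.1.mulVec p.2))) ?_) Finset.card_image_le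
    rintro ⟨A, b⟩ hp
    rw [Finset.mem_filter, Finset.mem_product] at hp
    obtain ⟨⟨hA, _⟩, x, hx⟩ := hp
    rw [Finset.mem_image]
    exact ⟨(A, x), by rw [Finset.mem_product]; exact ⟨hA, Finset.mem_univ _⟩, Prod.ext rfl hx⟩
  have h' : (((CS ×ˢ (Finset.univ : Finset (Fin m → ZMod 2))).filter
      (fun p => ∃ x : Fin n → ZMod 2, p.1.mulVec x = p.2)).card : ℝ) ≤ CS.card * 2^n := by exact_mod_cast h
  rcases Nat.eq_zero_or_pos CS.card with h0 | h0
  · rw [h0, Nat.cast_zero, zero_mul, div_zero]; positivity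
  · have h0' : (0:ℝ) < CS.card := by exact_mod_cast h0
    rw [div_le_div_iff₀ (by positivity) (by positivity)]
    have := mul_le_mul_of_nonneg_right h' (by positivity : (0:ℝ) ≤ 2^m)
    linarith

theorem constrained_kxorsat_sharp_threshold
    (k : ℕ) (hk : 3 ≤ k) (m n : ℕ → ℕ)
    (hm : ∀ j, 0 < m j) (hn : ∀ j, 0 < n j)
    (hmtop : Filter.Tendsto m Filter.atTop Filter.atTop)
    (hntop : Filter.Tendsto n Filter.atTop Filter.atTop)
    (hliminf : 2 / (k : ℝ) < Filter.liminf (fun j => (m j : ℝ) / (n j : ℝ)) Filter.atTop)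
    (w : ℕ → ℝ) (hw : Filter.Tendsto w Filter.atTop Filter.atTop) :
    ((∀ j, (m j : ℝ) ≤ (n j : ℝ) - w j) →
      (∃ K : ℝ, ∀ᶠ j in Filter.atTop,
        1 - satProb k (m j) (n j) ≤
          K * (1 / (m j : ℝ) ^ (k - 2) + Real.exp (-0.69 * w j))) ∧
      Filter.Tendsto (fun j => satProb k (m j) (n j)) Filter.atTop (nhds 1)) ∧
    ((∀ j, (n j : ℝ) + w j ≤ (m j : ℝ)) →
      (∃ K : ℝ, ∀ᶠ j in Filter.atTop,
        satProb k (m j) (n j) ≤ K * (2 : ℝ) ^ (-(w j))) ∧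
      Filter.Tendsto (fun j => satProb k (m j) (n j)) Filter.atTop (nhds 0)) := by
  have hk0 : (0:ℝ) < k := by exact_mod_cast (by omega : 0 < k)
  have hk3 : (3:ℝ) ≤ k := by exact_mod_cast hk
  constructor
  · intro hmn
    have hmain : ∃ K : ℝ, ∀ᶠ j in Filter.atTop, 1 - satProb k (m j) (n j) ≤
          K * (1 / (m j : ℝ) ^ (k - 2) + Real.exp (-0.69 * w j)) := by
      obtain ⟨y, hy1, hy2⟩ := exists_between hliminf
      rw [div_lt_iff₀ hk0] at hy1
      have hev := Filter.eventually_lt_of_lt_liminf hy2 (Filter.isBoundedUnder_of ⟨0, fun j => by positivity⟩)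
      obtain ⟨K, hK, n0, H⟩ := case1 hk (κ0 := min (y*k) k) (lt_min hy1 (by linarith)) (min_le_right _ _)
      refine ⟨K, ?_⟩
      filter_upwards [hev, hw.eventually_ge_atTop 0, hntop.eventually_ge_atTop n0] with j h1 h2 h3
      have hnp : (0:ℝ) < n j := by exact_mod_cast hn j
      rw [lt_div_iff₀ hnp] at h1
      have hle : m j ≤ n j := by
        have := hmn j
        have h4 : (m j : ℝ) ≤ n j := by linarith
        exact_mod_cast h4
      have h5 : min (y*k) k * (n j : ℝ) ≤ k * m j := by
        calc min (y*k) k * (n j : ℝ) ≤ (y*k) * n j := mul_le_mul_of_nonneg_right (min_le_left _ _) hnp.le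
          _ = k * (y * n j) := by ring
          _ ≤ _ := mul_le_mul_of_nonneg_left h1.le hk0.le
      refine (H (m j) (n j) h3 h5 hle).trans ?_
      refine mul_le_mul_of_nonneg_left (add_le_add le_rfl (Real.exp_le_exp.2 ?_)) hK.le
      have := hmn j
      linarith
    refine ⟨hmain, ?_⟩
    obtain ⟨K, hK⟩ := hmain
    have hlim : Filter.Tendsto (fun j => 1 - K * (1 / (m j : ℝ) ^ (k - 2) + Real.exp (-0.69 * w j))) Filter.atTop (nhds 1) := by
      have t1 : Filter.Tendsto (fun j => 1 / (m j : ℝ) ^ (k - 2)) Filter.atTop (nhds 0) := by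
        have hmr : Filter.Tendsto (fun j => (m j : ℝ)) Filter.atTop Filter.atTop := tendsto_natCast_atTop_atTop.comp hmtop
        have := (Filter.tendsto_pow_atTop (α := ℝ) (by omega : k - 2 ≠ 0)).comp hmr
        simp only [one_div]
        exact this.inv_tendsto_atTop
      have t2 : Filter.Tendsto (fun j => Real.exp (-0.69 * w j)) Filter.atTop (nhds 0) := by
        apply Real.tendsto_exp_atBot.comp
        exact hw.const_mul_atTop_of_neg (by norm_num)
      have := ((t1.add t2).const_mul K).const_sub 1
      simpa using this
    refine tendsto_of_tendsto_of_tendsto_of_le_of_le' hlim tendsto_const_nhds ?_ (Filter.Eventually.of_forall fun j => satProb_le_one _ _ _)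
    filter_upwards [hK] with j hj
    linarith
  · intro hmn
    have hb : ∀ j, satProb k (m j) (n j) ≤ (2:ℝ)^(-(w j)) := by
      intro j
      refine (case2 k (m j) (n j)).trans ?_
      rw [← Real.rpow_natCast, ← Real.rpow_natCast, ← Real.rpow_sub (by norm_num)]
      apply Real.rpow_le_rpow_of_exponent_le (by norm_num)
      linarith [hmn j]
    refine ⟨⟨1, Filter.Eventually.of_forall fun j => by rw [one_mul]; exact hb j⟩, ?_⟩
    have hlim : Filter.Tendsto (fun j => (2:ℝ)^(-(w j))) Filter.atTop (nhds 0) := by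
      have e : ∀ j, (2:ℝ)^(-(w j)) = Real.exp (Real.log 2 * (-(w j))) := fun j => Real.rpow_def_of_pos (by norm_num) _
      simp only [e]
      apply Real.tendsto_exp_atBot.comp
      exact (Filter.tendsto_neg_atTop_atBot.comp hw).const_mul_atBot (Real.log_pos (by norm_num))
    exact squeeze_zero (fun j => satProb_nonneg _ _ _) hb hlim
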